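/- For every integer p ≥ 2 and every integer k with 1 ≤ k ≤ p−1, Σ_k^p = (k+1)π if k is odd and Σ_k^p = kπ if k is even; equivalently Σ_k^p = 2π⌊(k+1)/2⌋, which is the value σ_k(𝔻)·L(∂𝔻) for the unit disk 𝔻. (Bandle's theorem, extended in the paper to Lipschitz boundaries and L^∞ rotationally symmetric weights; Theorem 4.2.) -/

import Mathlib

open Set MeasureTheory Metric Filter Asymptotics
open scoped ENNReal Topology NNReal

noncomputable section

abbrev E2 : Type := EuclideanSpace ℝ (Fin 2)

def IsLipschitzDomain (Ω : Set E2) : Prop :=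
  IsOpen Ω ∧ IsConnected Ω ∧ Bornology.IsBounded Ω ∧
    ∀ p ∈ frontier Ω, ∃ (e : E2 ≃ₗᵢ[ℝ] E2) (K : ℝ≥0) (φ : ℝ → ℝ) (U : Set E2),
      LipschitzWith K φ ∧ IsOpen U ∧ p ∈ U ∧
      ∀ x ∈ U, (x ∈ Ω ↔ φ (e x 0) < e x 1)

def dirEnergy (Ω : Set E2) (f : E2 → ℝ) : ℝ≥0∞ :=
  ∫⁻ x in Ω, (‖fderiv ℝ f x‖₊ : ℝ≥0∞) ^ 2

def bdryInt (Γ : Set E2) (ρ f : E2 → ℝ) : ℝ≥0∞ :=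
  ∫⁻ x in Γ, ENNReal.ofReal (ρ x * (f x) ^ 2) ∂μH[1]

def rayleigh (Ω Γ : Set E2) (ρ f : E2 → ℝ) : ℝ≥0∞ :=
  dirEnergy Ω f / bdryInt Γ ρ f

def steklovMixed (Ω ΓS ΓD : Set E2) (ρ : E2 → ℝ) (k : ℕ) : ℝ≥0∞ :=
  ⨅ (V : Submodule ℝ (E2 → ℝ))
    (_ : Module.finrank ℝ V = k + 1)
    (_ : ∀ f ∈ V, ContDiff ℝ (⊤ : ℕ∞) f)
    (_ : ∀ f ∈ V, ∀ᶠ x in nhdsSet ΓD, f x = 0)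
    (_ : ∀ f ∈ V, Set.EqOn f 0 (closure Ω) → f = 0),
    ⨆ f ∈ V, ⨆ (_ : ¬ Set.EqOn f 0 (closure Ω)), rayleigh Ω ΓS ρ f

def steklovN (Ω ΓS : Set E2) (k : ℕ) : ℝ≥0∞ :=
  steklovMixed Ω ΓS ∅ (fun _ => 1) k

def steklovD (Ω ΓS ΓD : Set E2) (k : ℕ) : ℝ≥0∞ :=
  steklovMixed Ω ΓS ΓD (fun _ => 1) k

def steklovW (Ω : Set E2) (ρ : E2 → ℝ) (k : ℕ) : ℝ≥0∞ :=
  steklovMixed Ω (frontier Ω) ∅ ρ k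

def steklov (Ω : Set E2) (k : ℕ) : ℝ≥0∞ := steklovW Ω (fun _ => 1) k

def IsArc (A : Set E2) : Prop :=
  ∃ γ : ℝ → E2, ContinuousOn γ (Icc 0 1) ∧ InjOn γ (Icc 0 1) ∧ A = γ '' Icc 0 1

def IsLoop (A : Set E2) : Prop :=
  ∃ γ : ℝ → E2, ContinuousOn γ (Icc 0 1) ∧ InjOn γ (Ico 0 1) ∧ γ 0 = γ 1 ∧ A = γ '' Icc 0 1

def IsBoundaryPart (Γ : Set E2) : Prop :=
  ∃ F : Finset (Set E2), (∀ A ∈ F, IsArc A ∨ IsLoop A) ∧ Γ = ⋃₀ ↑F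

structure SteklovDecomp (Ω ΓS Γstar : Set E2) : Prop where
  partS : IsBoundaryPart ΓS
  partStar : IsBoundaryPart Γstar
  union_eq : ΓS ∪ Γstar = frontier Ω
  inter_finite : (ΓS ∩ Γstar).Finite
  nonemptyS : ΓS.Nonempty

/-- Rotation of the plane by angle θ about the origin. -/
def rotBy (θ : ℝ) : E2 → E2 := fun x =>
  (WithLp.equiv 2 (Fin 2 → ℝ)).symm
    ![Real.cos θ * x 0 - Real.sin θ * x 1, Real.sin θ * x 0 + Real.cos θ * x 1]

/-- The class 𝒟_p: simply connected bounded Lipschitz planar domains with rotational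
symmetry of order p about the origin, together with a nonnegative rotationally
symmetric L^∞ weight on the boundary that is positive on a set of positive H¹ measure. -/
def MemDp (p : ℕ) (Ω : Set E2) (ρ : E2 → ℝ) : Prop :=
  IsLipschitzDomain Ω ∧ SimplyConnectedSpace Ω ∧
  rotBy (2 * Real.pi / p) '' Ω = Ω ∧
  (∀ x, 0 ≤ ρ x) ∧
  (∃ C : ℝ, ∀ᵐ x ∂(μH[1].restrict (frontier Ω)), ρ x ≤ C) ∧
  0 < μH[1] {x ∈ frontier Ω | 0 < ρ x} ∧
  (∀ x ∈ frontier Ω, ρ (rotBy (2 * Real.pi / p) x) = ρ x)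

/-- The ρ-weighted length L_ρ(∂Ω). -/
def Lweight (Ω : Set E2) (ρ : E2 → ℝ) : ℝ≥0∞ :=
  ∫⁻ x in frontier Ω, ENNReal.ofReal (ρ x) ∂μH[1]

/-- Σ_k^p, the supremum of the normalized k-th Steklov eigenvalue over 𝒟_p. -/
def SigmaP (p k : ℕ) : ℝ≥0∞ :=
  ⨆ (Ω : Set E2) (ρ : E2 → ℝ) (_ : MemDp p Ω ρ), steklovW Ω ρ k * Lweight Ω ρ

/-! ### The Riemann mapping theorem -/

lemma exists_tendstoLocallyUniformlyOn_of_bounded {U : Set ℂ} (hU : IsOpen U)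
    {F : ℕ → ℂ → ℂ} (hF : ∀ n, DifferentiableOn ℂ (F n) U)
    (hb : ∀ n, MapsTo (F n) U (closedBall 0 1)) :
    ∃ f : ℂ → ℂ, TendstoLocallyUniformlyOn F f (hyperfilter ℕ : Filter ℕ) U := by
  have key : ∀ z ∈ U, ∃ w, Tendsto (fun n => F n z) (hyperfilter ℕ : Filter ℕ) (𝓝 w) := by
    intro z hz
    obtain ⟨w, -, hw⟩ := (isCompact_closedBall (0 : ℂ) 1).ultrafilter_le_nhds
      ((hyperfilter ℕ).map fun n => F n z)
      (by
        rw [le_principal_iff]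
        exact Filter.Eventually.of_forall (f := (hyperfilter ℕ : Filter ℕ)) fun n => hb n hz)
    exact ⟨w, hw⟩
  choose! f hf using key
  refine ⟨f, Metric.tendstoLocallyUniformlyOn_iff.2 fun ε hε x hx => ?_⟩
  obtain ⟨r, hr, hrU⟩ := Metric.isOpen_iff.1 hU x hx
  have lip : ∀ n, ∀ y ∈ ball x r, dist (F n y) (F n x) ≤ 2 / r * dist y x := by
    intro n y hy
    refine Complex.dist_le_div_mul_dist_of_mapsTo_ball ((hF n).mono hrU) ?_ hy
    intro z hz
    have h1 := hb n (hrU hz)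
    have h2 := hb n hx
    rw [mem_closedBall_zero_iff] at h1 h2
    rw [mem_closedBall, dist_eq_norm]
    linarith [norm_sub_le (F n z) (F n x)]
  have lipf : ∀ y ∈ ball x r, dist (f y) (f x) ≤ 2 / r * dist y x := fun y hy =>
    le_of_tendsto ((hf y (hrU hy)).dist (hf x hx)) (Eventually.of_forall fun n => lip n y hy)
  set δ := min r (ε * r / 8) with hδ
  have hδ0 : 0 < δ := lt_min hr (by positivity)
  refine ⟨ball x δ, mem_nhdsWithin_of_mem_nhds (ball_mem_nhds x hδ0), ?_⟩
  filter_upwards [Metric.tendsto_nhds.1 (hf x hx) (ε / 2) (by positivity)] with n hn y hy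
  have hyr : y ∈ ball x r := ball_subset_ball (min_le_left _ _) hy
  have hd : dist y x < ε * r / 8 := lt_of_lt_of_le (mem_ball.1 hy) (min_le_right _ _)
  have hd' : 2 / r * dist y x < ε / 4 := by
    rw [div_mul_eq_mul_div, div_lt_iff₀ hr]; linarith
  have := dist_triangle4 (f y) (f x) (F n x) (F n y)
  have h1 := lipf y hyr
  have h2 := lip n y hyr
  rw [dist_comm (F n y)] at h2
  rw [dist_comm (F n x) (f x)] at hn
  linarith

lemma injOn_of_tendstoLocallyUniformlyOn {U : Set ℂ} (hU : IsOpen U) (hUc : IsPreconnected U)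
    {F : ℕ → ℂ → ℂ} {f : ℂ → ℂ} {l : Filter ℕ} [l.NeBot]
    (hF : ∀ n, DifferentiableOn ℂ (F n) U) (hinj : ∀ n, InjOn (F n) U)
    (hlim : TendstoLocallyUniformlyOn F f l U) (hne : ∃ x ∈ U, ∃ y ∈ U, f x ≠ f y) :
    InjOn f U := by
  intro a ha b hb hab
  by_contra hne'
  have hfd : DifferentiableOn ℂ f U :=
    hlim.differentiableOn (Eventually.of_forall hF) hU
  have hga : AnalyticOnNhd ℂ (fun z => f z - f a) U :=
    (hfd.sub_const (f a)).analyticOnNhd hU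
  have hev : ∀ᶠ z in 𝓝[≠] b, f z - f a ≠ 0 := by
    by_contra hcon
    have hfr : ∃ᶠ z in 𝓝[≠] b, f z - f a = 0 :=
      (not_eventually.1 hcon).mono fun z hz => not_not.1 hz
    have := hga.eqOn_zero_of_preconnected_of_frequently_eq_zero hUc hb hfr
    obtain ⟨x, hx, y, hy, hxy⟩ := hne
    exact hxy ((sub_eq_zero.1 (this hx)).trans (sub_eq_zero.1 (this hy)).symm)
  rw [eventually_nhdsWithin_iff, Metric.eventually_nhds_iff_ball] at hev
  obtain ⟨r₁, hr₁, h₁⟩ := hev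
  obtain ⟨r₂, hr₂, h₂⟩ := Metric.isOpen_iff.1 hU b hb
  have hdist : 0 < dist a b := dist_pos.2 hne'
  set r := min (min r₁ r₂) (dist a b) / 2 with hr
  have hr0 : 0 < r := by positivity
  have hrr : r < min (min r₁ r₂) (dist a b) := half_lt_self (by positivity)
  have hr1 : r < r₁ := hrr.trans_le ((min_le_left _ _).trans (min_le_left _ _))
  have hr2 : r < r₂ := hrr.trans_le ((min_le_left _ _).trans (min_le_right _ _))
  have hr3 : r < dist a b := hrr.trans_le (min_le_right _ _)
  have hsub : closedBall b r ⊆ U := (closedBall_subset_ball hr2).trans h₂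
  have hsph : sphere b r ⊆ U := sphere_subset_closedBall.trans hsub
  obtain ⟨z₀, hz₀, hmin⟩ := (isCompact_sphere b r).exists_isMinOn
    (NormedSpace.sphere_nonempty.2 hr0.le)
    (((hfd.mono hsph).sub_const (f a)).continuousOn.norm)
  set ε := ‖f z₀ - f a‖ with hε
  have hε0 : 0 < ε := by
    rw [hε, norm_pos_iff]
    refine h₁ z₀ (sphere_subset_closedBall.trans (closedBall_subset_ball hr1) hz₀) ?_
    rintro rfl
    simp [hr0.ne] at hz₀
  have hunif := (tendstoLocallyUniformlyOn_iff_forall_isCompact hU).1 hlim _ hsub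
    (isCompact_closedBall b r)
  have hpt := hlim.tendsto_at ha
  rw [Metric.tendstoUniformlyOn_iff] at hunif
  obtain ⟨n, hn1, hn2⟩ := ((hunif (ε / 8) (by positivity)).and
    (Metric.tendsto_nhds.1 hpt (ε / 8) (by positivity))).exists
  have hnz : ∀ z ∈ closedBall b r, F n z - F n a ≠ 0 := by
    intro z hz h0
    have := hinj n (hsub hz) ha (sub_eq_zero.1 h0)
    subst this
    exact absurd (mem_closedBall.1 hz) (not_le.2 hr3)
  have hinv : DifferentiableOn ℂ (fun z => (F n z - F n a)⁻¹) (closedBall b r) :=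
    (((hF n).mono hsub).sub_const _).inv hnz
  have hdc : DiffContOnCl ℂ (fun z => (F n z - F n a)⁻¹) (ball b r) := by
    refine DifferentiableOn.diffContOnCl ?_
    rwa [closure_ball b hr0.ne']
  have hbound : ∀ z ∈ frontier (ball b r), ‖(F n z - F n a)⁻¹‖ ≤ 2 / ε := by
    intro z hz
    rw [frontier_ball b hr0.ne'] at hz
    have h3 : ε ≤ ‖f z - f a‖ := hmin hz
    have h4 := hn1 z (sphere_subset_closedBall hz)
    rw [dist_eq_norm] at h4 hn2
    have h5 : ‖f z - f a‖ ≤ ‖f z - F n z‖ + ‖F n z - F n a‖ + ‖F n a - f a‖ := by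
      have : f z - f a = (f z - F n z) + (F n z - F n a) + (F n a - f a) := by ring
      rw [this]; exact norm_add₃_le
    rw [norm_inv, inv_le_comm₀ (norm_pos_iff.2 (hnz z (sphere_subset_closedBall hz)))
      (by positivity), inv_div]
    linarith
  have hcen := Complex.norm_le_of_forall_mem_frontier_norm_le isBounded_ball hdc hbound
    (subset_closure (mem_ball_self hr0))
  have hbn := hnz b (mem_closedBall_self hr0.le)
  rw [norm_inv, inv_le_comm₀ (norm_pos_iff.2 hbn) (by positivity), inv_div] at hcen
  have h4 := hn1 b (mem_closedBall_self hr0.le)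
  rw [dist_eq_norm] at h4 hn2
  have h5 : ‖F n b - F n a‖ ≤ ‖f b - F n b‖ + ‖F n a - f a‖ := by
    have : F n b - F n a = -(f b - F n b) - (F n a - f a) := by rw [hab]; ring
    rw [this]
    exact (norm_sub_le _ _).trans (by rw [norm_neg])
  linarith

lemma moebius_norm_lt {a z : ℂ} (ha : ‖a‖ < 1) (hz : ‖z‖ < 1) :
    ‖(a - z) / (1 - (starRingEnd ℂ) a * z)‖ < 1 := by
  have hden : 1 - (starRingEnd ℂ) a * z ≠ 0 := by
    intro h
    have : ‖(starRingEnd ℂ) a * z‖ = 1 := by rw [← sub_eq_zero.1 h, norm_one]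
    rw [norm_mul, RCLike.norm_conj] at this
    nlinarith [norm_nonneg a, norm_nonneg z]
  rw [norm_div, div_lt_one (norm_pos_iff.2 hden), ← sq_lt_sq₀ (norm_nonneg _) (norm_nonneg _),
    Complex.sq_norm, Complex.sq_norm]
  have h1 : Complex.normSq a < 1 := by rw [← Complex.sq_norm]; nlinarith [norm_nonneg a]
  have h2 : Complex.normSq z < 1 := by rw [← Complex.sq_norm]; nlinarith [norm_nonneg z]
  have h3 : Complex.normSq (1 - (starRingEnd ℂ) a * z) - Complex.normSq (a - z)
      = (1 - Complex.normSq a) * (1 - Complex.normSq z) := by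
    simp only [Complex.normSq_apply, Complex.sub_re, Complex.sub_im, Complex.mul_re,
      Complex.mul_im, Complex.conj_re, Complex.conj_im, Complex.one_re, Complex.one_im]
    ring
  nlinarith [mul_pos (sub_pos.2 h1) (sub_pos.2 h2)]

lemma moebius_den_ne_zero {a z : ℂ} (ha : ‖a‖ < 1) (hz : ‖z‖ < 1) :
    1 - (starRingEnd ℂ) a * z ≠ 0 := by
  intro h
  have : ‖(starRingEnd ℂ) a * z‖ = 1 := by rw [← sub_eq_zero.1 h, norm_one]
  rw [norm_mul, RCLike.norm_conj] at this
  nlinarith [norm_nonneg a, norm_nonneg z]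

lemma moebius_inj {a z w : ℂ} (ha : ‖a‖ < 1) (hz : ‖z‖ < 1) (hw : ‖w‖ < 1)
    (h : (a - z) / (1 - (starRingEnd ℂ) a * z) = (a - w) / (1 - (starRingEnd ℂ) a * w)) :
    z = w := by
  rw [div_eq_div_iff (moebius_den_ne_zero ha hz) (moebius_den_ne_zero ha hw)] at h
  have h1 : (z - w) * ((starRingEnd ℂ) a * a - 1) = 0 := by linear_combination h
  rcases mul_eq_zero.1 h1 with h2 | h2
  · exact sub_eq_zero.1 h2
  · exfalso
    rw [← Complex.normSq_eq_conj_mul_self, ← Complex.ofReal_one, ← Complex.ofReal_sub,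
      Complex.ofReal_eq_zero, ← Complex.sq_norm] at h2
    nlinarith [norm_nonneg a]

lemma hasDerivAt_moebius_comp {a : ℂ} {f : ℂ → ℂ} {f' x : ℂ} (ha : ‖a‖ < 1) (hfx : ‖f x‖ < 1)
    (hf : HasDerivAt f f' x) :
    HasDerivAt (fun z => (a - f z) / (1 - (starRingEnd ℂ) a * f z))
      (-(1 - (starRingEnd ℂ) a * a) * f' / (1 - (starRingEnd ℂ) a * f x) ^ 2) x := by
  have h := (hf.const_sub a).div ((hf.const_mul ((starRingEnd ℂ) a)).const_sub 1)
    (moebius_den_ne_zero ha hfx)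
  refine h.congr_deriv ?_
  congr 1
  ring

/-- Koebe's square-root construction. -/
lemma exists_larger_deriv {U : Set ℂ} (hU : IsOpen U) (hsc : IsSimplyConnected U)
    {f : ℂ → ℂ} {x₀ : ℂ} (hx₀ : x₀ ∈ U) (hfd : DifferentiableOn ℂ f U)
    (hfm : MapsTo f U (ball 0 1)) (hfi : InjOn f U) (hf0 : f x₀ = 0) (hf' : deriv f x₀ ≠ 0)
    {w : ℂ} (hw : ‖w‖ < 1) (hwf : ∀ z ∈ U, f z ≠ w) :
    ∃ g : ℂ → ℂ, DifferentiableOn ℂ g U ∧ MapsTo g U (ball 0 1) ∧ InjOn g U ∧ g x₀ = 0 ∧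
      ‖deriv f x₀‖ < ‖deriv g x₀‖ := by
  have hfn : ∀ z ∈ U, ‖f z‖ < 1 := fun z hz => mem_ball_zero_iff.1 (hfm hz)
  set q : ℂ → ℂ := fun z => (w - f z) / (1 - (starRingEnd ℂ) w * f z) with hq
  have hqd : ∀ z ∈ U, HasDerivAt q
      (-(1 - (starRingEnd ℂ) w * w) * deriv f z / (1 - (starRingEnd ℂ) w * f z) ^ 2) z :=
    fun z hz => hasDerivAt_moebius_comp hw (hfn z hz)
      (hfd.differentiableAt (hU.mem_nhds hz)).hasDerivAt
  have hqc : ContinuousOn q U := fun z hz => (hqd z hz).continuousAt.continuousWithinAt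
  have hq0 : ∀ z ∈ U, q z ≠ 0 := fun z hz =>
    div_ne_zero (sub_ne_zero.2 (hwf z hz).symm) (moebius_den_ne_zero hw (hfn z hz))
  obtain ⟨h, hc, hpow⟩ := Complex.exists_continuousOn_pow_eq hsc hU hqc
    (by rintro ⟨z, hz, h0⟩; exact hq0 z hz h0) (n := 2) two_ne_zero
  have hh0 : ∀ z ∈ U, h z ≠ 0 := by
    intro z hz h0
    apply hq0 z hz
    rw [← hpow z, h0]; norm_num
  have hhn : ∀ z ∈ U, ‖h z‖ < 1 := by
    intro z hz
    have h1 : ‖h z‖ ^ 2 < 1 := by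
      rw [← norm_pow, hpow]; exact moebius_norm_lt hw (hfn z hz)
    nlinarith [norm_nonneg (h z)]
  have hhd : ∀ z ∈ U, HasDerivAt h ((-(1 - (starRingEnd ℂ) w * w) * deriv f z /
      (1 - (starRingEnd ℂ) w * f z) ^ 2) / (2 * h z)) z := by
    intro z hz
    have h1 : HasDerivAt (fun y : ℂ => y ^ 2) (2 * h z) (h z) := by
      simpa using hasDerivAt_pow 2 (h z)
    exact HasDerivAt.of_comp_left (hc.continuousAt (hU.mem_nhds hz)) h1 (hqd z hz)
      (mul_ne_zero two_ne_zero (hh0 z hz)) (Eventually.of_forall hpow)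
  set b := h x₀ with hb
  have hbn : ‖b‖ < 1 := hhn x₀ hx₀
  have hb2 : b ^ 2 = w := by rw [hb, hpow]; simp [hq, hf0]
  have hb0 : 0 < ‖b‖ := norm_pos_iff.2 (hh0 x₀ hx₀)
  have hgd : ∀ z ∈ U, HasDerivAt (fun z => (b - h z) / (1 - (starRingEnd ℂ) b * h z)) _ z :=
    fun z hz => hasDerivAt_moebius_comp hbn (hhn z hz) (hhd z hz)
  refine ⟨fun z => (b - h z) / (1 - (starRingEnd ℂ) b * h z),
    fun z hz => (hgd z hz).differentiableAt.differentiableWithinAt,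
    fun z hz => mem_ball_zero_iff.2 (moebius_norm_lt hbn (hhn z hz)), ?_, by simp [hb], ?_⟩
  · intro y hy z hz hyz
    have h1 : h y = h z := moebius_inj hbn (hhn y hy) (hhn z hz) hyz
    have h2 : q y = q z := by rw [← hpow, ← hpow, h1]
    exact hfi hy hz (moebius_inj hw (hfn y hy) (hfn z hz) h2)
  · rw [(hgd x₀ hx₀).deriv, ← hb, hf0]
    have cw : (starRingEnd ℂ) w * w = ((‖b‖ ^ 4 : ℝ) : ℂ) := by
      rw [← hb2, ← Complex.normSq_eq_conj_mul_self, ← Complex.sq_norm, norm_pow]; ring_nf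
    have cb : (starRingEnd ℂ) b * b = ((‖b‖ ^ 2 : ℝ) : ℂ) := by
      rw [← Complex.normSq_eq_conj_mul_self, ← Complex.sq_norm]
    rw [cw, cb]
    have r1 : (1 : ℂ) - ((‖b‖ ^ 4 : ℝ) : ℂ) = ((1 - ‖b‖ ^ 4 : ℝ) : ℂ) := by push_cast; ring
    have r2 : (1 : ℂ) - ((‖b‖ ^ 2 : ℝ) : ℂ) = ((1 - ‖b‖ ^ 2 : ℝ) : ℂ) := by push_cast; ring
    have p2 : 0 < 1 - ‖b‖ ^ 2 := by nlinarith
    have p4 : 0 < 1 - ‖b‖ ^ 4 := by nlinarith [sq_nonneg ‖b‖]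
    rw [r1, r2]
    simp only [norm_div, norm_mul, norm_neg, norm_pow, mul_zero, sub_zero, one_pow,
      div_one, Complex.norm_real, Real.norm_of_nonneg p2.le, Real.norm_of_nonneg p4.le,
      Complex.norm_ofNat]
    have hd0 : 0 < ‖deriv f x₀‖ := norm_pos_iff.2 hf'
    have : (1 - ‖b‖ ^ 2) * ((1 - ‖b‖ ^ 4) * ‖deriv f x₀‖ / (2 * ‖b‖)) / (1 - ‖b‖ ^ 2) ^ 2
        = ‖deriv f x₀‖ * ((1 + ‖b‖ ^ 2) / (2 * ‖b‖)) := by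
      field_simp
      ring
    rw [this]
    have h1 : 1 < (1 + ‖b‖ ^ 2) / (2 * ‖b‖) := by
      rw [lt_div_iff₀ (by positivity)]; nlinarith
    nlinarith

lemma nhds_le_map_of_injOn {U : Set ℂ} (hU : IsOpen U) {f : ℂ → ℂ}
    (hfd : DifferentiableOn ℂ f U) (hfi : InjOn f U) {z : ℂ} (hz : z ∈ U) :
    𝓝 (f z) ≤ map f (𝓝 z) := by
  have ha : AnalyticAt ℂ f z := hfd.analyticAt (hU.mem_nhds hz)
  refine ha.eventually_constant_or_nhds_le_map_nhds.resolve_left fun hc => ?_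
  have h1 : ∀ᶠ y in 𝓝[≠] z, f y = f z ∧ y ∈ U ∧ y ≠ z :=
    (hc.filter_mono nhdsWithin_le_nhds).and
      (Filter.Eventually.and (mem_nhdsWithin_of_mem_nhds (hU.mem_nhds hz)) self_mem_nhdsWithin)
  obtain ⟨y, h2, h3, h4⟩ := h1.exists
  exact h4 (hfi h3 hz h2)

theorem exists_bijOn_unitBall {U : Set ℂ} (hU : IsOpen U) (hsc : IsSimplyConnected U)
    (hbd : Bornology.IsBounded U) {x₀ : ℂ} (hx₀ : x₀ ∈ U) :
    ∃ f : ℂ → ℂ, DifferentiableOn ℂ f U ∧ BijOn f U (ball 0 1) ∧ f x₀ = 0 ∧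
      deriv f x₀ ≠ 0 := by
  set S : Set (ℂ → ℂ) := {f | DifferentiableOn ℂ f U ∧ MapsTo f U (ball 0 1) ∧ InjOn f U ∧
    f x₀ = 0} with hS
  obtain ⟨R, hR0, hR⟩ := hbd.subset_ball_lt 0 x₀
  have hid : ∀ z, HasDerivAt (fun z : ℂ => (z - x₀) / (R : ℂ)) (1 / (R : ℂ)) z := fun z =>
    ((hasDerivAt_id z).sub_const x₀).div_const _
  have hR0' : (R : ℂ) ≠ 0 := by exact_mod_cast hR0.ne'
  have hidS : (fun z : ℂ => (z - x₀) / (R : ℂ)) ∈ S := by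
    refine ⟨fun z _ => (hid z).differentiableAt.differentiableWithinAt, fun z hz => ?_,
      fun y _ z _ hyz => ?_, by simp⟩
    · rw [mem_ball_zero_iff, norm_div, Complex.norm_real, Real.norm_of_nonneg hR0.le,
        div_lt_one hR0, ← dist_eq_norm]
      exact hR hz
    · have h1 := (div_left_inj' hR0').1 hyz
      exact sub_left_inj.1 h1
  obtain ⟨r, hr0, hr⟩ := Metric.isOpen_iff.1 hU x₀ hx₀
  have hbdd : BddAbove ((fun f : ℂ → ℂ => ‖deriv f x₀‖) '' S) := by
    refine ⟨1 / r, ?_⟩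
    rintro _ ⟨f, ⟨hd, hm, -, h0⟩, rfl⟩
    refine Complex.norm_deriv_le_div_of_mapsTo_ball (hd.mono hr) (fun z hz => ?_) hr0
    rw [h0]
    exact ball_subset_closedBall (hm (hr hz))
  have hneS : ((fun f : ℂ → ℂ => ‖deriv f x₀‖) '' S).Nonempty := ⟨_, _, hidS, rfl⟩
  set M := sSup ((fun f : ℂ → ℂ => ‖deriv f x₀‖) '' S) with hM
  have hMpos : 0 < M := by
    refine lt_of_lt_of_le ?_ (le_csSup hbdd ⟨_, hidS, rfl⟩)
    show 0 < ‖deriv _ x₀‖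
    rw [(hid x₀).deriv]
    exact norm_pos_iff.2 (one_div_ne_zero hR0')
  obtain ⟨u, -, hu, hum⟩ := exists_seq_tendsto_sSup hneS hbdd
  choose F hFS hFu using hum
  obtain ⟨f, hf⟩ := exists_tendstoLocallyUniformlyOn_of_bounded hU (F := F)
    (fun n => (hFS n).1) (fun n => (hFS n).2.1.mono_right ball_subset_closedBall)
  have hle : ((hyperfilter ℕ : Filter ℕ)) ≤ atTop := Nat.hyperfilter_le_atTop
  have hFd : ∀ n, DifferentiableOn ℂ (F n) U := fun n => (hFS n).1
  have hfd : DifferentiableOn ℂ f U := hf.differentiableOn (Eventually.of_forall hFd) hU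
  have hderiv : ‖deriv f x₀‖ = M := by
    have h1 := ((hf.deriv (Eventually.of_forall hFd) hU).tendsto_at hx₀).norm
    have h2 : Tendsto (fun n => ‖deriv (F n) x₀‖) (hyperfilter ℕ : Filter ℕ) (𝓝 M) :=
      (hu.mono_left hle).congr fun n => (hFu n).symm
    exact tendsto_nhds_unique h1 h2
  have hd0 : deriv f x₀ ≠ 0 := by
    rw [← norm_pos_iff, hderiv]; exact hMpos
  have hf0 : f x₀ = 0 := by
    refine tendsto_nhds_unique (hf.tendsto_at hx₀) ?_
    simp_rw [fun n => (hFS n).2.2.2]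
    exact tendsto_const_nhds
  have hfne : ∃ x ∈ U, ∃ y ∈ U, f x ≠ f y := by
    by_contra! hcon
    apply hd0
    have : f =ᶠ[𝓝 x₀] fun _ => f x₀ := by
      filter_upwards [hU.mem_nhds hx₀] with y hy using hcon y hy x₀ hx₀
    rw [this.deriv_eq, deriv_const]
  have hpc : IsPreconnected U := hsc.isPathConnected.isConnected.isPreconnected
  have hfi : InjOn f U := injOn_of_tendstoLocallyUniformlyOn hU hpc hFd
    (fun n => (hFS n).2.2.1) hf hfne
  have hfc : MapsTo f U (closedBall 0 1) := fun z hz =>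
    isClosed_closedBall.mem_of_tendsto (hf.tendsto_at hz)
      (Eventually.of_forall fun n => ball_subset_closedBall ((hFS n).2.1 hz))
  have hfm : MapsTo f U (ball 0 1) := by
    intro z hz
    have h1 : f '' U ∈ 𝓝 (f z) :=
      nhds_le_map_of_injOn hU hfd hfi hz (image_mem_map (hU.mem_nhds hz))
    have h2 : f z ∈ interior (closedBall (0 : ℂ) 1) :=
      mem_interior_iff_mem_nhds.2 (mem_of_superset h1 hfc.image_subset)
    rwa [interior_closedBall _ one_ne_zero] at h2
  refine ⟨f, hfd, ⟨hfm, hfi, fun w hw => ?_⟩, hf0, hd0⟩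
  by_contra hcon
  obtain ⟨g, hg1, hg2, hg3, hg4, hg5⟩ := exists_larger_deriv hU hsc hx₀ hfd hfm hfi hf0 hd0
    (mem_ball_zero_iff.1 hw) (fun z hz h => hcon ⟨z, hz, h⟩)
  have := le_csSup hbdd ⟨g, ⟨hg1, hg2, hg3, hg4⟩, rfl⟩
  rw [← hM, ← hderiv] at this
  exact absurd hg5 (not_lt.2 this)

lemma continuousOn_invFunOn {U : Set ℂ} (hU : IsOpen U) {f : ℂ → ℂ}
    (hfd : DifferentiableOn ℂ f U) (hf : BijOn f U (ball 0 1)) :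
    ContinuousOn (Function.invFunOn f U) (ball 0 1) := by
  intro w hw
  obtain ⟨z, hz, rfl⟩ := hf.surjOn hw
  refine ContinuousAt.continuousWithinAt ?_
  have hl : LeftInvOn (Function.invFunOn f U) f U := hf.injOn.leftInvOn_invFunOn
  rw [ContinuousAt, hl hz]
  refine Tendsto.mono_left ?_ (nhds_le_map_of_injOn hU hfd hf.injOn hz)
  rw [tendsto_map'_iff]
  refine tendsto_id.congr' ?_
  filter_upwards [hU.mem_nhds hz] with y hy using (hl hy).symm

lemma differentiableOn_invFunOn {U : Set ℂ} (hU : IsOpen U) {f : ℂ → ℂ}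
    (hfd : DifferentiableOn ℂ f U) (hf : BijOn f U (ball 0 1)) :
    DifferentiableOn ℂ (Function.invFunOn f U) (ball 0 1) := by
  set φ := Function.invFunOn f U with hφ
  have hc := continuousOn_invFunOn hU hfd hf
  have hl : LeftInvOn φ f U := hf.injOn.leftInvOn_invFunOn
  have hr : RightInvOn φ f (ball 0 1) := hf.surjOn.rightInvOn_invFunOn
  have hmt : MapsTo φ (ball 0 1) U := hf.surjOn.mapsTo_invFunOn
  have hat : ∀ w ∈ ball (0 : ℂ) 1, deriv f (φ w) ≠ 0 → DifferentiableAt ℂ φ w := by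
    intro w hw hd
    refine (HasDerivAt.of_local_left_inverse (hc.continuousAt (isOpen_ball.mem_nhds hw))
      (hfd.differentiableAt (hU.mem_nhds (hmt hw))).hasDerivAt hd ?_).differentiableAt
    filter_upwards [isOpen_ball.mem_nhds hw] with y hy using hr hy
  intro w hw
  obtain ⟨z, hz, rfl⟩ := hf.surjOn hw
  refine DifferentiableAt.differentiableWithinAt ?_
  have hda : AnalyticAt ℂ (deriv f) z := (hfd.analyticAt (hU.mem_nhds hz)).deriv
  have hnz : ∀ᶠ y in 𝓝[≠] z, deriv f y ≠ 0 := by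
    refine hda.eventually_eq_zero_or_eventually_ne_zero.resolve_left fun h0 => ?_
    obtain ⟨r, hr0, hrb⟩ := Metric.eventually_nhds_iff_ball.1 (h0.and (hU.mem_nhds hz))
    have hcst : ∀ y ∈ ball z r, f y = f z := fun y hy =>
      (convex_ball z r).is_const_of_fderivWithin_eq_zero (𝕜 := ℂ)
        (hfd.mono fun y hy => (hrb y hy).2)
        (fun y hy => by
          rw [fderivWithin_of_isOpen isOpen_ball hy]
          ext
          simpa using (hrb y hy).1) hy (mem_ball_self hr0)
    have hm : z + (r / 2 : ℝ) ∈ ball z r := by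
      rw [mem_ball, dist_eq_norm, add_sub_cancel_left, Complex.norm_real,
        Real.norm_of_nonneg (by positivity)]
      linarith
    have := hf.injOn (hrb _ hm).2 hz (hcst _ hm)
    rw [add_eq_left] at this
    have : r / 2 = 0 := by exact_mod_cast this
    linarith
  refine (Complex.analyticAt_of_differentiable_on_punctured_nhds_of_continuousAt ?_
    (hc.continuousAt (isOpen_ball.mem_nhds hw))).differentiableAt
  have htend : Tendsto φ (𝓝[≠] (f z)) (𝓝[≠] z) := by
    refine tendsto_nhdsWithin_iff.2 ⟨?_, ?_⟩
    · have : Tendsto φ (𝓝 (f z)) (𝓝 (φ (f z))) :=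
        (hc.continuousAt (isOpen_ball.mem_nhds hw)).tendsto
      rw [hl hz] at this
      exact this.mono_left nhdsWithin_le_nhds
    · filter_upwards [self_mem_nhdsWithin,
        mem_nhdsWithin_of_mem_nhds (isOpen_ball.mem_nhds hw)] with y hy hyb h
      apply hy
      rw [mem_singleton_iff, ← hr hyb, mem_singleton_iff.1 h]
  filter_upwards [htend.eventually hnz,
    mem_nhdsWithin_of_mem_nhds (isOpen_ball.mem_nhds hw)] with y hy hyb using hat y hyb hy

/-- The Riemann map of a bounded simply connected domain with a rotational symmetry can be
chosen to commute with the rotation. -/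
theorem exists_equivariant_riemann_map {U : Set ℂ} (hU : IsOpen U) (hsc : IsSimplyConnected U)
    (hbd : Bornology.IsBounded U) (h0 : (0 : ℂ) ∈ U) {ω : ℂ} (hω : ‖ω‖ = 1)
    (hsym : ∀ z ∈ U, ω * z ∈ U) :
    ∃ f : ℂ → ℂ, DifferentiableOn ℂ f U ∧ BijOn f U (ball 0 1) ∧
      ContinuousOn (Function.invFunOn f U) (ball 0 1) ∧ ∀ z ∈ U, f (ω * z) = ω * f z := by
  obtain ⟨f, hfd, hf, hf0, hd0⟩ := exists_bijOn_unitBall hU hsc hbd h0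
  refine ⟨f, hfd, hf, continuousOn_invFunOn hU hfd hf, ?_⟩
  set φ := Function.invFunOn f U with hφ
  have hl : LeftInvOn φ f U := hf.injOn.leftInvOn_invFunOn
  have hmt : MapsTo φ (ball 0 1) U := hf.surjOn.mapsTo_invFunOn
  have hφd := differentiableOn_invFunOn hU hfd hf
  have hω0 : ω ≠ 0 := by rintro rfl; simp at hω
  have hφ0 : φ 0 = 0 := by
    have := hl h0
    rwa [hf0] at this
  set k : ℂ → ℂ := fun w => ω⁻¹ * f (ω * φ w) with hk
  have hkd : DifferentiableOn ℂ k (ball 0 1) :=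
    (hfd.comp (hφd.const_mul ω) fun w hw => hsym _ (hmt hw)).const_mul _
  have hk0 : k 0 = 0 := by simp [hk, hφ0, hf0]
  have hmaps : MapsTo k (ball 0 1) (closedBall (k 0) 1) := by
    intro w hw
    rw [hk0, mem_closedBall_zero_iff, norm_mul, norm_inv, hω, inv_one, one_mul]
    exact (mem_ball_zero_iff.1 (hf.mapsTo (hsym _ (hmt hw)))).le
  have hb0 : (0 : ℂ) ∈ ball (0 : ℂ) 1 := mem_ball_self one_pos
  have hfat : HasDerivAt f (deriv f 0) 0 := (hfd.differentiableAt (hU.mem_nhds h0)).hasDerivAt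
  have hφat : HasDerivAt φ (deriv φ 0) 0 :=
    (hφd.differentiableAt (isOpen_ball.mem_nhds hb0)).hasDerivAt
  have hprod : deriv f 0 * deriv φ 0 = 1 := by
    have h1 : HasDerivAt (f ∘ φ) (deriv f 0 * deriv φ 0) 0 :=
      HasDerivAt.comp 0 (by rw [hφ0]; exact hfat) hφat
    have h2 : HasDerivAt (f ∘ φ) 1 0 := by
      refine (hasDerivAt_id (0 : ℂ)).congr_of_eventuallyEq ?_
      filter_upwards [isOpen_ball.mem_nhds hb0] with w hw
      exact hf.surjOn.rightInvOn_invFunOn hw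
    exact h1.unique h2
  have hk' : deriv k 0 = 1 := by
    have h1 : HasDerivAt (fun w => ω * φ w) (ω * deriv φ 0) 0 := hφat.const_mul ω
    have h2 : HasDerivAt (f ∘ fun w => ω * φ w) (deriv f 0 * (ω * deriv φ 0)) 0 :=
      HasDerivAt.comp 0 (by rw [hφ0, mul_zero]; exact hfat) h1
    have h3 := (h2.const_mul ω⁻¹).deriv
    rw [show deriv k 0 = _ from h3]
    field_simp
    exact hprod
  have heq := Complex.affine_of_mapsTo_ball_of_norm_dslope_eq_div hkd hmaps hb0
    (by rw [dslope_same, hk']; simp)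
  intro z hz
  have h1 := heq (hf.mapsTo hz)
  simp only [hk0, dslope_same, hk', sub_zero, smul_eq_mul, mul_one, zero_add] at h1
  rw [hk] at h1
  simp only [hl hz] at h1
  field_simp at h1
  exact h1

lemma pow_mul_mem {U : Set ℂ} {ω : ℂ} (hsym : ∀ z ∈ U, ω * z ∈ U) (j : ℕ) {z : ℂ} (hz : z ∈ U) :
    ω ^ j * z ∈ U := by
  induction j with
  | zero => simpa using hz
  | succ j ih =>
    have := hsym _ ih
    rwa [← mul_assoc, ← pow_succ'] at this

lemma zero_mem_of_isSimplyConnected {U : Set ℂ} (hU : IsOpen U) (hsc : IsSimplyConnected U)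
    {p : ℕ} (hp : 2 ≤ p)
    (hsym : ∀ z ∈ U, Complex.exp (2 * Real.pi * Complex.I / p) * z ∈ U) : (0 : ℂ) ∈ U := by
  by_contra h0
  obtain ⟨L, hLc, hL⟩ := Complex.exists_continuousOn_eqOn_exp_comp hsc hU
    (g := fun z => z) continuousOn_id (by simpa using h0)
  set ω := Complex.exp (2 * Real.pi * Complex.I / p) with hω
  have hpi : (2 * Real.pi * Complex.I : ℂ) ≠ 0 := Complex.two_pi_I_ne_zero
  have hp0 : (p : ℂ) ≠ 0 := by exact_mod_cast (by omega : p ≠ 0)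
  have key : ∀ z ∈ U, ∃ n : ℤ,
      L (ω * z) - L z - 2 * Real.pi * Complex.I / p = n * (2 * Real.pi * Complex.I) := by
    intro z hz
    rw [← Complex.exp_eq_one_iff, Complex.exp_sub, Complex.exp_sub]
    have h1 : Complex.exp (L (ω * z)) = ω * z := hL (hsym z hz)
    have h2 : Complex.exp (L z) = z := hL hz
    have hz0 : z ≠ 0 := fun h => h0 (h ▸ hz)
    have hω0 : ω ≠ 0 := Complex.exp_ne_zero _
    rw [h1, h2, ← hω]
    field_simp
  choose! n hn using key
  have hnc : ContinuousOn n U := by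
    rw [Int.isClosedEmbedding_coe_real.isInducing.continuousOn_iff]
    have hcont : ContinuousOn (fun z => ((L (ω * z) - L z - 2 * Real.pi * Complex.I / p) /
        (2 * Real.pi * Complex.I)).re) U := by
      refine Complex.continuous_re.comp_continuousOn (ContinuousOn.div_const ?_ _)
      exact ((hLc.comp (by fun_prop) hsym).sub hLc).sub continuousOn_const
    refine hcont.congr fun z hz => ?_
    simp only [Function.comp_apply]
    rw [hn z hz, mul_div_assoc, div_self hpi, mul_one]
    simp
  have hpc : IsPreconnected U := hsc.isPathConnected.isConnected.isPreconnected
  obtain ⟨z₀, hz₀⟩ := hsc.nonempty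
  have hiter : ∀ j : ℕ, L (ω ^ j * z₀) - L z₀
      = j * (n z₀ * (2 * Real.pi * Complex.I) + 2 * Real.pi * Complex.I / p) := by
    intro j
    induction j with
    | zero => simp
    | succ j ih =>
      have hm := pow_mul_mem hsym j hz₀
      have h1 := hn _ hm
      rw [hpc.constant hnc hm hz₀] at h1
      rw [pow_succ', mul_assoc]
      push_cast
      linear_combination h1 + ih
  have h1 := hiter p
  have hωp : ω ^ p = 1 := by
    rw [hω, ← Complex.exp_nat_mul, mul_div_cancel₀ _ hp0, Complex.exp_two_pi_mul_I]
  rw [hωp, one_mul, sub_self] at h1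
  have h2 : (p * n z₀ + 1 : ℂ) * (2 * Real.pi * Complex.I) = 0 := by
    rw [h1]
    field_simp
  have h3 : (p * n z₀ + 1 : ℂ) = 0 := (mul_eq_zero.1 h2).resolve_right hpi
  have h4 : (p : ℤ) * n z₀ = -1 := by
    have : ((p : ℤ) * n z₀ + 1 : ℂ) = 0 := by exact_mod_cast h3
    have : (p : ℤ) * n z₀ + 1 = 0 := by exact_mod_cast this
    linarith
  have h5 : (p : ℤ) ∣ 1 := ⟨-n z₀, by linarith⟩
  have h6 := Int.le_of_dvd one_pos h5
  omega

/-- The directions pointing uniformly into `U` near `x`. -/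
def inwardCone {E : Type*} [NormedAddCommGroup E] [NormedSpace ℝ E] (U : Set E) (x : E) : Set E :=
  {v | ∃ δ > 0, ∀ y ∈ closure U, dist y x < δ → ∀ w, dist w v < δ → ∀ s ∈ Ioo (0 : ℝ) δ,
    y + s • w ∈ U}

section InwardCone

variable {E : Type*} [NormedAddCommGroup E] [NormedSpace ℝ E] {U : Set E}

lemma convex_inwardCone (x : E) : Convex ℝ (inwardCone U x) := by
  rw [convex_iff_forall_pos]
  rintro v₁ ⟨δ₁, hδ₁, h₁⟩ v₂ ⟨δ₂, hδ₂, h₂⟩ a b ha hb hab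
  have hv : 0 < ‖v₁‖ + δ₁ := by positivity
  refine ⟨min (min δ₁ δ₂ / 2) (δ₂ / 2 / (‖v₁‖ + δ₁)), by positivity, ?_⟩
  intro y hy hyx w hw s ⟨hs0, hs⟩
  rw [lt_min_iff] at hyx hw hs
  have hm1 := min_le_left δ₁ δ₂
  have hm2 := min_le_right δ₁ δ₂
  set d := w - (a • v₁ + b • v₂) with hd
  have hdn : ‖d‖ < min δ₁ δ₂ / 2 := by rw [hd, ← dist_eq_norm]; exact hw.1
  have ha1 : a ≤ 1 := by linarith
  have hb1 : b ≤ 1 := by linarith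
  have hsa : s * a ≤ s := mul_le_of_le_one_right hs0.le ha1
  have hsb : s * b ≤ s := mul_le_of_le_one_right hs0.le hb1
  have e1 : y + (s * a) • (v₁ + d) ∈ U := by
    refine h₁ y hy (by linarith) _ ?_ _ ⟨by positivity, by linarith⟩
    rw [dist_eq_norm, add_sub_cancel_left]; linarith
  have e2 : y + (s * a) • (v₁ + d) + (s * b) • (v₂ + d) ∈ U := by
    refine h₂ _ (subset_closure e1) ?_ _ ?_ _ ⟨by positivity, by linarith⟩
    · have h3 : dist (y + (s * a) • (v₁ + d)) y < δ₂ / 2 := by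
        rw [dist_eq_norm, add_sub_cancel_left, norm_smul, Real.norm_of_nonneg (by positivity)]
        have h4 : ‖v₁ + d‖ ≤ ‖v₁‖ + δ₁ := (norm_add_le _ _).trans (by linarith)
        have h5 : s * (‖v₁‖ + δ₁) < δ₂ / 2 := (lt_div_iff₀ hv).1 hs.2
        calc s * a * ‖v₁ + d‖ ≤ s * (‖v₁‖ + δ₁) := by gcongr
          _ < _ := h5
      linarith [dist_triangle (y + (s * a) • (v₁ + d)) y x]
    · rw [dist_eq_norm, add_sub_cancel_left]; linarith
  convert e2 using 1
  have hw' : w = a • v₁ + b • v₂ + (a + b) • d := by rw [hab, one_smul, hd]; abel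
  rw [hw']
  module

lemma eventually_mem_inwardCone {x v : E} (hv : v ∈ inwardCone U x) :
    ∀ᶠ y in 𝓝 x, v ∈ inwardCone U y := by
  obtain ⟨δ, hδ, h⟩ := hv
  filter_upwards [Metric.ball_mem_nhds x (half_pos hδ)] with z hz
  refine ⟨δ / 2, half_pos hδ, fun y hy hyz w hw s hs => h y hy ?_ w (by linarith) s
    ⟨hs.1, by linarith [hs.2]⟩⟩
  linarith [dist_triangle y z x, mem_ball.1 hz]

lemma mem_inwardCone_of_notMem_frontier (hU : IsOpen U) {x : E} (hx : x ∉ frontier U) :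
    0 ∈ inwardCone U x := by
  by_cases hxc : x ∈ closure U
  · have hxU : x ∈ U := by
      by_contra h
      exact hx ⟨hxc, by rwa [hU.interior_eq]⟩
    have ht : Tendsto (fun q : E × E × ℝ => q.1 + q.2.2 • q.2.1) (𝓝 (x, 0, 0)) (𝓝 x) := by
      have : Continuous (fun q : E × E × ℝ => q.1 + q.2.2 • q.2.1) := by fun_prop
      simpa using this.tendsto (x, 0, 0)
    obtain ⟨δ, hδ, h⟩ := Metric.eventually_nhds_iff.1 (ht.eventually (hU.mem_nhds hxU))
    refine ⟨δ, hδ, fun y _ hyx w hw s hs => @h (y, w, s) ?_⟩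
    rw [Prod.dist_eq, Prod.dist_eq, max_lt_iff, max_lt_iff]
    refine ⟨hyx, hw, ?_⟩
    simp only [Real.dist_eq, sub_zero, abs_of_pos hs.1, hs.2]
  · obtain ⟨δ, hδ, h⟩ := Metric.isOpen_iff.1 (isClosed_closure (s := U)).isOpen_compl x hxc
    exact ⟨δ, hδ, fun y hy hyx => absurd hy (h hyx)⟩

lemma exists_forall_add_smul_mem (hc : IsCompact (closure U)) {X : E → E} (hX : Continuous X)
    (h : ∀ x, X x ∈ inwardCone U x) :
    ∃ ε₀ > 0, ∀ ε ∈ Ioo (0 : ℝ) ε₀, ∀ y ∈ closure U, y + ε • X y ∈ U := by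
  refine hc.induction_on (p := fun A => ∃ ε₀ > 0, ∀ ε ∈ Ioo (0 : ℝ) ε₀, ∀ y ∈ A, y + ε • X y ∈ U)
    ⟨1, one_pos, by simp⟩ ?_ ?_ ?_
  · rintro s t hst ⟨ε₀, h0, h1⟩
    exact ⟨ε₀, h0, fun ε hε y hy => h1 ε hε y (hst hy)⟩
  · rintro s t ⟨ε₁, h1, h1'⟩ ⟨ε₂, h2, h2'⟩
    refine ⟨min ε₁ ε₂, lt_min h1 h2, fun ε hε y hy => ?_⟩
    have := lt_min_iff.1 hε.2
    exact hy.elim (h1' ε ⟨hε.1, this.1⟩ y) (h2' ε ⟨hε.1, this.2⟩ y)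
  · intro x _
    obtain ⟨δ, hδ, hx⟩ := h x
    refine ⟨{y | dist y x < δ ∧ dist (X y) (X x) < δ} ∩ closure U, ?_, δ, hδ,
      fun ε hε y hy => hx y hy.2 hy.1.1 _ hy.1.2 ε hε⟩
    refine inter_mem (mem_nhdsWithin_of_mem_nhds ?_) self_mem_nhdsWithin
    exact Filter.Eventually.and (Metric.ball_mem_nhds x hδ)
      (hX.continuousAt.eventually (Metric.ball_mem_nhds (X x) hδ))

end InwardCone

lemma mul_mem_closure {U : Set ℂ} {ω : ℂ} (hsym : ∀ z ∈ U, ω * z ∈ U) {z : ℂ}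
    (hz : z ∈ closure U) : ω * z ∈ closure U :=
  map_mem_closure (f := fun z => ω * z) (by fun_prop) hz hsym

lemma mul_mem_inwardCone {U : Set ℂ} {ω : ℂ} (hω : ‖ω‖ = 1) (hsym : ∀ z ∈ U, ω * z ∈ U)
    (hsym' : ∀ z ∈ U, ω⁻¹ * z ∈ U) {x v : ℂ} (hv : v ∈ inwardCone U (ω * x)) :
    ω⁻¹ * v ∈ inwardCone U x := by
  have hω0 : ω ≠ 0 := by rintro rfl; simp at hω
  obtain ⟨δ, hδ, h⟩ := hv
  refine ⟨δ, hδ, fun y hy hyx w hw s hs => ?_⟩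
  have h1 : ω * y + s • (ω * w) ∈ U := by
    refine h _ (mul_mem_closure hsym hy) ?_ _ ?_ s hs
    · rwa [dist_eq_norm, ← mul_sub, norm_mul, hω, one_mul, ← dist_eq_norm]
    · rwa [dist_eq_norm, ← mul_inv_cancel_left₀ hω0 v, ← mul_sub, norm_mul, hω, one_mul,
        ← dist_eq_norm]
  have h2 := hsym' _ h1
  rw [Complex.real_smul] at h2 ⊢
  convert h2 using 1
  field_simp

/-- A smooth rotationally equivariant vector field pushing the closure of `U` into `U`. -/
theorem exists_inward_field {U : Set ℂ} (hU : IsOpen U) (hbd : Bornology.IsBounded U)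
    (hcone : ∀ x ∈ frontier U, (inwardCone U x).Nonempty) {p : ℕ} (hp : p ≠ 0) {ω : ℂ}
    (hω : ω ^ p = 1) (hsym : ∀ z ∈ U, ω * z ∈ U) :
    ∃ X : ℂ → ℂ, ContDiff ℝ (⊤ : ℕ∞) X ∧ (∀ z, X (ω * z) = ω * X z) ∧
      ∃ ε₀ > 0, ∀ ε ∈ Ioo (0 : ℝ) ε₀, ∀ z ∈ closure U, z + ε • X z ∈ U := by
  have hω1 : ‖ω‖ = 1 := by
    have : ‖ω‖ ^ p = 1 := by rw [← norm_pow, hω, norm_one]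
    exact (pow_eq_one_iff_of_nonneg (norm_nonneg _) hp).1 this
  have hω0 : ω ≠ 0 := by rintro rfl; simp at hω1
  have hinv : ω⁻¹ = ω ^ (p - 1) := by
    refine inv_eq_of_mul_eq_one_right ?_
    rw [← pow_succ', Nat.sub_add_cancel (Nat.pos_of_ne_zero hp), hω]
  have hsym' : ∀ z ∈ U, ω⁻¹ * z ∈ U := fun z hz => by
    rw [hinv]; exact pow_mul_mem hsym _ hz
  obtain ⟨Y, hY⟩ := exists_contMDiffMap_forall_mem_convex_of_local_const
    (n := (⊤ : ℕ∞)) (modelWithCornersSelf ℝ ℂ) (t := inwardCone U) convex_inwardCone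
    (fun x => by
      by_cases hx : x ∈ frontier U
      · obtain ⟨v, hv⟩ := hcone x hx
        exact ⟨v, eventually_mem_inwardCone hv⟩
      · exact ⟨0, eventually_mem_inwardCone (mem_inwardCone_of_notMem_frontier hU hx)⟩)
  have hYc : ContDiff ℝ (⊤ : ℕ∞) Y := contMDiff_iff_contDiff.1 Y.contMDiff
  set g : ℂ → ℕ → ℂ := fun z j => (ω ^ j)⁻¹ * Y (ω ^ j * z) with hg
  have hp' : (p : ℝ) ≠ 0 := by exact_mod_cast hp
  refine ⟨fun z => ∑ j ∈ Finset.range p, (1 / p : ℝ) • g z j, ?_, fun z => ?_, ?_⟩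
  · refine ContDiff.sum fun j _ => ContDiff.const_smul _ ?_
    exact contDiff_const.mul (hYc.comp (contDiff_const.mul contDiff_id))
  · rw [Finset.mul_sum]
    have h1 : ∀ j, (1 / p : ℝ) • g (ω * z) j = ω * ((1 / p : ℝ) • g z (j + 1)) := by
      intro j
      simp only [hg, Complex.real_smul, pow_succ]
      rw [mul_inv, mul_assoc (ω ^ j) ω z]
      field_simp
    simp_rw [h1]
    have h2 := Finset.sum_range_succ (fun j => ω * ((1 / p : ℝ) • g z j)) p
    rw [Finset.sum_range_succ'] at h2
    have h3 : g z p = g z 0 := by simp [hg, hω]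
    rw [h3] at h2
    exact add_right_cancel h2
  · refine exists_forall_add_smul_mem hbd.isCompact_closure ?_ fun x => ?_
    · refine continuous_finsetSum _ fun j _ => Continuous.fun_const_smul ?_ _
      exact continuous_const.mul (hYc.continuous.comp (by fun_prop))
    · refine (convex_inwardCone x).sum_mem (fun _ _ => by positivity) ?_ fun j _ => ?_
      · rw [Finset.sum_const, Finset.card_range, nsmul_eq_mul]
        field_simp
      · refine mul_mem_inwardCone (by rw [norm_pow, hω1, one_pow])
          (fun z hz => pow_mul_mem hsym j hz) (fun z hz => ?_) (hY _)
        rw [← inv_pow]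
        exact pow_mul_mem hsym' j hz

lemma det_restrictScalars_smulRight (a : ℂ) (A : ℂ →L[ℝ] ℂ) :
    ((((1 : ℂ →L[ℂ] ℂ).smulRight a).restrictScalars ℝ).comp A).det = ‖a‖ ^ 2 * A.det := by
  have h : ((((1 : ℂ →L[ℂ] ℂ).smulRight a).restrictScalars ℝ : ℂ →L[ℝ] ℂ) : ℂ →ₗ[ℝ] ℂ)
      = Algebra.lmul ℝ ℂ a := by
    ext x
    simp [mul_comm]
  rw [ContinuousLinearMap.det, ContinuousLinearMap.toLinearMap_comp, LinearMap.det_comp, h,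
    ← Algebra.norm_apply, Algebra.norm_complex_apply, Complex.normSq_eq_norm_sq]

lemma exists_norm_sq_le_det {η : ℝ} (hη : 0 < η) :
    ∃ t > 0, ∀ B : ℂ →L[ℝ] ℂ, ‖B‖ < t →
      ‖ContinuousLinearMap.id ℝ ℂ + B‖ ^ 2 ≤ (1 + η) * |(ContinuousLinearMap.id ℝ ℂ + B).det| := by
  have hc : Continuous fun B : ℂ →L[ℝ] ℂ => (1 + η) * |(ContinuousLinearMap.id ℝ ℂ + B).det|
      - ‖ContinuousLinearMap.id ℝ ℂ + B‖ ^ 2 := by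
    have h1 : Continuous fun B : ℂ →L[ℝ] ℂ => ContinuousLinearMap.id ℝ ℂ + B := by fun_prop
    exact (continuous_const.mul (ContinuousLinearMap.continuous_det.comp h1).abs).sub
      (h1.norm.pow 2)
  have h0 : 0 < (1 + η) * |(ContinuousLinearMap.id ℝ ℂ + 0).det|
      - ‖ContinuousLinearMap.id ℝ ℂ + 0‖ ^ 2 := by
    rw [add_zero, ContinuousLinearMap.norm_id]
    simp [ContinuousLinearMap.det, hη]
  obtain ⟨t, ht, h⟩ := Metric.eventually_nhds_iff.1 (hc.continuousAt.eventually (lt_mem_nhds h0))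
  refine ⟨t, ht, fun B hB => ?_⟩
  have := h (y := B) (by rwa [dist_zero_right])
  linarith

/-- On a bounded simply connected domain with rotational symmetry there are smooth equivariant
injective maps into the disk, defined beyond the closure, that are nearly conformal and take the
boundary close to the unit circle. -/
theorem exists_almost_riemann_map {U : Set ℂ} (hU : IsOpen U) (hsc : IsSimplyConnected U)
    (hbd : Bornology.IsBounded U) (hcone : ∀ x ∈ frontier U, (inwardCone U x).Nonempty)
    {p : ℕ} (hp : 2 ≤ p) {ω : ℂ} (hω : ω = Complex.exp (2 * Real.pi * Complex.I / p))
    (hsym : ∀ z ∈ U, ω * z ∈ U) {η : ℝ} (hη : 0 < η) :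
    ∃ (G : ℂ → ℂ) (N : Set ℂ), IsOpen N ∧ closure U ⊆ N ∧ ContDiffOn ℝ (⊤ : ℕ∞) G N ∧
      (∀ z ∈ N, ‖G z‖ < 1) ∧ InjOn G U ∧ (∀ z ∈ closure U, G (ω * z) = ω * G z) ∧
      (∀ z ∈ frontier U, 1 - η ≤ ‖G z‖) ∧
      ∀ z ∈ U, ‖fderiv ℝ G z‖ ^ 2 ≤ (1 + η) * |(fderiv ℝ G z).det| := by
  have hp0 : p ≠ 0 := by omega
  have hp0' : (p : ℂ) ≠ 0 := by exact_mod_cast hp0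
  have hωp : ω ^ p = 1 := by
    rw [hω, ← Complex.exp_nat_mul, mul_div_cancel₀ _ hp0', Complex.exp_two_pi_mul_I]
  have hω1 : ‖ω‖ = 1 := by
    have : ‖ω‖ ^ p = 1 := by rw [← norm_pow, hωp, norm_one]
    exact (pow_eq_one_iff_of_nonneg (norm_nonneg _) hp0).1 this
  have h0 : (0 : ℂ) ∈ U := zero_mem_of_isSimplyConnected hU hsc hp (by rwa [hω] at hsym)
  obtain ⟨ψ, hψd, hψ, hφc, hψω⟩ := exists_equivariant_riemann_map hU hsc hbd h0 hω1 hsym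
  obtain ⟨X, hX, hXω, ε₀, hε₀, hXU⟩ := exists_inward_field hU hbd hcone hp0 hωp hsym
  obtain ⟨R, hR⟩ := hbd.closure.subset_closedBall 0
  obtain ⟨M, hM⟩ := (isCompact_closedBall (0 : ℂ) R).exists_bound_of_continuousOn
    hX.continuous.continuousOn
  have hX1 : ContDiff ℝ 1 X := hX.of_le (by norm_cast)
  obtain ⟨Λ, hΛ⟩ := (isCompact_closedBall (0 : ℂ) R).exists_bound_of_continuousOn
    (hX1.continuous_fderiv one_ne_zero).continuousOn
  obtain ⟨t, ht, hdet⟩ := exists_norm_sq_le_det hη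
  set φ := Function.invFunOn ψ U with hφ
  have hsub : closedBall (0 : ℂ) (1 - η) ⊆ ball 0 1 := closedBall_subset_ball (by linarith)
  have hK : IsCompact (φ '' closedBall 0 (1 - η)) :=
    (isCompact_closedBall _ _).image_of_continuousOn (hφc.mono hsub)
  have hKU : φ '' closedBall 0 (1 - η) ⊆ U :=
    ((hψ.surjOn.mapsTo_invFunOn).mono_left hsub).image_subset
  obtain ⟨δ, hδ, hthick⟩ := hK.exists_thickening_subset_open hU hKU
  have hlim : ∀ c : ℝ, Tendsto (fun ε : ℝ => ε * c) (𝓝[>] 0) (𝓝 0) := fun c => by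
    have : Tendsto (fun ε : ℝ => ε * c) (𝓝 0) (𝓝 (0 * c)) := (continuous_mul_const c).tendsto 0
    rw [zero_mul] at this
    exact this.mono_left nhdsWithin_le_nhds
  obtain ⟨ε, hε, hεM, hεΛ, hεt⟩ := (Filter.Eventually.and (Ioo_mem_nhdsGT hε₀)
    (((hlim M).eventually_lt_const hδ).and (((hlim Λ).eventually_lt_const one_pos).and
      ((hlim Λ).eventually_lt_const ht)))).exists
  set T : ℂ → ℂ := fun z => z + ε • X z with hT
  have hTs : ContDiff ℝ (⊤ : ℕ∞) T := contDiff_id.add (hX.const_smul ε)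
  have hTU : ∀ z ∈ closure U, T z ∈ U := hXU ε hε
  have hTd : ∀ z, HasFDerivAt T (ContinuousLinearMap.id ℝ ℂ + ε • fderiv ℝ X z) z := fun z =>
    (hasFDerivAt_id z).add ((hX1.differentiable one_ne_zero z).hasFDerivAt.const_smul ε)
  refine ⟨ψ ∘ T, T ⁻¹' U, hU.preimage hTs.continuous, hTU, ?_, ?_, ?_, ?_, ?_, ?_⟩
  · exact ((hψd.contDiffOn hU).restrict_scalars ℝ).comp hTs.contDiffOn fun z hz => hz
  · exact fun z hz => mem_ball_zero_iff.1 (hψ.mapsTo hz)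
  · intro y hy z hz hyz
    have h1 : T y = T z := hψ.injOn (hTU y (subset_closure hy)) (hTU z (subset_closure hz)) hyz
    have h2 : ‖X y - X z‖ ≤ Λ * ‖y - z‖ :=
      (convex_closedBall (0 : ℂ) R).norm_image_sub_le_of_norm_fderiv_le (𝕜 := ℝ)
        (fun x _ => hX1.differentiable one_ne_zero x) hΛ (hR (subset_closure hz))
        (hR (subset_closure hy))
    have h3 : y - z = -(ε • (X y - X z)) := by
      simp only [hT] at h1
      rw [smul_sub]
      linear_combination h1
    have h4 : ‖y - z‖ ≤ ε * Λ * ‖y - z‖ := by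
      conv_lhs => rw [h3, norm_neg, norm_smul, Real.norm_of_nonneg hε.1.le]
      rw [mul_assoc]
      exact mul_le_mul_of_nonneg_left h2 hε.1.le
    have h5 : ‖y - z‖ = 0 := by
      by_contra hne
      have : 0 < ‖y - z‖ := lt_of_le_of_ne (norm_nonneg _) (Ne.symm hne)
      nlinarith
    exact sub_eq_zero.1 (norm_eq_zero.1 h5)
  · intro z hz
    have h1 : T (ω * z) = ω * T z := by
      simp only [hT, hXω, Complex.real_smul]
      ring
    rw [Function.comp_apply, h1, hψω _ (hTU z hz), Function.comp_apply]
  · intro z hz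
    by_contra! hlt
    have hzc : z ∈ closure U := frontier_subset_closure hz
    have h1 : T z ∈ φ '' closedBall 0 (1 - η) :=
      ⟨ψ (T z), mem_closedBall_zero_iff.2 hlt.le, hψ.injOn.leftInvOn_invFunOn (hTU z hzc)⟩
    have h2 : z ∈ U := hthick (mem_thickening_iff.2 ⟨_, h1, by
      rw [dist_comm, dist_eq_norm]
      simp only [hT]
      rw [add_sub_cancel_left, norm_smul, Real.norm_of_nonneg hε.1.le]
      exact (mul_le_mul_of_nonneg_left (hM z (hR hzc)) hε.1.le).trans_lt hεM⟩)
    rw [frontier, hU.interior_eq] at hz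
    exact hz.2 h2
  · intro z hz
    have hzc : z ∈ closure U := subset_closure hz
    set A := ContinuousLinearMap.id ℝ ℂ + ε • fderiv ℝ X z with hA
    have h1 : HasDerivAt ψ (deriv ψ (T z)) (T z) :=
      (hψd.differentiableAt (hU.mem_nhds (hTU z hzc))).hasDerivAt
    have h2 : HasFDerivAt (ψ ∘ T)
        ((((1 : ℂ →L[ℂ] ℂ).smulRight (deriv ψ (T z))).restrictScalars ℝ).comp A) z :=
      (h1.hasFDerivAt.restrictScalars ℝ).comp z (hTd z)
    have h3 : ‖A‖ ^ 2 ≤ (1 + η) * |A.det| := by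
      refine hdet _ ?_
      rw [norm_smul, Real.norm_of_nonneg hε.1.le]
      exact (mul_le_mul_of_nonneg_left (hΛ z (hR hzc)) hε.1.le).trans_lt hεt
    rw [h2.fderiv, det_restrictScalars_smulRight, abs_mul, abs_of_nonneg (by positivity)]
    have h4 : ‖((((1 : ℂ →L[ℂ] ℂ).smulRight (deriv ψ (T z))).restrictScalars ℝ).comp A)‖
        ≤ ‖deriv ψ (T z)‖ * ‖A‖ := by
      refine ContinuousLinearMap.opNorm_le_bound _ (by positivity) fun v => ?_
      have : ‖A v‖ ≤ ‖A‖ * ‖v‖ := A.le_opNorm v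
      simp only [ContinuousLinearMap.comp_apply, ContinuousLinearMap.coe_restrictScalars',
        ContinuousLinearMap.smulRight_apply, one_apply_eq_self, smul_eq_mul, norm_mul]
      calc ‖A v‖ * ‖deriv ψ (T z)‖ ≤ ‖A‖ * ‖v‖ * ‖deriv ψ (T z)‖ := by gcongr
        _ = _ := by ring
    calc _ ≤ (‖deriv ψ (T z)‖ * ‖A‖) ^ 2 := by gcongr
      _ = ‖deriv ψ (T z)‖ ^ 2 * ‖A‖ ^ 2 := by ring
      _ ≤ ‖deriv ψ (T z)‖ ^ 2 * ((1 + η) * |A.det|) := by gcongr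
      _ = _ := by ring

lemma continuous_expMulI : Continuous fun θ : ℝ => Complex.exp (θ * Complex.I) := by fun_prop

lemma hasDerivAt_expMulI (θ : ℝ) : HasDerivAt (fun θ : ℝ => Complex.exp (θ * Complex.I))
    (Complex.exp (θ * Complex.I) * Complex.I) θ := by
  have h : HasDerivAt (fun θ : ℝ => (θ : ℂ) * Complex.I) (1 * Complex.I) θ :=
    (Complex.ofRealCLM.hasDerivAt (x := θ)).mul_const _
  simpa using h.cexp

lemma setIntegral_ball_eq_polar {h : ℂ → ℝ} (hh : Continuous h) :
    ∫ z in ball (0 : ℂ) 1, h z = ∫ r in (0 : ℝ)..1, ∫ θ in (-Real.pi)..Real.pi,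
      r * h (r * Complex.exp (θ * Complex.I)) := by
  rw [← integral_indicator isOpen_ball.measurableSet, ← Complex.integral_comp_polarCoord_symm,
    polarCoord_target]
  have h1 : ∀ q ∈ Ioi (0 : ℝ) ×ˢ Ioo (-Real.pi) Real.pi,
      q.1 • (ball (0 : ℂ) 1).indicator h (Complex.polarCoord.symm q)
      = (Ioo (0 : ℝ) 1 ×ˢ Ioo (-Real.pi) Real.pi).indicator
        (fun q : ℝ × ℝ => q.1 * h (q.1 * Complex.exp (q.2 * Complex.I))) q := by
    rintro ⟨r, θ⟩ ⟨hr, hθ⟩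
    have hr' : 0 < r := hr
    have hn := Complex.norm_polarCoord_symm (r, θ)
    simp only [abs_of_pos hr'] at hn
    by_cases hr1 : r < 1
    · rw [indicator_of_mem (by rw [mem_ball_zero_iff, hn]; exact hr1),
        indicator_of_mem (show (r, θ) ∈ Ioo (0 : ℝ) 1 ×ˢ Ioo (-Real.pi) Real.pi from
          ⟨⟨hr', hr1⟩, hθ⟩), Complex.polarCoord_symm_apply,
        Complex.exp_mul_I]
      simp
    · rw [indicator_of_notMem (by rw [mem_ball_zero_iff, hn]; exact hr1),
        indicator_of_notMem (fun hm => hr1 hm.1.2), smul_zero]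
  have hc : Continuous (fun q : ℝ × ℝ => q.1 * h (q.1 * Complex.exp (q.2 * Complex.I))) := by
    fun_prop
  rw [setIntegral_congr_fun (measurableSet_Ioi.prod measurableSet_Ioo) h1,
    setIntegral_indicator (measurableSet_Ioo.prod measurableSet_Ioo),
    inter_eq_self_of_subset_right (prod_mono_left Ioo_subset_Ioi_self), Measure.volume_eq_prod,
    setIntegral_prod]
  · rw [intervalIntegral.integral_of_le zero_le_one, integral_Ioc_eq_integral_Ioo]
    refine setIntegral_congr_fun measurableSet_Ioo fun r _ => ?_
    simp only
    rw [intervalIntegral.integral_of_le (by linarith [Real.pi_pos]), integral_Ioc_eq_integral_Ioo]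
  · exact (hc.continuousOn.integrableOn_compact (isCompact_Icc.prod isCompact_Icc)).mono_set
      (prod_mono Ioo_subset_Icc_self Ioo_subset_Icc_self)

/-- Green's formula on the disk against the real part of a primitive of `g`. -/
theorem integral_ball_fderiv_conj {f : ℂ → ℝ} (hf : ContDiff ℝ 1 f) {g g' : ℂ → ℂ}
    (hg : ∀ z, HasDerivAt g (g' z) z) (hg' : Continuous g') :
    ∫ z in ball (0 : ℂ) 1, fderiv ℝ f z (starRingEnd ℂ (g z))
      = ∫ θ in (-Real.pi)..Real.pi, f (Complex.exp (θ * Complex.I)) *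
        (Complex.exp (θ * Complex.I) * g (Complex.exp (θ * Complex.I))).re := by
  have hgc : Continuous g := continuous_iff_continuousAt.2 fun z => (hg z).continuousAt
  have hfc := hf.continuous_fderiv one_ne_zero
  have hfc0 := hf.continuous
  have hcont : Continuous fun z => fderiv ℝ f z (starRingEnd ℂ (g z)) :=
    hfc.clm_apply (Complex.continuous_conj.comp hgc)
  rw [setIntegral_ball_eq_polar hcont]
  set E : ℝ → ℂ := fun θ => Complex.exp (θ * Complex.I) with hE
  have hEc : Continuous E := continuous_expMulI
  have hEd : ∀ θ, HasDerivAt E (E θ * Complex.I) θ := hasDerivAt_expMulI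
  have hzr : ∀ r θ : ℝ, HasDerivAt (fun r : ℝ => (r : ℂ) * E θ) (E θ) r := fun r θ => by
    simpa using (Complex.ofRealCLM.hasDerivAt (x := r)).mul_const (E θ)
  have hzθ : ∀ r θ : ℝ, HasDerivAt (fun θ : ℝ => (r : ℂ) * E θ) (r * (E θ * Complex.I)) θ :=
    fun r θ => (hEd θ).const_mul _
  have hfd : ∀ z, HasFDerivAt f (fderiv ℝ f z) z := fun z =>
    (hf.differentiable one_ne_zero z).hasFDerivAt
  set a : ℝ → ℝ → ℝ := fun r θ => fderiv ℝ f (r * E θ) (E θ) * (r * E θ * g (r * E θ)).re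
    + f (r * E θ) * (E θ * g (r * E θ) + r * E θ * (g' (r * E θ) * E θ)).re with ha
  set b : ℝ → ℝ → ℝ := fun r θ =>
    fderiv ℝ f (r * E θ) (r * (E θ * Complex.I)) * (E θ * g (r * E θ)).im
    + f (r * E θ) * (E θ * Complex.I * g (r * E θ)
      + E θ * (g' (r * E θ) * (r * (E θ * Complex.I)))).im with hb
  have had : ∀ r θ : ℝ, HasDerivAt (fun r : ℝ => f (r * E θ) * (r * E θ * g (r * E θ)).re)
      (a r θ) r := by
    intro r θ
    have h1 : HasDerivAt (fun r : ℝ => f (r * E θ)) (fderiv ℝ f (r * E θ) (E θ)) r :=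
      (hfd _).comp_hasDerivAt r (hzr r θ)
    have h2 : HasDerivAt (fun r : ℝ => g (r * E θ)) (g' (r * E θ) * E θ) r :=
      (hg _).comp r (hzr r θ)
    have h3 := (hzr r θ).mul h2
    exact h1.mul (Complex.reCLM.hasFDerivAt.comp_hasDerivAt r h3)
  have hbd : ∀ r θ : ℝ, HasDerivAt (fun θ : ℝ => f (r * E θ) * (E θ * g (r * E θ)).im)
      (b r θ) θ := by
    intro r θ
    have h1 : HasDerivAt (fun θ : ℝ => f (r * E θ))
        (fderiv ℝ f (r * E θ) (r * (E θ * Complex.I))) θ :=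
      (hfd _).comp_hasDerivAt θ (hzθ r θ)
    have h2 : HasDerivAt (fun θ : ℝ => g (r * E θ)) (g' (r * E θ) * (r * (E θ * Complex.I))) θ :=
      (hg _).comp θ (hzθ r θ)
    have h3 := (hEd θ).mul h2
    exact h1.mul (Complex.imCLM.hasFDerivAt.comp_hasDerivAt θ h3)
  have hac : Continuous (Function.uncurry a) := by
    simp only [ha, Function.uncurry_def]
    have h1 : Continuous fun q : ℝ × ℝ => fderiv ℝ f (q.1 * E q.2) (E q.2) :=
      (hfc.comp (by fun_prop)).clm_apply (by fun_prop)
    fun_prop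
  have hbc : Continuous (Function.uncurry b) := by
    simp only [hb, Function.uncurry_def]
    have h1 : Continuous fun q : ℝ × ℝ =>
        fderiv ℝ f (q.1 * E q.2) (q.1 * (E q.2 * Complex.I)) :=
      (hfc.comp (by fun_prop)).clm_apply (by fun_prop)
    fun_prop
  have hab : ∀ r θ : ℝ, r * fderiv ℝ f (r * E θ) (starRingEnd ℂ (g (r * E θ)))
      = a r θ - b r θ := by
    intro r θ
    set z := (r : ℂ) * E θ with hz
    set w := E θ * g z with hw
    have hunit : E θ * starRingEnd ℂ (E θ) = 1 := by
      rw [Complex.mul_conj, Complex.normSq_eq_norm_sq]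
      simp [hE, Complex.norm_exp_ofReal_mul_I]
    have h1 : (r : ℂ) * starRingEnd ℂ (g z) = ((r * w.re : ℝ) : ℂ) * E θ
        - ((w.im : ℝ) : ℂ) * (r * (E θ * Complex.I)) := by
      have h2 : (w.re : ℂ) - w.im * Complex.I = starRingEnd ℂ w := by
        apply Complex.ext <;> simp
      have h3 : starRingEnd ℂ w = starRingEnd ℂ (E θ) * starRingEnd ℂ (g z) := by
        rw [hw, map_mul]
      push_cast
      linear_combination (-(r : ℂ) * starRingEnd ℂ (g z)) * hunit
        - (r : ℂ) * E θ * h2 - (r : ℂ) * E θ * h3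
    have h4 : r * fderiv ℝ f z (starRingEnd ℂ (g z))
        = (r * w.re) * fderiv ℝ f z (E θ) - w.im * fderiv ℝ f z (r * (E θ * Complex.I)) := by
      have h7 : r * fderiv ℝ f z (starRingEnd ℂ (g z))
          = fderiv ℝ f z (r • starRingEnd ℂ (g z)) := by rw [map_smul, smul_eq_mul]
      rw [h7, ← smul_eq_mul (r * w.re), ← smul_eq_mul w.im, ← map_smul (fderiv ℝ f z),
        ← map_smul (fderiv ℝ f z), ← map_sub]
      simp only [Complex.real_smul]
      rw [h1]
    rw [h4]
    simp only [ha, hb, ← hz]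
    have h5 : (z * g z).re = r * w.re := by rw [hz, mul_assoc, ← hz, ← hw]; simp
    have h6 : (E θ * Complex.I * g z + E θ * (g' z * (r * (E θ * Complex.I)))).im
        = (E θ * g z + z * (g' z * E θ)).re := by
      rw [show E θ * Complex.I * g z + E θ * (g' z * (r * (E θ * Complex.I)))
        = (E θ * g z + z * (g' z * E θ)) * Complex.I by rw [hz]; ring]
      simp
    rw [h5, h6]
    ring
  have hi : ∀ {F : ℝ → ℝ → ℝ} (r : ℝ), Continuous (Function.uncurry F) →
      IntervalIntegrable (F r) volume (-Real.pi) Real.pi := fun r hF =>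
    (hF.comp (Continuous.prodMk_right r)).intervalIntegrable _ _
  have hi' : ∀ {F : ℝ → ℝ → ℝ}, Continuous (Function.uncurry F) →
      IntervalIntegrable (fun r => ∫ θ in (-Real.pi)..Real.pi, F r θ) volume 0 1 := fun hF =>
    (intervalIntegral.continuous_parametric_intervalIntegral_of_continuous' hF _ _).intervalIntegrable
      _ _
  have e1 : ∀ r θ : ℝ, r * fderiv ℝ f (r * Complex.exp (θ * Complex.I))
      (starRingEnd ℂ (g (r * Complex.exp (θ * Complex.I)))) = a r θ - b r θ := hab
  simp_rw [e1]
  have e2 : ∀ r : ℝ, ∫ θ in (-Real.pi)..Real.pi, b r θ = 0 := by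
    intro r
    rw [intervalIntegral.integral_eq_sub_of_hasDerivAt (fun θ _ => hbd r θ) (hi r hbc)]
    have : E (-Real.pi) = E Real.pi := by
      simp [hE, Complex.exp_neg, Complex.exp_pi_mul_I]
    rw [this, sub_self]
  have e3 : ∀ θ : ℝ, ∫ r in (0 : ℝ)..1, a r θ = f (E θ) * (E θ * g (E θ)).re := by
    intro θ
    rw [intervalIntegral.integral_eq_sub_of_hasDerivAt (fun r _ => had r θ)
      ((hac.comp (Continuous.prodMk_left θ)).intervalIntegrable _ _)]
    simp
  calc ∫ r in (0 : ℝ)..1, ∫ θ in (-Real.pi)..Real.pi, (a r θ - b r θ)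
      = ∫ r in (0 : ℝ)..1, ∫ θ in (-Real.pi)..Real.pi, a r θ := by
        refine intervalIntegral.integral_congr fun r _ => ?_
        rw [intervalIntegral.integral_sub (hi r hac) (hi r hbc), e2, sub_zero]
    _ = ∫ θ in (-Real.pi)..Real.pi, ∫ r in (0 : ℝ)..1, a r θ := by
        refine intervalIntegral_intervalIntegral_swap ?_
        exact (hac.continuousOn.integrableOn_compact (isCompact_uIcc.prod isCompact_uIcc)).mono_set
          (prod_mono uIoc_subset_uIcc uIoc_subset_uIcc)
    _ = _ := intervalIntegral.integral_congr fun θ _ => e3 θ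

lemma norm_expMulI_sub (θ φ : ℝ) :
    ‖Complex.exp (θ * Complex.I) - Complex.exp (φ * Complex.I)‖
      = ‖Complex.exp ((θ - φ : ℝ) * Complex.I) - 1‖ := by
  have h : Complex.exp (θ * Complex.I) - Complex.exp (φ * Complex.I)
      = Complex.exp (φ * Complex.I) * (Complex.exp ((θ - φ : ℝ) * Complex.I) - 1) := by
    rw [mul_sub, ← Complex.exp_add, mul_one]
    push_cast
    ring_nf
  rw [h, norm_mul, Complex.norm_exp_ofReal_mul_I, one_mul]

lemma lipschitzWith_expMulI : LipschitzWith 1 fun θ : ℝ => Complex.exp (θ * Complex.I) := by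
  refine LipschitzWith.of_dist_le_mul fun θ φ => ?_
  rw [dist_eq_norm, norm_expMulI_sub, NNReal.coe_one, one_mul, Real.dist_eq, mul_comm]
  exact Real.norm_exp_I_mul_ofReal_sub_one_le

lemma eventually_abs_le_norm_expMulI_sub_one {K : ℝ} (hK : 1 < K) :
    ∀ᶠ t : ℝ in 𝓝 0, |t| ≤ K * ‖Complex.exp (t * Complex.I) - 1‖ := by
  have h := hasDerivAt_iff_isLittleO.1 (hasDerivAt_expMulI 0)
  have hc : 0 < 1 - 1 / K := by
    rw [sub_pos, div_lt_one (by linarith)]; exact hK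
  filter_upwards [h.def hc] with t ht
  simp only [Complex.ofReal_zero, zero_mul, Complex.exp_zero, one_mul, sub_zero,
    Real.norm_eq_abs] at ht
  have h1 : ‖t • Complex.I‖ = |t| := by rw [norm_smul, Complex.norm_I, mul_one, Real.norm_eq_abs]
  have h2 : |t| ≤ ‖Complex.exp (t * Complex.I) - 1‖ + (1 - 1 / K) * |t| := by
    rw [← h1]
    have := norm_sub_le (Complex.exp (t * Complex.I) - 1)
      (Complex.exp (t * Complex.I) - 1 - t • Complex.I)
    rw [sub_sub_cancel] at this
    rw [h1] at this ⊢
    linarith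
  have hK0 : 0 < K := by linarith
  have h3 : 1 / K * |t| ≤ ‖Complex.exp (t * Complex.I) - 1‖ := by linarith
  calc |t| = K * (1 / K * |t|) := by field_simp
    _ ≤ _ := by gcongr

lemma arg_expMulI {θ : ℝ} (hθ : θ ∈ Ioc (-Real.pi) Real.pi) :
    Complex.arg (Complex.exp (θ * Complex.I)) = θ := by
  rw [Complex.arg_exp_mul_I]
  exact (toIocMod_eq_self Real.two_pi_pos).2 ⟨hθ.1, by linarith [hθ.2]⟩

lemma expMulI_arg {z : ℂ} (hz : z ∈ sphere (0 : ℂ) 1) : Complex.exp (z.arg * Complex.I) = z := by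
  have := Complex.norm_mul_exp_arg_mul_I z
  rwa [mem_sphere_zero_iff_norm.1 hz, Complex.ofReal_one, one_mul] at this

lemma expMulI_mem_sphere (θ : ℝ) : Complex.exp (θ * Complex.I) ∈ sphere (0 : ℂ) 1 := by
  simp [Complex.norm_exp_ofReal_mul_I]

lemma image_expMulI_eq {B : Set ℝ} (hB : B ⊆ Ioc (-Real.pi) Real.pi) :
    (fun θ : ℝ => Complex.exp (θ * Complex.I)) '' B = sphere 0 1 ∩ Complex.arg ⁻¹' B := by
  ext z
  constructor
  · rintro ⟨θ, hθ, rfl⟩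
    exact ⟨expMulI_mem_sphere θ, by rw [mem_preimage, arg_expMulI (hB hθ)]; exact hθ⟩
  · rintro ⟨hz, hzB⟩
    exact ⟨z.arg, hzB, expMulI_arg hz⟩

lemma hausdorffMeasure_image_expMulI {B : Set ℝ} (hB : B ⊆ Ioc (-Real.pi) Real.pi)
    (hBm : MeasurableSet B) :
    μH[1] ((fun θ : ℝ => Complex.exp (θ * Complex.I)) '' B) = volume B := by
  set E : ℝ → ℂ := fun θ => Complex.exp (θ * Complex.I) with hE
  refine le_antisymm ?_ ?_
  · have := (lipschitzWith_expMulI.lipschitzOnWith (s := B)).hausdorffMeasure_image_le zero_le_one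
    rw [hausdorffMeasure_real] at this
    simpa using this
  have key : ∀ K : ℝ≥0, 1 < K → volume B ≤ K * μH[1] (E '' B) := by
    intro K hK
    obtain ⟨δ, hδ, h⟩ := Metric.eventually_nhds_iff.1
      (eventually_abs_le_norm_expMulI_sub_one (K := K) (by exact_mod_cast hK))
    have hsplit : B = ⋃ n : ℤ, B ∩ Ico (n • δ) ((n + 1) • δ) := by
      rw [← inter_iUnion, iUnion_Ico_zsmul hδ, inter_univ]
    have hdisj : Pairwise (Function.onFun Disjoint fun n : ℤ => Ico (n • δ) ((n + 1) • δ)) :=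
      pairwise_disjoint_Ico_zsmul δ
    have hsub : ∀ n : ℤ, B ∩ Ico (n • δ) ((n + 1) • δ) ⊆ Ioc (-Real.pi) Real.pi :=
      fun n => inter_subset_left.trans hB
    have hpiece : ∀ n : ℤ, volume (B ∩ Ico (n • δ) ((n + 1) • δ))
        ≤ K * μH[1] (E '' (B ∩ Ico (n • δ) ((n + 1) • δ))) := by
      intro n
      have hl : LipschitzOnWith K Complex.arg (E '' (B ∩ Ico (n • δ) ((n + 1) • δ))) := by
        refine LipschitzOnWith.of_dist_le_mul ?_
        rintro _ ⟨θ, hθ, rfl⟩ _ ⟨φ, hφ, rfl⟩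
        rw [arg_expMulI (hB hθ.1), arg_expMulI (hB hφ.1), dist_eq_norm (E θ), norm_expMulI_sub,
          Real.dist_eq]
        refine h ?_
        have h1 := hθ.2
        have h2 := hφ.2
        rw [add_smul, one_smul] at h1 h2
        rw [dist_zero_right, Real.norm_eq_abs, abs_lt]
        exact ⟨by linarith [h1.1, h2.2], by linarith [h1.2, h2.1]⟩
      have h1 := hl.hausdorffMeasure_image_le zero_le_one
      rw [hausdorffMeasure_real, image_image, image_congr fun θ hθ => arg_expMulI (hB hθ.1),
        image_id'] at h1
      simpa using h1
    have himg : E '' B = ⋃ n : ℤ, E '' (B ∩ Ico (n • δ) ((n + 1) • δ)) := by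
      rw [← image_iUnion, ← hsplit]
    have e1 : volume B = ∑' n : ℤ, volume (B ∩ Ico (n • δ) ((n + 1) • δ)) := by
      conv_lhs => rw [hsplit]
      exact measure_iUnion (fun i j hij => (hdisj hij).mono inter_subset_right inter_subset_right)
        fun n => hBm.inter measurableSet_Ico
    have e2 : μH[1] (E '' B) = ∑' n : ℤ, μH[1] (E '' (B ∩ Ico (n • δ) ((n + 1) • δ))) := by
      conv_lhs => rw [himg]
      refine measure_iUnion (fun i j hij => ?_) fun n => ?_
      · simp only [Function.onFun]
        rw [image_expMulI_eq (hsub i), image_expMulI_eq (hsub j)]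
        exact (((hdisj hij).mono inter_subset_right inter_subset_right).preimage _).mono
          inter_subset_right inter_subset_right
      · rw [image_expMulI_eq (hsub n)]
        exact isClosed_sphere.measurableSet.inter
          (Complex.measurable_arg (hBm.inter measurableSet_Ico))
    rw [e1, e2, ← ENNReal.tsum_mul_left]
    exact ENNReal.tsum_le_tsum hpiece
  have hlim : Tendsto (fun K : ℝ≥0 => (K : ℝ≥0∞) * μH[1] (E '' B)) (𝓝[>] 1)
      (𝓝 ((1 : ℝ≥0) * μH[1] (E '' B))) :=
    ENNReal.Tendsto.mul_const ((ENNReal.continuous_coe.tendsto 1).mono_left nhdsWithin_le_nhds)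
      (Or.inl (by simp))
  have := ge_of_tendsto hlim (b := volume B)
    (by filter_upwards [self_mem_nhdsWithin] with K hK using key K hK)
  simpa using this

/-- Arc length on the unit circle is the Hausdorff measure. -/
theorem restrict_sphere_hausdorffMeasure :
    (μH[1] : Measure ℂ).restrict (sphere 0 1)
      = (volume.restrict (Ioc (-Real.pi) Real.pi)).map
        fun θ : ℝ => Complex.exp (θ * Complex.I) := by
  have hEm : Measurable fun θ : ℝ => Complex.exp (θ * Complex.I) :=
    continuous_expMulI.measurable
  ext A hA
  rw [Measure.map_apply hEm hA, Measure.restrict_apply hA, Measure.restrict_apply (hEm hA),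
    ← hausdorffMeasure_image_expMulI inter_subset_right ((hEm hA).inter measurableSet_Ioc),
    image_preimage_inter, image_expMulI_eq subset_rfl]
  congr 2
  refine (inter_eq_left.2 fun z _ => ?_).symm
  exact ⟨Complex.neg_pi_lt_arg z, Complex.arg_le_pi z⟩

lemma setLIntegral_sphere {g : ℂ → ℝ≥0∞} (hg : Measurable g) :
    ∫⁻ z in sphere (0 : ℂ) 1, g z ∂μH[1]
      = ∫⁻ θ in Ioc (-Real.pi) Real.pi, g (Complex.exp (θ * Complex.I)) := by
  rw [restrict_sphere_hausdorffMeasure, lintegral_map hg continuous_expMulI.measurable]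

section Moments

variable {X : Type*} [MeasurableSpace X] {μ : Measure X} [IsFiniteMeasure μ] {H : X → ℂ}

lemma integrable_pow_mul_conj_pow (hH : AEStronglyMeasurable H μ) (hb : ∀ᵐ x ∂μ, ‖H x‖ ≤ 1)
    (s t : ℕ) : Integrable (fun x => H x ^ s * starRingEnd ℂ (H x) ^ t) μ := by
  refine Integrable.of_bound (C := 1) ?_ ?_
  · exact (hH.pow s).mul ((Complex.continuous_conj.comp_aestronglyMeasurable hH).pow t)
  · filter_upwards [hb] with x hx
    rw [norm_mul, norm_pow, norm_pow, RCLike.norm_conj]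
    exact mul_le_one₀ (pow_le_one₀ (norm_nonneg _) hx) (by positivity)
      (pow_le_one₀ (norm_nonneg _) hx)

lemma re_mul_re (a b : ℂ) : a.re * b.re = ((a * b).re + (a * starRingEnd ℂ b).re) / 2 := by
  simp only [Complex.mul_re, Complex.conj_re, Complex.conj_im]
  ring

lemma re_mul_pow_mul_re (a b : ℂ) (s t : ℕ) (z : ℂ) : (a * z ^ s).re * (b * z ^ t).re
    = ((a * b * (z ^ (s + t) * starRingEnd ℂ z ^ 0)).re
      + (a * starRingEnd ℂ b * (z ^ s * starRingEnd ℂ z ^ t)).re) / 2 := by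
  rw [re_mul_re, map_mul, map_pow, pow_add]
  ring_nf

lemma integrable_re_mul_re (hH : AEStronglyMeasurable H μ) (hb : ∀ᵐ x ∂μ, ‖H x‖ ≤ 1)
    (a b : ℂ) (s t : ℕ) : Integrable (fun x => (a * H x ^ s).re * (b * H x ^ t).re) μ := by
  simp_rw [re_mul_pow_mul_re]
  exact ((((integrable_pow_mul_conj_pow hH hb (s + t) 0).const_mul (a * b)).re).add
    (((integrable_pow_mul_conj_pow hH hb s t).const_mul (a * starRingEnd ℂ b)).re)).div_const 2

lemma integral_re_mul_re (hH : AEStronglyMeasurable H μ) (hb : ∀ᵐ x ∂μ, ‖H x‖ ≤ 1)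
    (a b : ℂ) (s t : ℕ) : ∫ x, (a * H x ^ s).re * (b * H x ^ t).re ∂μ
      = ((a * b * ∫ x, H x ^ (s + t) * starRingEnd ℂ (H x) ^ 0 ∂μ).re
        + (a * starRingEnd ℂ b * ∫ x, H x ^ s * starRingEnd ℂ (H x) ^ t ∂μ).re) / 2 := by
  have h1 := (integrable_pow_mul_conj_pow hH hb (s + t) 0).const_mul (a * b)
  have h2 := (integrable_pow_mul_conj_pow hH hb s t).const_mul (a * starRingEnd ℂ b)
  have h1' : Integrable (fun x => (a * b * (H x ^ (s + t) * starRingEnd ℂ (H x) ^ 0)).re) μ :=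
    h1.re
  have h2' : Integrable
      (fun x => (a * starRingEnd ℂ b * (H x ^ s * starRingEnd ℂ (H x) ^ t)).re) μ := h2.re
  simp_rw [re_mul_pow_mul_re]
  rw [integral_div, integral_add h1' h2', ← integral_const_mul, ← integral_const_mul]
  congr 2
  · exact integral_re h1
  · exact integral_re h2

/-- Phases for the real trigonometric family of degree at most `(k + 1) / 2`. -/
def trigPhase (k : ℕ) (γ : ℂ) (i : ℕ) : ℂ :=
  if i = 0 then 1 else if Even i then -Complex.I else if i = k then γ else 1

lemma norm_trigPhase {k : ℕ} {γ : ℂ} (hγ : ‖γ‖ = 1) (i : ℕ) : ‖trigPhase k γ i‖ = 1 := by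
  unfold trigPhase
  split_ifs <;> simp [hγ]

/-- The real trigonometric family built on a complex function. -/
def trigFun (k : ℕ) (γ : ℂ) (i : ℕ) (z : ℂ) : ℝ := (trigPhase k γ i * z ^ ((i + 1) / 2)).re

variable {p k : ℕ} {γ : ℂ}

lemma integral_trigFun_mul_of_ne (hH : AEStronglyMeasurable H μ) (hb : ∀ᵐ x ∂μ, ‖H x‖ ≤ 1)
    (hM : ∀ a b : ℕ, ¬ a ≡ b [MOD p] → ∫ x, H x ^ a * starRingEnd ℂ (H x) ^ b ∂μ = 0)
    (hk : k < p) {i j : ℕ} (hi : i ≤ k) (hj : j ≤ k) (hij : i ≠ j) :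
    ∫ x, trigFun k γ i (H x) * trigFun k γ j (H x) ∂μ = 0 := by
  unfold trigFun
  rw [integral_re_mul_re hH hb]
  have h1 : ¬ (i + 1) / 2 + (j + 1) / 2 ≡ 0 [MOD p] := by
    intro h
    have := Nat.le_of_dvd (by omega) ((Nat.modEq_zero_iff_dvd).1 h)
    omega
  rw [hM _ _ h1, mul_zero, Complex.zero_re, zero_add]
  by_cases hn : (i + 1) / 2 = (j + 1) / 2
  · rw [← hn]
    have h2 : ∀ x, H x ^ ((i + 1) / 2) * starRingEnd ℂ (H x) ^ ((i + 1) / 2)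
        = ((‖H x‖ ^ 2) ^ ((i + 1) / 2) : ℝ) := by
      intro x
      rw [← mul_pow, Complex.mul_conj, Complex.normSq_eq_norm_sq]
      push_cast
      rfl
    simp_rw [h2]
    rw [integral_complex_ofReal, Complex.re_mul_ofReal]
    have h3 : (trigPhase k γ i * starRingEnd ℂ (trigPhase k γ j)).re = 0 := by
      rcases Nat.even_or_odd i with he | ho
      · have hj' : ¬ Even j := by
          rw [Nat.not_even_iff_odd]
          obtain ⟨r, hr⟩ := he
          exact ⟨r - 1, by omega⟩
        have hi0 : i ≠ 0 := by omega
        obtain ⟨r, hr⟩ := he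
        have hj0 : j ≠ 0 := by omega
        have hjk : j ≠ k := by omega
        have he : Even i := ⟨r, hr⟩
        simp [trigPhase, hi0, hj0, hjk, he, hj']
      · have hj' : Even j := by
          obtain ⟨r, hr⟩ := ho
          exact ⟨r + 1, by omega⟩
        have ho' : ¬ Even i := Nat.not_even_iff_odd.2 ho
        obtain ⟨r, hr⟩ := ho
        have hi0 : i ≠ 0 := by omega
        have hj0 : j ≠ 0 := by omega
        have hik : i ≠ k := by omega
        simp [trigPhase, hi0, hj0, hik, ho', hj']
    rw [h3, zero_mul, zero_div]
  · have h2 : ¬ (i + 1) / 2 ≡ (j + 1) / 2 [MOD p] := by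
      intro h
      rw [Nat.ModEq, Nat.mod_eq_of_lt (by omega), Nat.mod_eq_of_lt (by omega)] at h
      exact hn h
    rw [hM _ _ h2, mul_zero, Complex.zero_re, zero_div]

lemma integral_trigFun_sq (hH : AEStronglyMeasurable H μ) (hb : ∀ᵐ x ∂μ, ‖H x‖ ≤ 1)
    (hγ : ‖γ‖ = 1) (i : ℕ) :
    ∫ x, trigFun k γ i (H x) * trigFun k γ i (H x) ∂μ
      = ((trigPhase k γ i ^ 2
          * ∫ x, H x ^ ((i + 1) / 2 + (i + 1) / 2) * starRingEnd ℂ (H x) ^ 0 ∂μ).re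
        + ∫ x, ‖H x‖ ^ (2 * ((i + 1) / 2)) ∂μ) / 2 := by
  unfold trigFun
  rw [integral_re_mul_re hH hb, ← sq]
  congr 2
  have h2 : ∀ x, H x ^ ((i + 1) / 2) * starRingEnd ℂ (H x) ^ ((i + 1) / 2)
      = ((‖H x‖ ^ (2 * ((i + 1) / 2)) : ℝ) : ℂ) := by
    intro x
    rw [← mul_pow, Complex.mul_conj, Complex.normSq_eq_norm_sq, pow_mul]
    push_cast
    rfl
  simp_rw [h2]
  rw [integral_complex_ofReal, Complex.mul_conj, Complex.normSq_eq_norm_sq, norm_trigPhase hγ]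
  simp

lemma integrable_trigFun_mul (hH : AEStronglyMeasurable H μ) (hb : ∀ᵐ x ∂μ, ‖H x‖ ≤ 1)
    (i j : ℕ) : Integrable (fun x => trigFun k γ i (H x) * trigFun k γ j (H x)) μ :=
  integrable_re_mul_re hH hb _ _ _ _

lemma integral_sum_trigFun_mul_sum (hH : AEStronglyMeasurable H μ) (hb : ∀ᵐ x ∂μ, ‖H x‖ ≤ 1)
    (hM : ∀ a b : ℕ, ¬ a ≡ b [MOD p] → ∫ x, H x ^ a * starRingEnd ℂ (H x) ^ b ∂μ = 0)
    (hk : k < p) (x y : Fin (k + 1) → ℝ) :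
    ∫ z, (∑ i, x i * trigFun k γ i (H z)) * (∑ i, y i * trigFun k γ i (H z)) ∂μ
      = ∑ i, x i * y i * ∫ z, trigFun k γ i (H z) * trigFun k γ i (H z) ∂μ := by
  have h1 : ∀ z, (∑ i, x i * trigFun k γ i (H z)) * (∑ i, y i * trigFun k γ i (H z))
      = ∑ i, ∑ j, x i * y j * (trigFun k γ i (H z) * trigFun k γ j (H z)) := by
    intro z
    rw [Finset.sum_mul_sum]
    exact Finset.sum_congr rfl fun i _ => Finset.sum_congr rfl fun j _ => by ring
  simp_rw [h1]
  rw [integral_finsetSum _ fun i _ => integrable_finsetSum _ fun j _ =>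
    (integrable_trigFun_mul hH hb _ _).const_mul _]
  refine Finset.sum_congr rfl fun i _ => ?_
  rw [integral_finsetSum _ fun j _ => (integrable_trigFun_mul hH hb _ _).const_mul _,
    Finset.sum_eq_single i]
  · rw [integral_const_mul]
  · intro j _ hji
    rw [integral_const_mul, integral_trigFun_mul_of_ne hH hb hM hk (by omega) (by omega)
      (fun h => hji (Fin.ext h.symm)), mul_zero]
  · exact fun h => absurd (Finset.mem_univ i) h

end Moments

lemma exists_phase (w : ℂ) : ∃ γ : ℂ, ‖γ‖ = 1 ∧ 0 ≤ (γ ^ 2 * w).re := by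
  obtain ⟨γ, hγ⟩ : ∃ γ : ℂ, γ ^ 2 = Complex.exp (-w.arg * Complex.I) :=
    ⟨Complex.exp (-w.arg * Complex.I / 2), by rw [← Complex.exp_nat_mul]; push_cast; ring_nf⟩
  refine ⟨γ, ?_, ?_⟩
  · have h1 : ‖γ‖ ^ 2 = 1 := by
      rw [← norm_pow, hγ, ← Complex.ofReal_neg, Complex.norm_exp_ofReal_mul_I]
    exact (pow_eq_one_iff_of_nonneg (norm_nonneg _) two_ne_zero).1 h1
  · have h1 : Complex.exp (-w.arg * Complex.I) * w = ‖w‖ := by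
      calc Complex.exp (-w.arg * Complex.I) * w
          = Complex.exp (-w.arg * Complex.I) * (‖w‖ * Complex.exp (w.arg * Complex.I)) := by
            rw [Complex.norm_mul_exp_arg_mul_I]
        _ = ‖w‖ := by
            rw [mul_left_comm, ← Complex.exp_add, neg_mul, neg_add_cancel, Complex.exp_zero,
              mul_one]
    rw [hγ, h1, Complex.ofReal_re]
    positivity

lemma exists_contDiff_eqOn_closure {U N : Set ℂ} {G : ℂ → ℂ} (hU : IsOpen U) (hN : IsOpen N)
    (hUN : closure U ⊆ N) (hG : ContDiffOn ℝ (⊤ : ℕ∞) G N) :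
    ∃ G' : ℂ → ℂ, ContDiff ℝ (⊤ : ℕ∞) G' ∧ EqOn G' G (closure U) ∧
      ∀ z ∈ U, fderiv ℝ G' z = fderiv ℝ G z := by
  obtain ⟨V, hV, hUV, hVN⟩ := normal_exists_closure_subset isClosed_closure hN hUN
  obtain ⟨χ, h1, h0, -⟩ := exists_contMDiffMap_one_nhds_of_subset_interior
    (n := (⊤ : ℕ∞)) (modelWithCornersSelf ℝ ℂ) (s := closure U) (t := V) isClosed_closure
    (by rwa [hV.interior_eq])
  have hχ : ContDiff ℝ (⊤ : ℕ∞) χ := χ.contMDiff.contDiff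
  have heq : EqOn (fun z => χ z • G z) G (closure U) := by
    intro z hz
    have := h1.self_of_nhdsSet z hz
    simp [this]
  refine ⟨fun z => χ z • G z, ?_, heq, ?_⟩
  · rw [contDiff_iff_contDiffAt]
    intro z
    by_cases hz : z ∈ N
    · exact hχ.contDiffAt.smul (hG.contDiffAt (hN.mem_nhds hz))
    · have hz' : z ∉ closure V := fun h => hz (hVN h)
      have : (fun z => χ z • G z) =ᶠ[𝓝 z] fun _ => 0 := by
        filter_upwards [isClosed_closure.isOpen_compl.mem_nhds hz'] with y hy
        rw [h0 y fun h => hy (subset_closure h), zero_smul]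
      exact contDiffAt_const.congr_of_eventuallyEq this
  · intro z hz
    refine Filter.EventuallyEq.fderiv_eq ?_
    filter_upwards [hU.mem_nhds hz] with y hy
    exact heq (subset_closure hy)

lemma fderiv_re_comp {P : ℂ → ℂ} {c : ℂ} {G : ℂ → ℂ} {z : ℂ} (hP : HasDerivAt P c (G z))
    (hG : DifferentiableAt ℝ G z) (v : ℂ) :
    fderiv ℝ (fun z => (P (G z)).re) z v = (c * fderiv ℝ G z v).re := by
  have h := Complex.reCLM.hasFDerivAt.comp z
    ((hP.hasFDerivAt.restrictScalars ℝ).comp z hG.hasFDerivAt)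
  have h2 : fderiv ℝ (fun z => (P (G z)).re) z = _ := h.fderiv
  rw [h2]
  simp [mul_comm]

lemma lintegral_fderiv_re_comp_le {U : Set ℂ} {G P P' : ℂ → ℂ} {η : ℝ} (hU : IsOpen U)
    (hη : 0 ≤ η) (hG : ∀ z ∈ U, DifferentiableAt ℝ G z) (hlt : ∀ z ∈ U, ‖G z‖ < 1)
    (hinj : InjOn G U)
    (hqc : ∀ z ∈ U, ‖fderiv ℝ G z‖ ^ 2 ≤ (1 + η) * |(fderiv ℝ G z).det|)
    (hP : ∀ z, HasDerivAt P (P' z) z) :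
    ∫⁻ z in U, (‖fderiv ℝ (fun z => (P (G z)).re) z‖₊ : ℝ≥0∞) ^ 2
      ≤ ENNReal.ofReal (1 + η) * ∫⁻ z in ball (0 : ℂ) 1, (‖P' z‖₊ : ℝ≥0∞) ^ 2 := by
  calc ∫⁻ z in U, (‖fderiv ℝ (fun z => (P (G z)).re) z‖₊ : ℝ≥0∞) ^ 2
      ≤ ∫⁻ z in U, ENNReal.ofReal (1 + η) *
          (ENNReal.ofReal |(fderiv ℝ G z).det| * (‖P' (G z)‖₊ : ℝ≥0∞) ^ 2) := by
        refine setLIntegral_mono' hU.measurableSet fun z hz => ?_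
        have h1 : ‖fderiv ℝ (fun z => (P (G z)).re) z‖ ≤ ‖P' (G z)‖ * ‖fderiv ℝ G z‖ := by
          refine ContinuousLinearMap.opNorm_le_bound _ (by positivity) fun v => ?_
          rw [fderiv_re_comp (hP _) (hG z hz)]
          calc ‖(P' (G z) * fderiv ℝ G z v).re‖ ≤ ‖P' (G z) * fderiv ℝ G z v‖ :=
                Complex.abs_re_le_norm _
            _ = ‖P' (G z)‖ * ‖fderiv ℝ G z v‖ := norm_mul _ _
            _ ≤ ‖P' (G z)‖ * (‖fderiv ℝ G z‖ * ‖v‖) := by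
              gcongr; exact (fderiv ℝ G z).le_opNorm v
            _ = _ := by ring
        have h2 : ‖fderiv ℝ (fun z => (P (G z)).re) z‖ ^ 2
            ≤ (1 + η) * (|(fderiv ℝ G z).det| * ‖P' (G z)‖ ^ 2) := by
          calc _ ≤ (‖P' (G z)‖ * ‖fderiv ℝ G z‖) ^ 2 := by gcongr
            _ = ‖P' (G z)‖ ^ 2 * ‖fderiv ℝ G z‖ ^ 2 := by ring
            _ ≤ ‖P' (G z)‖ ^ 2 * ((1 + η) * |(fderiv ℝ G z).det|) := by
              gcongr; exact hqc z hz
            _ = _ := by ring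
        have h3 := ENNReal.ofReal_le_ofReal h2
        rw [ENNReal.ofReal_mul (by linarith), ENNReal.ofReal_mul (abs_nonneg _),
          ENNReal.ofReal_pow (norm_nonneg _), ENNReal.ofReal_pow (norm_nonneg _)] at h3
        simp only [ofReal_norm] at h3
        exact h3
    _ = ENNReal.ofReal (1 + η) * ∫⁻ z in G '' U, (‖P' z‖₊ : ℝ≥0∞) ^ 2 := by
        rw [lintegral_const_mul' _ _ ENNReal.ofReal_ne_top,
          lintegral_image_eq_lintegral_abs_det_fderiv_mul volume hU.measurableSet
            (fun z hz => (hG z hz).hasFDerivAt.hasFDerivWithinAt) hinj]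
    _ ≤ _ := by
        gcongr
        rintro _ ⟨z, hz, rfl⟩
        exact mem_ball_zero_iff.2 (hlt z hz)

lemma lintegral_ball_deriv_sq {P P' : ℂ → ℂ} (hP : ∀ z, HasDerivAt P (P' z) z) {P'' : ℂ → ℂ}
    (hP' : ∀ z, HasDerivAt P' (P'' z) z) (hc : Continuous P'') :
    ∫⁻ z in ball (0 : ℂ) 1, (‖P' z‖₊ : ℝ≥0∞) ^ 2
      = ENNReal.ofReal (∫ θ in (-Real.pi)..Real.pi, (P (Complex.exp (θ * Complex.I))).re *
        (Complex.exp (θ * Complex.I) * P' (Complex.exp (θ * Complex.I))).re) := by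
  have hP'c : Continuous P' := continuous_iff_continuousAt.2 fun z => (hP' z).continuousAt
  have hd : ∀ z v, fderiv ℝ (fun z => (P z).re) z v = (P' z * v).re := fun z v => by
    have := fderiv_re_comp (G := fun z => z) (hP z) differentiableAt_id v
    simpa using this
  have hf : ContDiff ℝ 1 fun z => (P z).re := by
    have : Differentiable ℂ P := fun z => (hP z).differentiableAt
    exact Complex.reCLM.contDiff.comp (this.contDiff.restrict_scalars ℝ)
  rw [← integral_ball_fderiv_conj hf hP' hc]
  have h1 : ∀ z, fderiv ℝ (fun z => (P z).re) z (starRingEnd ℂ (P' z)) = ‖P' z‖ ^ 2 := fun z => by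
    rw [hd, Complex.mul_conj, Complex.normSq_eq_norm_sq, Complex.ofReal_re]
  simp_rw [h1]
  rw [ofReal_integral_eq_lintegral_ofReal]
  · refine lintegral_congr fun z => ?_
    rw [ENNReal.ofReal_pow (norm_nonneg _), ofReal_norm]
    rfl
  · exact ((hP'c.norm.pow 2).continuousOn.integrableOn_compact
      (isCompact_closedBall (0 : ℂ) 1)).mono_set ball_subset_closedBall
  · exact ae_of_all _ fun z => by positivity

lemma integral_expMulI_pow_mul_conj_pow {a b : ℕ} (hab : a ≠ b) :
    ∫ θ in Ioc (-Real.pi) Real.pi, Complex.exp (θ * Complex.I) ^ a *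
      starRingEnd ℂ (Complex.exp (θ * Complex.I)) ^ b = 0 := by
  have hc : ((a : ℂ) - b) * Complex.I ≠ 0 :=
    mul_ne_zero (sub_ne_zero.2 (by exact_mod_cast hab)) Complex.I_ne_zero
  have h1 : ∀ θ : ℝ, Complex.exp (θ * Complex.I) ^ a *
      starRingEnd ℂ (Complex.exp (θ * Complex.I)) ^ b
      = Complex.exp (((a : ℂ) - b) * Complex.I * θ) := fun θ => by
    rw [← Complex.exp_conj, map_mul, Complex.conj_I, Complex.conj_ofReal, ← Complex.exp_nat_mul,
      ← Complex.exp_nat_mul, ← Complex.exp_add]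
    ring_nf
  simp_rw [h1]
  rw [← intervalIntegral.integral_of_le (by linarith [Real.pi_pos]), integral_exp_mul_complex hc,
    div_eq_zero_iff, sub_eq_zero]
  left
  rw [Complex.exp_eq_exp_iff_exists_int]
  refine ⟨(a : ℤ) - b, ?_⟩
  push_cast
  ring

/-- The complex polynomial whose real part is a combination of the real trigonometric family. -/
def trigPoly (k : ℕ) (γ : ℂ) (x : Fin (k + 1) → ℝ) (z : ℂ) : ℂ :=
  ∑ i, (x i : ℂ) * (trigPhase k γ i * z ^ (((i : ℕ) + 1) / 2))

lemma re_trigPoly (k : ℕ) (γ : ℂ) (x : Fin (k + 1) → ℝ) (z : ℂ) :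
    (trigPoly k γ x z).re = ∑ i, x i * trigFun k γ i z := by
  simp [trigPoly, trigFun]

lemma hasDerivAt_trigPoly (k : ℕ) (γ : ℂ) (x : Fin (k + 1) → ℝ) (z : ℂ) :
    HasDerivAt (trigPoly k γ x) (deriv (trigPoly k γ x) z) z := by
  refine DifferentiableAt.hasDerivAt ?_
  unfold trigPoly
  fun_prop

lemma mul_deriv_trigPoly (k : ℕ) (γ : ℂ) (x : Fin (k + 1) → ℝ) (z : ℂ) :
    z * deriv (trigPoly k γ x) z
      = trigPoly k γ (fun i => ((((i : ℕ) + 1) / 2 : ℕ) : ℝ) * x i) z := by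
  have h : HasDerivAt (trigPoly k γ x) (∑ i, (x i : ℂ) * (trigPhase k γ i *
      (((((i : ℕ) + 1) / 2 : ℕ) : ℂ) * z ^ (((i : ℕ) + 1) / 2 - 1)))) z := by
    unfold trigPoly
    exact HasDerivAt.fun_sum fun i _ => ((hasDerivAt_pow _ z).const_mul _).const_mul _
  rw [h.deriv, Finset.mul_sum]
  refine Finset.sum_congr rfl fun i _ => ?_
  rcases Nat.eq_zero_or_pos (((i : ℕ) + 1) / 2) with h0 | h0
  · simp [h0]
  · obtain ⟨n, hn⟩ := Nat.exists_eq_succ_of_ne_zero h0.ne'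
    simp only [hn, Nat.succ_eq_add_one, Nat.add_sub_cancel, pow_succ]
    push_cast
    ring

lemma lintegral_ball_deriv_trigPoly_le {k : ℕ} {γ : ℂ} (hγ : ‖γ‖ = 1) (x : Fin (k + 1) → ℝ) :
    ∫⁻ z in ball (0 : ℂ) 1, (‖deriv (trigPoly k γ x) z‖₊ : ℝ≥0∞) ^ 2
      ≤ ENNReal.ofReal (Real.pi * ((k + 1) / 2 : ℕ) * ∑ i, x i ^ 2) := by
  have hdiff : Differentiable ℂ (trigPoly k γ x) := fun z =>
    (hasDerivAt_trigPoly k γ x z).differentiableAt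
  have hcd : ContDiff ℂ (⊤ : ℕ∞) (trigPoly k γ x) := hdiff.contDiff
  have hcd1 : ContDiff ℂ (⊤ : ℕ∞) (deriv (trigPoly k γ x)) := hcd.deriv'
  rw [lintegral_ball_deriv_sq (hasDerivAt_trigPoly k γ x)
    (fun z => (hcd1.differentiable (by simp) z).hasDerivAt)
    (hcd1.continuous_deriv (by exact_mod_cast le_top))]
  simp_rw [mul_deriv_trigPoly, re_trigPoly]
  refine ENNReal.ofReal_le_ofReal ?_
  rw [intervalIntegral.integral_of_le (by linarith [Real.pi_pos])]
  set H : ℝ → ℂ := fun θ => Complex.exp (θ * Complex.I) with hH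
  have hHm : AEStronglyMeasurable H (volume.restrict (Ioc (-Real.pi) Real.pi)) :=
    continuous_expMulI.aestronglyMeasurable
  have hn : ∀ θ, ‖H θ‖ = 1 := fun θ => Complex.norm_exp_ofReal_mul_I θ
  have hb : ∀ᵐ θ ∂(volume.restrict (Ioc (-Real.pi) Real.pi)), ‖H θ‖ ≤ 1 :=
    ae_of_all _ fun θ => (hn θ).le
  have hM : ∀ a b : ℕ, ¬ a ≡ b [MOD k + 1] → ∫ θ in Ioc (-Real.pi) Real.pi,
      H θ ^ a * starRingEnd ℂ (H θ) ^ b = 0 := fun a b hab =>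
    integral_expMulI_pow_mul_conj_pow fun h => hab (h ▸ rfl)
  rw [integral_sum_trigFun_mul_sum hHm hb hM (Nat.lt_succ_self k), Finset.mul_sum]
  refine Finset.sum_le_sum fun i _ => ?_
  rcases Nat.eq_zero_or_pos (((i : ℕ) + 1) / 2) with h0 | h0
  · rw [h0]
    simp only [Nat.cast_zero, zero_mul, mul_zero]
    positivity
  · rw [integral_trigFun_sq hHm hb hγ,
      integral_expMulI_pow_mul_conj_pow (by omega)]
    have hle : (((((i : ℕ) + 1) / 2 : ℕ)) : ℝ) ≤ ((k + 1) / 2 : ℕ) := by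
      exact_mod_cast Nat.div_le_div_right (by omega)
    simp only [hn, one_pow, mul_zero, Complex.zero_re, zero_add, integral_const,
      MeasurableSet.univ, measureReal_restrict_apply, univ_inter, Real.volume_real_Ioc, smul_eq_mul,
      mul_one]
    rw [max_eq_left (by linarith [Real.pi_pos])]
    have : 0 ≤ (((k + 1) / 2 : ℕ) - ((((i : ℕ) + 1) / 2 : ℕ) : ℝ)) * (Real.pi * x i ^ 2) :=
      mul_nonneg (by linarith) (by positivity)
    nlinarith

lemma exists_invariant_measurable_le {X : Type*} [MeasurableSpace X] {μ : Measure X} {T : X → X}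
    {Γ : Set X} {w : X → ℝ≥0∞} {p : ℕ} (hT : Measurable T) (hΓ : MeasurableSet Γ)
    (hTΓ : MapsTo T Γ Γ) (hp : 0 < p) (hTp : ∀ x, T^[p] x = x) (hw : ∀ x ∈ Γ, w (T x) = w x) :
    ∃ g : X → ℝ≥0∞, Measurable g ∧ (∀ x ∈ Γ, g x ≤ w x) ∧
      ∫⁻ x in Γ, g x ∂μ = ∫⁻ x in Γ, w x ∂μ ∧ ∀ x, g (T x) = g x := by
  obtain ⟨g, hg, hgw, hgi⟩ := exists_measurable_le_lintegral_eq (μ := μ.restrict Γ) w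
  have hwj : ∀ j : ℕ, ∀ x ∈ Γ, T^[j] x ∈ Γ ∧ w (T^[j] x) = w x := by
    intro j
    induction j with
    | zero => exact fun x hx => ⟨hx, rfl⟩
    | succ j ih =>
      intro x hx
      rw [Function.iterate_succ_apply', hw _ (ih x hx).1]
      exact ⟨hTΓ (ih x hx).1, (ih x hx).2⟩
  have hle : ∀ x ∈ Γ, ⨆ j : ℕ, g (T^[j] x) ≤ w x := fun x hx =>
    iSup_le fun j => (hgw _).trans (hwj j x hx).2.le
  refine ⟨fun x => ⨆ j : ℕ, g (T^[j] x), Measurable.iSup fun j => hg.comp (hT.iterate j), hle,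
    le_antisymm (setLIntegral_mono' hΓ hle) ?_, fun x => le_antisymm ?_ ?_⟩
  · rw [hgi]
    exact lintegral_mono fun x => le_iSup (fun j : ℕ => g (T^[j] x)) 0
  · exact iSup_le fun j => le_iSup_of_le (j + 1) le_rfl
  · refine iSup_le fun j => le_iSup_of_le (j + p - 1) ?_
    rw [← Function.iterate_succ_apply T, Nat.succ_eq_add_one, Nat.sub_add_cancel (by omega),
      Function.iterate_add_apply, hTp]

lemma MeasureTheory.MeasurePreserving.withDensity_of_invariant {X : Type*} [MeasurableSpace X]
    {μ : Measure X} {T : X → X} (hT : MeasurePreserving T μ μ) {g : X → ℝ≥0∞} (hg : Measurable g)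
    (hgT : ∀ x, g (T x) = g x) : MeasurePreserving T (μ.withDensity g) (μ.withDensity g) := by
  refine ⟨hT.measurable, ?_⟩
  ext s hs
  rw [Measure.map_apply hT.measurable hs, withDensity_apply _ (hT.measurable hs),
    withDensity_apply _ hs, ← hT.setLIntegral_comp_preimage hs hg]
  simp_rw [hgT]

section Moments

variable {X : Type*} [MeasurableSpace X] {μ : Measure X} [IsFiniteMeasure μ] {H : X → ℂ}

lemma le_integral_sum_trigFun_sq (hH : AEStronglyMeasurable H μ) (hb : ∀ᵐ x ∂μ, ‖H x‖ ≤ 1)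
    {p k : ℕ}
    (hM : ∀ a b : ℕ, ¬ a ≡ b [MOD p] → ∫ x, H x ^ a * starRingEnd ℂ (H x) ^ b ∂μ = 0)
    (hk : k < p) {γ : ℂ} (hγ : ‖γ‖ = 1)
    (hγ' : 0 ≤ (γ ^ 2 * ∫ x, H x ^ ((k + 1) / 2 + (k + 1) / 2) *
      starRingEnd ℂ (H x) ^ 0 ∂μ).re) {c : ℝ} (hc0 : 0 ≤ c) (hc1 : c ≤ 1)
    (hc : ∀ᵐ x ∂μ, c ≤ ‖H x‖) (x : Fin (k + 1) → ℝ) :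
    c ^ (2 * ((k + 1) / 2)) / 2 * μ.real univ * ∑ i, x i ^ 2
      ≤ ∫ z, (∑ i, x i * trigFun k γ i (H z)) ^ 2 ∂μ := by
  simp_rw [sq (∑ i, x i * trigFun k γ i (H _))]
  rw [integral_sum_trigFun_mul_sum hH hb hM hk, Finset.mul_sum]
  refine Finset.sum_le_sum fun i _ => ?_
  rw [← sq, mul_comm]
  refine mul_le_mul_of_nonneg_left ?_ (sq_nonneg _)
  rw [integral_trigFun_sq hH hb hγ]
  have h1 : 0 ≤ (trigPhase k γ i ^ 2 * ∫ x, H x ^ (((i : ℕ) + 1) / 2 + ((i : ℕ) + 1) / 2) *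
      starRingEnd ℂ (H x) ^ 0 ∂μ).re := by
    rcases Nat.eq_zero_or_pos (i : ℕ) with h0 | h0
    · simp [h0, trigPhase, integral_const]
    · by_cases hi : ¬ Even (i : ℕ) ∧ (i : ℕ) = k
      · have : trigPhase k γ i = γ := by
          simp only [trigPhase, h0.ne', if_false, hi.1]
          rw [if_pos hi.2]
        rw [this, hi.2]
        exact hγ'
      · have hmod : ¬ ((i : ℕ) + 1) / 2 + ((i : ℕ) + 1) / 2 ≡ 0 [MOD p] := by
          intro h
          have := Nat.le_of_dvd (by omega) ((Nat.modEq_zero_iff_dvd).1 h)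
          rw [Nat.even_iff] at hi
          omega
        rw [hM _ _ hmod, mul_zero, Complex.zero_re]
  have h2 : c ^ (2 * ((k + 1) / 2)) * μ.real univ
      ≤ ∫ x, ‖H x‖ ^ (2 * (((i : ℕ) + 1) / 2)) ∂μ := by
    have h_int : Integrable (fun x => ‖H x‖ ^ (2 * (((i : ℕ) + 1) / 2))) μ := by
      refine Integrable.of_bound (C := 1) (hH.norm.pow _) ?_
      filter_upwards [hb] with x hx
      rw [norm_pow, norm_norm]
      exact pow_le_one₀ (norm_nonneg _) hx
    calc c ^ (2 * ((k + 1) / 2)) * μ.real univ = ∫ _, c ^ (2 * ((k + 1) / 2)) ∂μ := by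
          rw [integral_const, smul_eq_mul, mul_comm]
      _ ≤ _ := by
          refine integral_mono_ae (integrable_const _) h_int ?_
          filter_upwards [hc] with x hx
          calc c ^ (2 * ((k + 1) / 2)) ≤ c ^ (2 * (((i : ℕ) + 1) / 2)) :=
                pow_le_pow_of_le_one hc0 hc1
                  (Nat.mul_le_mul_left 2 (Nat.div_le_div_right (by omega)))
            _ ≤ _ := by gcongr
  linarith

end Moments

lemma IsPrimitiveRoot.pow_mul_conj_pow_eq_one_iff {p : ℕ} {ω : ℂ} (hω : IsPrimitiveRoot ω p)
    (hp : p ≠ 0) (a b : ℕ) : ω ^ a * starRingEnd ℂ ω ^ b = 1 ↔ a ≡ b [MOD p] := by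
  have hn : ‖ω‖ = 1 := hω.norm'_eq_one hp
  have h1 : ω ^ b * starRingEnd ℂ ω ^ b = 1 := by
    rw [← mul_pow, Complex.mul_conj, Complex.normSq_eq_norm_sq, hn]; simp
  have h0 : starRingEnd ℂ ω ^ b ≠ 0 := right_ne_zero_of_mul_eq_one h1
  constructor
  · intro h
    have h2 := mul_right_cancel₀ h0 (h.trans h1.symm)
    rw [Nat.ModEq]
    refine hω.pow_inj (Nat.mod_lt _ (by omega)) (Nat.mod_lt _ (by omega)) ?_
    rw [hω.eq_orderOf, pow_mod_orderOf, pow_mod_orderOf, h2]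
  · intro h
    have h2 : ω ^ a = ω ^ b := by
      rw [← pow_mod_orderOf ω a, ← pow_mod_orderOf ω b, ← hω.eq_orderOf, h]
    rw [h2, h1]

lemma mul_mem_iff {U : Set ℂ} {p : ℕ} (hp : p ≠ 0) {ω : ℂ} (hω : IsPrimitiveRoot ω p)
    (hsym : ∀ z ∈ U, ω * z ∈ U) (z : ℂ) : ω * z ∈ U ↔ z ∈ U := by
  refine ⟨fun h => ?_, hsym z⟩
  have := pow_mul_mem hsym (p - 1) h
  rwa [← mul_assoc, ← pow_succ, Nat.sub_add_cancel (by omega), hω.pow_eq_one, one_mul] at this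

lemma mul_mem_frontier_iff {U : Set ℂ} {p : ℕ} (hp : p ≠ 0) {ω : ℂ} (hω : IsPrimitiveRoot ω p)
    (hsym : ∀ z ∈ U, ω * z ∈ U) (z : ℂ) : ω * z ∈ frontier U ↔ z ∈ frontier U := by
  have h := (Homeomorph.mulLeft₀ ω (hω.ne_zero hp)).preimage_frontier U
  have h2 : (Homeomorph.mulLeft₀ ω (hω.ne_zero hp)) ⁻¹' U = U := by
    ext z
    exact mul_mem_iff hp hω hsym z
  rw [h2] at h
  exact Set.ext_iff.1 h z

lemma exists_small_distortion {m : ℕ} {B : ℝ} (hB : 2 * Real.pi * m < B) :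
    ∃ η : ℝ, 0 < η ∧ η < 1 ∧ 2 * Real.pi * m * (1 + η) ≤ B * (1 - η) ^ (2 * m) := by
  have h1 : ∀ᶠ η : ℝ in 𝓝[>] 0, 2 * Real.pi * m * (1 + η) < B * (1 - η) ^ (2 * m) := by
    refine (ContinuousAt.eventually_lt (by fun_prop) (by fun_prop) ?_).filter_mono
      nhdsWithin_le_nhds
    simpa using hB
  obtain ⟨η, ⟨h, h0⟩, h2⟩ := ((h1.and (self_mem_nhdsWithin)).and
    (nhdsWithin_le_nhds (Iio_mem_nhds (zero_lt_one' ℝ)))).exists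
  exact ⟨η, h0, h2, h.le⟩

theorem exists_test_functions {U : Set ℂ} (hU : IsOpen U) (hsc : IsSimplyConnected U)
    (hbd : Bornology.IsBounded U) (hcone : ∀ x ∈ frontier U, (inwardCone U x).Nonempty)
    {p k : ℕ} (hp : 2 ≤ p) (hk : k < p) {ω : ℂ}
    (hω : ω = Complex.exp (2 * Real.pi * Complex.I / p)) (hsym : ∀ z ∈ U, ω * z ∈ U)
    {w : ℂ → ℝ≥0∞} (hw : ∀ z ∈ frontier U, w (ω * z) = w z)
    (hL0 : ∫⁻ z in frontier U, w z ∂μH[1] ≠ 0) (hL : ∫⁻ z in frontier U, w z ∂μH[1] ≠ ∞)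
    {B : ℝ} (hB : 2 * Real.pi * ((k + 1) / 2 : ℕ) < B) :
    ∃ Φ : (Fin (k + 1) → ℝ) →ₗ[ℝ] (ℂ → ℝ), (∀ x, ContDiff ℝ (⊤ : ℕ∞) (Φ x)) ∧
      ∀ x ≠ 0, ¬ EqOn (Φ x) 0 (frontier U) ∧
        (∫⁻ z in U, (‖fderiv ℝ (Φ x) z‖₊ : ℝ≥0∞) ^ 2) * ∫⁻ z in frontier U, w z ∂μH[1]
          ≤ ENNReal.ofReal B * ∫⁻ z in frontier U, w z * ENNReal.ofReal (Φ x z ^ 2) ∂μH[1] := by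
  have hp0 : p ≠ 0 := by omega
  have hprim : IsPrimitiveRoot ω p := hω ▸ Complex.isPrimitiveRoot_exp p hp0
  have hn : ‖ω‖ = 1 := hprim.norm'_eq_one hp0
  obtain ⟨η, hη0, hη1, hη⟩ := exists_small_distortion hB
  obtain ⟨G₀, N, hN, hUN, hG₀, hlt₀, hinj₀, heq₀, hfr₀, hqc₀⟩ :=
    exists_almost_riemann_map hU hsc hbd hcone hp hω hsym hη0
  obtain ⟨G, hG, hGG, hGd⟩ := exists_contDiff_eqOn_closure hU hN hUN hG₀
  have hΓc : frontier U ⊆ closure U := frontier_subset_closure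
  have hlt : ∀ z ∈ closure U, ‖G z‖ < 1 := fun z hz => hGG hz ▸ hlt₀ z (hUN hz)
  have hfr : ∀ z ∈ frontier U, 1 - η ≤ ‖G z‖ := fun z hz => hGG (hΓc hz) ▸ hfr₀ z hz
  have hmf := mul_mem_frontier_iff hp0 hprim hsym
  have heq : ∀ z ∈ frontier U, G (ω * z) = ω * G z := fun z hz => by
    rw [hGG (hΓc hz), hGG (hΓc ((hmf z).2 hz)), heq₀ z (hΓc hz)]
  have hΓm : MeasurableSet (frontier U) := isClosed_frontier.measurableSet
  -- the invariant boundary measure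
  let T : ℂ ≃ₗᵢ[ℝ] ℂ := rotation ⟨ω, mem_sphere_zero_iff_norm.2 hn⟩
  have hT : ∀ z, T z = ω * z := fun z => rotation_apply _ z
  have hTm : Measurable T := T.continuous.measurable
  have hTmp : MeasurePreserving T (μH[1].restrict (frontier U)) (μH[1].restrict (frontier U)) := by
    have h := (T.toIsometryEquiv.measurePreserving_hausdorffMeasure 1).restrict_preimage hΓm
    have h2 : T.toIsometryEquiv ⁻¹' frontier U = frontier U := by
      ext z
      rw [mem_preimage]
      exact hT z ▸ hmf z
    rw [h2] at h
    exact h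
  have hTit : ∀ (j : ℕ) z, T^[j] z = ω ^ j * z := by
    intro j
    induction j with
    | zero => simp
    | succ j ih => intro z; rw [Function.iterate_succ_apply', ih, hT, pow_succ']; ring
  obtain ⟨g, hg, hgw, hgi, hgT⟩ := exists_invariant_measurable_le (μ := μH[1]) (w := w) (T := T)
    hTm hΓm (fun z hz => hT z ▸ (hmf z).2 hz) (by omega : 0 < p)
    (fun z => by rw [hTit, hprim.pow_eq_one, one_mul]) (fun z hz => hT z ▸ hw z hz)
  set ν : Measure ℂ := (μH[1].restrict (frontier U)).withDensity g with hν
  have hνT : MeasurePreserving T ν ν := hTmp.withDensity_of_invariant hg hgT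
  have hνu : ν univ = ∫⁻ z in frontier U, w z ∂μH[1] := by
    rw [hν, withDensity_apply _ MeasurableSet.univ, Measure.restrict_univ, hgi]
  have hfin : IsFiniteMeasure ν := ⟨by rw [hνu]; exact hL.lt_top⟩
  have hνΓ : ∀ᵐ z ∂ν, z ∈ frontier U :=
    (withDensity_absolutelyContinuous _ _).ae_le (ae_restrict_mem hΓm)
  have hGm : AEStronglyMeasurable G ν := hG.continuous.aestronglyMeasurable
  have hb : ∀ᵐ z ∂ν, ‖G z‖ ≤ 1 := hνΓ.mono fun z hz => (hlt z (hΓc hz)).le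
  have hM : ∀ a b : ℕ, ¬ a ≡ b [MOD p] → ∫ z, G z ^ a * starRingEnd ℂ (G z) ^ b ∂ν = 0 := by
    intro a b hab
    have h1 : ∫ z, G (T z) ^ a * starRingEnd ℂ (G (T z)) ^ b ∂ν
        = ∫ z, G z ^ a * starRingEnd ℂ (G z) ^ b ∂ν :=
      hνT.integral_comp T.toHomeomorph.measurableEmbedding
        (fun z => G z ^ a * starRingEnd ℂ (G z) ^ b)
    have h2 : ∫ z, G (T z) ^ a * starRingEnd ℂ (G (T z)) ^ b ∂ν
        = (ω ^ a * starRingEnd ℂ ω ^ b) * ∫ z, G z ^ a * starRingEnd ℂ (G z) ^ b ∂ν := by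
      rw [← integral_const_mul]
      refine integral_congr_ae (hνΓ.mono fun z hz => ?_)
      simp only
      rw [hT, heq z hz, map_mul, mul_pow, mul_pow]
      ring
    rw [h1] at h2
    by_contra h0
    exact hab ((hprim.pow_mul_conj_pow_eq_one_iff hp0 a b).1
      (mul_right_cancel₀ h0 (h2.symm.trans (one_mul _).symm)))
  obtain ⟨γ, hγ, hγ'⟩ := exists_phase (∫ z, G z ^ ((k + 1) / 2 + (k + 1) / 2) *
    starRingEnd ℂ (G z) ^ 0 ∂ν)
  have hlow := le_integral_sum_trigFun_sq hGm hb hM hk hγ hγ' (c := 1 - η) (by linarith)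
    (by linarith) (hνΓ.mono fun z hz => hfr z hz)
  have hℓ : 0 < ν.real univ := ENNReal.toReal_pos (hνu ▸ hL0) (measure_ne_top _ _)
  have hS : ∀ x : Fin (k + 1) → ℝ, x ≠ 0 → 0 < ∑ i, x i ^ 2 := by
    intro x hx
    obtain ⟨i, hi⟩ := Function.ne_iff.1 hx
    exact Finset.sum_pos' (fun i _ => sq_nonneg _) ⟨i, Finset.mem_univ i, by positivity [show x i ≠ 0 from hi]⟩
  let Φ : (Fin (k + 1) → ℝ) →ₗ[ℝ] (ℂ → ℝ) :=
    { toFun := fun x z => ∑ i, x i * trigFun k γ i (G z)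
      map_add' := fun x y => by
        ext z
        simp [add_mul, Finset.sum_add_distrib]
      map_smul' := fun c x => by
        ext z
        simp [Finset.mul_sum, mul_assoc] }
  have hΦ : ∀ x, Φ x = fun z => (trigPoly k γ x (G z)).re := fun x => by
    ext z
    exact (re_trigPoly k γ x (G z)).symm
  have hΦc : ∀ x, ContDiff ℝ (⊤ : ℕ∞) (Φ x) := by
    intro x
    have hP : ContDiff ℂ (⊤ : ℕ∞) (trigPoly k γ x) := by
      unfold trigPoly
      fun_prop
    rw [hΦ]
    exact Complex.reCLM.contDiff.comp ((hP.restrict_scalars ℝ).comp hG)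
  refine ⟨Φ, hΦc, fun x hx => ⟨fun h0 => ?_, ?_⟩⟩
  · have h1 : ∫ z, (∑ i, x i * trigFun k γ i (G z)) ^ 2 ∂ν = 0 := by
      refine integral_eq_zero_of_ae (hνΓ.mono fun z hz => ?_)
      have : ∑ i, x i * trigFun k γ i (G z) = 0 := h0 hz
      simp [this]
    have h2 := hlow x
    rw [h1] at h2
    have h3 : 0 < (1 - η) ^ (2 * ((k + 1) / 2)) / 2 * ν.real univ * ∑ i, x i ^ 2 :=
      mul_pos (mul_pos (half_pos (pow_pos (by linarith) _)) hℓ) (hS x hx)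
    linarith
  · have hE : ∫⁻ z in U, (‖fderiv ℝ (Φ x) z‖₊ : ℝ≥0∞) ^ 2
        ≤ ENNReal.ofReal ((1 + η) * (Real.pi * ((k + 1) / 2 : ℕ) * ∑ i, x i ^ 2)) := by
      rw [hΦ, ENNReal.ofReal_mul (by linarith)]
      refine (lintegral_fderiv_re_comp_le hU hη0.le
        (fun z _ => hG.contDiffAt.differentiableAt (by simp)) (fun z hz => hlt z (subset_closure hz))
        (hinj₀.congr fun z hz => (hGG (subset_closure hz)).symm)
        (fun z hz => by rw [hGd z hz]; exact hqc₀ z hz)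
        (hasDerivAt_trigPoly k γ x)).trans ?_
      gcongr
      exact lintegral_ball_deriv_trigPoly_le hγ x
    have hBd : ENNReal.ofReal ((1 - η) ^ (2 * ((k + 1) / 2)) / 2 * ν.real univ * ∑ i, x i ^ 2)
        ≤ ∫⁻ z in frontier U, w z * ENNReal.ofReal (Φ x z ^ 2) ∂μH[1] := by
      have hm : Measurable fun z => ENNReal.ofReal (Φ x z ^ 2) :=
        ((hΦc x).continuous.pow 2).measurable.ennreal_ofReal
      calc _ ≤ ENNReal.ofReal (∫ z, Φ x z ^ 2 ∂ν) := ENNReal.ofReal_le_ofReal (hlow x)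
        _ ≤ ∫⁻ z, ENNReal.ofReal (Φ x z ^ 2) ∂ν := by
          rw [integral_eq_lintegral_of_nonneg_ae (ae_of_all _ fun z => sq_nonneg _)
            ((hΦc x).continuous.pow 2).aestronglyMeasurable]
          exact ENNReal.ofReal_toReal_le
        _ = ∫⁻ z in frontier U, g z * ENNReal.ofReal (Φ x z ^ 2) ∂μH[1] := by
          rw [hν, lintegral_withDensity_eq_lintegral_mul _ hg hm]
          rfl
        _ ≤ _ := setLIntegral_mono' hΓm fun z hz => by gcongr; exact hgw z hz
    have hLr : ∫⁻ z in frontier U, w z ∂μH[1] = ENNReal.ofReal (ν.real univ) := by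
      rw [← hνu, Measure.real, ENNReal.ofReal_toReal (measure_ne_top _ _)]
    have hB0 : 0 ≤ B := le_trans (by positivity) hB.le
    calc _ ≤ ENNReal.ofReal ((1 + η) * (Real.pi * ((k + 1) / 2 : ℕ) * ∑ i, x i ^ 2))
          * ENNReal.ofReal (ν.real univ) := by rw [hLr]; gcongr
      _ = ENNReal.ofReal ((1 + η) * (Real.pi * ((k + 1) / 2 : ℕ) * ∑ i, x i ^ 2)
          * ν.real univ) := (ENNReal.ofReal_mul' hℓ.le).symm
      _ ≤ ENNReal.ofReal (B *
          ((1 - η) ^ (2 * ((k + 1) / 2)) / 2 * ν.real univ * ∑ i, x i ^ 2)) := by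
        refine ENNReal.ofReal_le_ofReal ?_
        have := mul_le_mul_of_nonneg_right hη
          (by have := hS x hx; positivity : 0 ≤ ν.real univ * ∑ i, x i ^ 2)
        linarith
      _ = ENNReal.ofReal B * _ := ENNReal.ofReal_mul hB0
      _ ≤ _ := by gcongr

lemma IsLipschitzDomain.le_of_mem_closure {Ω U : Set E2} {e : E2 ≃ₗᵢ[ℝ] E2} {φ : ℝ → ℝ}
    (hφ : Continuous φ) (hU : IsOpen U) (h : ∀ x ∈ U, (x ∈ Ω ↔ φ (e x 0) < e x 1)) {y : E2}
    (hyU : y ∈ U) (hy : y ∈ closure Ω) : φ (e y 0) ≤ e y 1 := by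
  have h1 : y ∈ closure (U ∩ Ω) := hU.inter_closure ⟨hyU, hy⟩
  have hc : IsClosed {x : E2 | φ (e x 0) ≤ e x 1} := by
    refine isClosed_le (hφ.comp ?_) ?_ <;> fun_prop
  exact closure_minimal (fun x hx => ((h x hx.1).1 hx.2).le) hc h1

lemma abs_apply_sub_le (e : E2 ≃ₗᵢ[ℝ] E2) (x y : E2) (i : Fin 2) :
    |e x i - e y i| ≤ ‖x - y‖ := by
  have := PiLp.norm_apply_le (e x - e y) i
  rwa [← map_sub, LinearIsometryEquiv.norm_map, map_sub, PiLp.sub_apply, Real.norm_eq_abs] at this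

lemma IsLipschitzDomain.inwardCone_nonempty {Ω : Set E2} (h : IsLipschitzDomain Ω) {x : E2}
    (hx : x ∈ frontier Ω) : (inwardCone Ω x).Nonempty := by
  obtain ⟨e, K, φ, U, hφ, hU, hxU, hch⟩ := h.2.2.2 x hx
  obtain ⟨r, hr, hrU⟩ := Metric.isOpen_iff.1 hU x hxU
  set v : E2 := e.symm (EuclideanSpace.single 1 1) with hv
  have hev : e v = EuclideanSpace.single 1 1 := by simp [hv]
  have hvn : ‖v‖ = 1 := by simp [hv]
  set δ : ℝ := min (min 1 (r / 3)) (1 / (K + 2)) with hδ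
  have hδ0 : 0 < δ := by positivity
  have hδ1 : δ ≤ 1 := (min_le_left _ _).trans (min_le_left _ _)
  have hδr : δ ≤ r / 3 := (min_le_left _ _).trans (min_le_right _ _)
  have hδK : δ * (K + 2) ≤ 1 := by
    rw [← le_div_iff₀ (by positivity)]; exact min_le_right _ _
  refine ⟨v, δ, hδ0, fun y hy hyx w hw s hs => ?_⟩
  rw [dist_eq_norm] at hw hyx
  have hwn : ‖w‖ < 2 := by
    calc ‖w‖ = ‖(w - v) + v‖ := by rw [sub_add_cancel]
      _ ≤ ‖w - v‖ + ‖v‖ := norm_add_le _ _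
      _ < 2 := by linarith
  have hyU : y ∈ U := hrU (by rw [mem_ball, dist_eq_norm]; linarith)
  have hwU : y + s • w ∈ U := by
    refine hrU ?_
    rw [mem_ball, dist_eq_norm]
    calc ‖y + s • w - x‖ = ‖(y - x) + s • w‖ := by congr 1; abel
      _ ≤ ‖y - x‖ + ‖s • w‖ := norm_add_le _ _
      _ = ‖y - x‖ + s * ‖w‖ := by rw [norm_smul, Real.norm_of_nonneg hs.1.le]
      _ < δ + δ * 2 := by
        have := mul_lt_mul'' hs.2 hwn hs.1.le (norm_nonneg _)
        linarith
      _ ≤ r := by linarith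
  rw [hch _ hwU]
  have h0 := abs_apply_sub_le e w v 0
  have h1 := abs_apply_sub_le e w v 1
  rw [hev] at h0 h1
  simp only [PiLp.single_apply, zero_ne_one, if_false, sub_zero, if_true] at h0 h1
  have h2 := IsLipschitzDomain.le_of_mem_closure hφ.continuous hU hch hyU hy
  have h3 : φ (e (y + s • w) 0) ≤ φ (e y 0) + K * (s * δ) := by
    have := hφ.dist_le_mul (e (y + s • w) 0) (e y 0)
    rw [Real.dist_eq, Real.dist_eq] at this
    have h4 : |e (y + s • w) 0 - e y 0| ≤ s * δ := by
      simp only [map_add, map_smul, PiLp.add_apply, PiLp.smul_apply, smul_eq_mul,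
        add_sub_cancel_left, abs_mul, abs_of_pos hs.1]
      exact mul_le_mul_of_nonneg_left (h0.trans hw.le) hs.1.le
    have h5 := mul_le_mul_of_nonneg_left h4 K.2
    have h6 := le_abs_self (φ (e (y + s • w) 0) - φ (e y 0))
    change (K : ℝ) * |e (y + s • w) 0 - e y 0| ≤ K * (s * δ) at h5
    linarith
  have h4 : e (y + s • w) 1 = e y 1 + s * e w 1 := by simp
  rw [h4]
  have h5 : 1 - δ < e w 1 := by have := (abs_le.1 h1).1; linarith
  have h6 : K * δ ≤ 1 - 2 * δ := by linarith
  have h7 := mul_lt_mul_of_pos_left h5 hs.1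
  have h8 := mul_le_mul_of_nonneg_left h6 hs.1.le
  nlinarith [mul_pos hs.1 hδ0]

lemma IsLipschitzDomain.hausdorffMeasure_frontier_lt_top {Ω : Set E2} (h : IsLipschitzDomain Ω) :
    μH[1] (frontier Ω) < ∞ := by
  have hcpt : IsCompact (frontier Ω) :=
    Metric.isCompact_of_isClosed_isBounded isClosed_frontier
      (h.2.2.1.closure.subset frontier_subset_closure)
  refine hcpt.measure_lt_top_of_nhdsWithin fun x hx => ?_
  obtain ⟨e, K, φ, U, hφ, hU, hxU, hch⟩ := h.2.2.2 x hx
  obtain ⟨r, hr, hrU⟩ := Metric.isOpen_iff.1 hU x hxU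
  refine ⟨frontier Ω ∩ ball x r, inter_mem_nhdsWithin _ (ball_mem_nhds x hr), ?_⟩
  set g : ℝ → E2 := fun t =>
    e.symm (EuclideanSpace.single 0 t + EuclideanSpace.single 1 (φ t)) with hg
  have hgl : LipschitzWith (1 + K) g := by
    refine e.symm.lipschitz.comp ?_ |>.weaken (by rw [one_mul])
    refine LipschitzWith.add ?_ ?_
    · refine LipschitzWith.of_dist_le_mul fun s t => ?_
      rw [PiLp.dist_single_same, NNReal.coe_one, one_mul]
    · refine LipschitzWith.of_dist_le_mul fun s t => ?_
      rw [PiLp.dist_single_same]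
      exact hφ.dist_le_mul s t
  have hsub : frontier Ω ∩ ball x r ⊆ g '' Icc (e x 0 - r) (e x 0 + r) := by
    rintro y ⟨hy, hyr⟩
    have hyU := hrU hyr
    have h1 := IsLipschitzDomain.le_of_mem_closure hφ.continuous hU hch hyU hy.1
    have h2 : ¬ φ (e y 0) < e y 1 := fun hlt =>
      hy.2 (h.1.interior_eq.symm ▸ (hch y hyU).2 hlt)
    have h3 : φ (e y 0) = e y 1 := le_antisymm h1 (not_lt.1 h2)
    refine ⟨e y 0, ?_, ?_⟩
    · have h4 := abs_apply_sub_le e y x 0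
      rw [mem_ball, dist_eq_norm] at hyr
      rw [abs_le] at h4
      constructor <;> linarith [h4.1, h4.2]
    · rw [hg]
      simp only
      rw [LinearIsometryEquiv.symm_apply_eq, h3]
      ext i
      fin_cases i <;> simp
  calc μH[1] (frontier Ω ∩ ball x r) ≤ μH[1] (g '' Icc (e x 0 - r) (e x 0 + r)) :=
        measure_mono hsub
    _ ≤ ((1 + K : ℝ≥0) : ℝ≥0∞) ^ (1 : ℝ) * μH[1] (Icc (e x 0 - r) (e x 0 + r)) :=
        hgl.lipschitzOnWith.hausdorffMeasure_image_le zero_le_one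
    _ < ∞ := by
        rw [hausdorffMeasure_real, Real.volume_Icc, ENNReal.rpow_one]
        exact ENNReal.mul_lt_top ENNReal.coe_lt_top ENNReal.ofReal_lt_top

/-- The standard isometry from the Euclidean plane to the complex numbers. -/
def toComplex : E2 ≃ₗᵢ[ℝ] ℂ := Complex.orthonormalBasisOneI.repr.symm

lemma toComplex_apply (x : E2) : toComplex x = x 0 + x 1 * Complex.I :=
  Complex.orthonormalBasisOneI_repr_symm_apply x

lemma toComplex_rotBy (θ : ℝ) (x : E2) :
    toComplex (rotBy θ x) = Complex.exp (θ * Complex.I) * toComplex x := by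
  rw [toComplex_apply, toComplex_apply, Complex.exp_mul_I]
  apply Complex.ext <;> simp [rotBy, Complex.cos_ofReal_re, Complex.sin_ofReal_re]
  all_goals ring

lemma dirEnergy_comp_toComplex (Ω : Set E2) (f : ℂ → ℝ) :
    dirEnergy Ω (f ∘ toComplex) = ∫⁻ z in toComplex '' Ω, (‖fderiv ℝ f z‖₊ : ℝ≥0∞) ^ 2 := by
  rw [dirEnergy, ← toComplex.measurePreserving.setLIntegral_comp_emb
    toComplex.toHomeomorph.measurableEmbedding]
  refine lintegral_congr fun x => ?_
  have h : fderiv ℝ (f ∘ toComplex) x = (fderiv ℝ f (toComplex x)).comp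
      (toComplex.toContinuousLinearEquiv : E2 →L[ℝ] ℂ) :=
    toComplex.toContinuousLinearEquiv.comp_right_fderiv
  have h2 : ‖fderiv ℝ (f ∘ toComplex) x‖ = ‖fderiv ℝ f (toComplex x)‖ := by
    rw [h]
    exact ContinuousLinearMap.opNorm_comp_linearIsometryEquiv _ toComplex
  have h3 : ‖fderiv ℝ (f ∘ toComplex) x‖₊ = ‖fderiv ℝ f (toComplex x)‖₊ := NNReal.eq h2
  rw [h3]

lemma image_toComplex_frontier (Ω : Set E2) :
    toComplex '' frontier Ω = frontier (toComplex '' Ω) :=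
  toComplex.toHomeomorph.image_frontier Ω

lemma setLIntegral_comp_toComplex (Γ : Set E2) (f : ℂ → ℝ≥0∞) :
    ∫⁻ x in Γ, f (toComplex x) ∂μH[1] = ∫⁻ z in toComplex '' Γ, f z ∂μH[1] :=
  (toComplex.toIsometryEquiv.measurePreserving_hausdorffMeasure 1).setLIntegral_comp_emb
    toComplex.toHomeomorph.measurableEmbedding f Γ

lemma inwardCone_image {E F : Type*} [NormedAddCommGroup E] [NormedSpace ℝ E]
    [NormedAddCommGroup F] [NormedSpace ℝ F] (e : E ≃ₗᵢ[ℝ] F) {Ω : Set E} {x v : E}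
    (hv : v ∈ inwardCone Ω x) : e v ∈ inwardCone (e '' Ω) (e x) := by
  obtain ⟨δ, hδ, h⟩ := hv
  refine ⟨δ, hδ, ?_⟩
  have hcl : closure (e '' Ω) = e '' closure Ω := (e.toHomeomorph.image_closure Ω).symm
  rw [hcl]
  rintro _ ⟨y, hy, rfl⟩ hyx w hw s hs
  rw [e.dist_map] at hyx
  have hw' : dist (e.symm w) v < δ := by
    rwa [← e.dist_map, e.apply_symm_apply]
  exact ⟨y + s • e.symm w, h y hy hyx _ hw' s hs, by simp⟩

lemma steklovW_mul_le_of_linearMap {Ω : Set E2} {ρ : E2 → ℝ} {k : ℕ}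
    (Φ : (Fin (k + 1) → ℝ) →ₗ[ℝ] (E2 → ℝ)) (hΦ : ∀ x, ContDiff ℝ (⊤ : ℕ∞) (Φ x))
    {L B : ℝ≥0∞} (hL0 : L ≠ 0) (hL : L ≠ ∞)
    (h : ∀ x ≠ 0, ¬ EqOn (Φ x) 0 (closure Ω) ∧
      dirEnergy Ω (Φ x) * L ≤ B * bdryInt (frontier Ω) ρ (Φ x)) :
    steklovW Ω ρ k * L ≤ B := by
  have hinj : Function.Injective Φ := by
    rw [injective_iff_map_eq_zero]
    intro x hx
    by_contra h0
    exact (h x h0).1 fun z _ => by rw [hx]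
  refine ENNReal.mul_le_of_le_div ?_
  refine iInf_le_of_le (LinearMap.range Φ) (iInf_le_of_le ?_ (iInf_le_of_le ?_
    (iInf_le_of_le ?_ (iInf_le_of_le ?_ ?_))))
  · rw [LinearMap.finrank_range_of_inj hinj]; simp
  · rintro _ ⟨x, rfl⟩
    exact hΦ x
  · rintro f -
    simp
  · rintro _ ⟨x, rfl⟩ hx
    by_contra h0
    exact (h x fun hx0 => h0 (by rw [hx0, map_zero])).1 hx
  · refine iSup_le fun f => iSup_le fun hf => iSup_le fun hf0 => ?_
    obtain ⟨x, rfl⟩ := hf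
    have hx : x ≠ 0 := by
      rintro rfl
      exact hf0 fun z _ => by rw [map_zero]
    refine ENNReal.div_le_of_le_mul ?_
    rw [← ENNReal.mul_div_right_comm, ENNReal.le_div_iff_mul_le (Or.inl hL0) (Or.inl hL)]
    exact (h x hx).2

theorem steklovW_mul_Lweight_le {p k : ℕ} (hp : 2 ≤ p) (hk : k < p) {Ω : Set E2} {ρ : E2 → ℝ}
    (h : MemDp p Ω ρ) :
    steklovW Ω ρ k * Lweight Ω ρ ≤ ENNReal.ofReal (2 * Real.pi * ((k + 1) / 2 : ℕ)) := by
  obtain ⟨hΩ, hsc, hrot, hρ0, ⟨C, hC⟩, -, hρ⟩ := h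
  rcases eq_or_ne (Lweight Ω ρ) 0 with hL0 | hL0
  · rw [hL0, mul_zero]; exact zero_le
  have hL : Lweight Ω ρ ≠ ∞ := by
    refine ne_top_of_le_ne_top (b := ∫⁻ _ in frontier Ω, ENNReal.ofReal C ∂μH[1]) ?_
      (lintegral_mono_ae (hC.mono fun x hx => ENNReal.ofReal_le_ofReal hx))
    rw [setLIntegral_const]
    exact ENNReal.mul_ne_top ENNReal.ofReal_ne_top hΩ.hausdorffMeasure_frontier_lt_top.ne
  set ω : ℂ := Complex.exp (2 * Real.pi * Complex.I / p) with hω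
  have hrotω : ∀ x, toComplex (rotBy (2 * Real.pi / p) x) = ω * toComplex x := fun x => by
    rw [toComplex_rotBy, hω]
    push_cast
    ring_nf
  have hsym : ∀ z ∈ toComplex '' Ω, ω * z ∈ toComplex '' Ω := by
    rintro _ ⟨x, hx, rfl⟩
    exact ⟨rotBy (2 * Real.pi / p) x, hrot ▸ mem_image_of_mem _ hx, hrotω x⟩
  have hfr := image_toComplex_frontier Ω
  set w : ℂ → ℝ≥0∞ := fun z => ENNReal.ofReal (ρ (toComplex.symm z)) with hw
  have hwL : ∫⁻ z in frontier (toComplex '' Ω), w z ∂μH[1] = Lweight Ω ρ := by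
    rw [← hfr, ← setLIntegral_comp_toComplex, Lweight]
    simp [hw]
  have hwsym : ∀ z ∈ frontier (toComplex '' Ω), w (ω * z) = w z := by
    rw [← hfr]
    rintro _ ⟨x, hx, rfl⟩
    rw [hw]
    simp only
    rw [← hrotω, LinearIsometryEquiv.symm_apply_apply, LinearIsometryEquiv.symm_apply_apply,
      hρ x hx]
  refine ENNReal.le_of_forall_pos_le_add fun ε hε _ => ?_
  have hB : 2 * Real.pi * ((k + 1) / 2 : ℕ) < 2 * Real.pi * ((k + 1) / 2 : ℕ) + ε :=
    lt_add_of_pos_right _ hε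
  obtain ⟨Φ, hΦ, hΦe⟩ := exists_test_functions (U := toComplex '' Ω)
    (toComplex.toHomeomorph.isOpenMap _ hΩ.1) (toComplex.toHomeomorph.isSimplyConnected_image.2 hsc)
    (toComplex.lipschitz.isBounded_image hΩ.2.2.1)
    (by
      rw [← hfr]
      rintro _ ⟨x, hx, rfl⟩
      obtain ⟨v, hv⟩ := hΩ.inwardCone_nonempty hx
      exact ⟨_, inwardCone_image toComplex hv⟩)
    hp hk hω hsym hwsym (hwL ▸ hL0) (hwL ▸ hL) hB
  rw [← ENNReal.ofReal_coe_nnreal, ← ENNReal.ofReal_add (by positivity) ε.coe_nonneg]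
  refine steklovW_mul_le_of_linearMap ((LinearMap.funLeft ℝ ℝ toComplex).comp Φ)
    (fun x => (hΦ x).comp toComplex.contDiff) hL0 hL fun x hx => ⟨fun h0 => ?_, ?_⟩
  · refine (hΦe x hx).1 ?_
    rw [← hfr]
    rintro _ ⟨y, hy, rfl⟩
    exact h0 (frontier_subset_closure hy)
  · have h1 := (hΦe x hx).2
    rw [hwL, ← dirEnergy_comp_toComplex] at h1
    refine h1.trans (mul_le_mul_right (le_of_eq ?_) _)
    rw [← hfr, ← setLIntegral_comp_toComplex, bdryInt]
    refine lintegral_congr fun y => ?_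
    rw [hw, ENNReal.ofReal_mul (hρ0 y)]
    simp [LinearMap.funLeft]

/-- The Fourier coefficients (without normalization) of the trace of `f` on the unit circle. -/
def circleCoeff (f : ℂ → ℝ) (n : ℕ) : ℂ :=
  ∫ θ in (-Real.pi)..Real.pi, (f (Complex.exp (θ * Complex.I)) : ℂ) *
    starRingEnd ℂ (Complex.exp (θ * Complex.I)) ^ n

section DiskEnergy

variable {f : ℂ → ℝ}

lemma continuous_circleCoeff_integrand (hf : Continuous f) (n : ℕ) : Continuous fun θ : ℝ =>
    (f (Complex.exp (θ * Complex.I)) : ℂ) * starRingEnd ℂ (Complex.exp (θ * Complex.I)) ^ n :=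
  (Complex.continuous_ofReal.comp (hf.comp continuous_expMulI)).mul
    ((Complex.continuous_conj.comp continuous_expMulI).pow n)

lemma integral_mul_re_mul_pow (hf : Continuous f) (a : ℂ) (n : ℕ) :
    ∫ θ in (-Real.pi)..Real.pi, f (Complex.exp (θ * Complex.I)) *
      (a * Complex.exp (θ * Complex.I) ^ n).re = (a * starRingEnd ℂ (circleCoeff f n)).re := by
  have h1 : ∀ θ : ℝ, f (Complex.exp (θ * Complex.I)) * (a * Complex.exp (θ * Complex.I) ^ n).re
      = (starRingEnd ℂ a * ((f (Complex.exp (θ * Complex.I)) : ℂ) *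
        starRingEnd ℂ (Complex.exp (θ * Complex.I)) ^ n)).re := fun θ => by
    rw [← Complex.re_ofReal_mul, ← Complex.conj_re, map_mul, map_mul, map_pow, Complex.conj_ofReal]
    ring_nf
  simp_rw [h1]
  have h2 : (a * starRingEnd ℂ (circleCoeff f n)).re = (starRingEnd ℂ a * circleCoeff f n).re := by
    rw [← Complex.conj_re, map_mul, Complex.conj_conj]
  rw [h2, circleCoeff, ← intervalIntegral.integral_const_mul]
  have hi := ((continuous_circleCoeff_integrand hf n).const_mul (starRingEnd ℂ a)).intervalIntegrable
    (μ := volume) (-Real.pi) Real.pi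
  exact Complex.reCLM.intervalIntegral_comp_comm hi

/-- The complex polynomial with coefficients `a`, truncated at degree `N`. -/
def truncPoly (a : ℕ → ℂ) (N : ℕ) (z : ℂ) : ℂ := ∑ n ∈ Finset.range N, a n * z ^ n

variable (a : ℕ → ℂ) (N : ℕ)

lemma contDiff_truncPoly : ContDiff ℂ (⊤ : ℕ∞) (truncPoly a N) := by
  unfold truncPoly
  fun_prop

lemma hasDerivAt_truncPoly (z : ℂ) :
    HasDerivAt (truncPoly a N) (deriv (truncPoly a N) z) z :=
  ((contDiff_truncPoly a N).differentiable (by simp) z).hasDerivAt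

lemma mul_deriv_truncPoly (z : ℂ) :
    z * deriv (truncPoly a N) z = truncPoly (fun n => (n : ℂ) * a n) N z := by
  have h : HasDerivAt (truncPoly a N)
      (∑ n ∈ Finset.range N, a n * ((n : ℂ) * z ^ (n - 1))) z := by
    unfold truncPoly
    exact HasDerivAt.fun_sum fun n _ => (hasDerivAt_pow n z).const_mul _
  rw [h.deriv, Finset.mul_sum]
  refine Finset.sum_congr rfl fun n _ => ?_
  rcases n with _ | n
  · simp
  · rw [Nat.add_sub_cancel, pow_succ]
    ring

lemma integral_ball_fderiv_conj_deriv_truncPoly (hf : ContDiff ℝ 1 f) :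
    ∫ z in ball (0 : ℂ) 1, fderiv ℝ f z (starRingEnd ℂ (deriv (truncPoly a N) z))
      = ∑ n ∈ Finset.range N, n * (a n * starRingEnd ℂ (circleCoeff f n)).re := by
  have hcd1 : ContDiff ℂ (⊤ : ℕ∞) (deriv (truncPoly a N)) := (contDiff_truncPoly a N).deriv'
  rw [integral_ball_fderiv_conj hf (fun z => (hcd1.differentiable (by simp) z).hasDerivAt)
    (hcd1.continuous_deriv (by exact_mod_cast le_top))]
  simp_rw [mul_deriv_truncPoly, truncPoly, Complex.re_sum, Finset.mul_sum]
  have hc : ∀ n ∈ Finset.range N, IntervalIntegrable (fun θ : ℝ =>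
      f (Complex.exp (θ * Complex.I)) * ((n : ℂ) * a n * Complex.exp (θ * Complex.I) ^ n).re)
      volume (-Real.pi) Real.pi := fun n _ =>
    ((hf.continuous.comp continuous_expMulI).mul (Complex.continuous_re.comp
      ((continuous_expMulI.pow n).const_mul _))).intervalIntegrable _ _
  rw [intervalIntegral.integral_finsetSum hc]
  refine Finset.sum_congr rfl fun n _ => ?_
  rw [integral_mul_re_mul_pow hf.continuous, mul_assoc, ← Complex.ofReal_natCast,
    Complex.re_ofReal_mul]

lemma circleCoeff_re_truncPoly {n : ℕ} (hn : n ≠ 0) (hnN : n < N) :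
    circleCoeff (fun z => (truncPoly a N z).re) n = Real.pi * a n := by
  set E : ℝ → ℂ := fun θ => Complex.exp (θ * Complex.I) with hE
  have hEc : Continuous E := continuous_expMulI
  have hcc : Continuous fun θ => starRingEnd ℂ (E θ) := Complex.continuous_conj.comp hEc
  have hI : ∀ s t : ℕ, ∫ θ in (-Real.pi)..Real.pi, E θ ^ s * starRingEnd ℂ (E θ) ^ t
      = if s = t then (2 * Real.pi : ℂ) else 0 := by
    intro s t
    split_ifs with h
    · have : ∀ θ, E θ ^ s * starRingEnd ℂ (E θ) ^ t = 1 := fun θ => by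
        rw [h, ← mul_pow, Complex.mul_conj, Complex.normSq_eq_norm_sq,
          Complex.norm_exp_ofReal_mul_I]
        simp
      simp_rw [this]
      rw [intervalIntegral.integral_const, sub_neg_eq_add, Complex.real_smul]
      push_cast
      ring
    · rw [intervalIntegral.integral_of_le (by linarith [Real.pi_pos]),
        integral_expMulI_pow_mul_conj_pow h]
  have h1 : ∀ θ : ℝ, ((truncPoly a N (E θ)).re : ℂ) * starRingEnd ℂ (E θ) ^ n
      = ∑ j ∈ Finset.range N, (a j / 2 * (E θ ^ j * starRingEnd ℂ (E θ) ^ n)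
        + starRingEnd ℂ (a j) / 2 * (E θ ^ 0 * starRingEnd ℂ (E θ) ^ (j + n))) := by
    intro θ
    rw [Complex.re_eq_add_conj, truncPoly, map_sum, ← Finset.sum_add_distrib, Finset.sum_div,
      Finset.sum_mul]
    refine Finset.sum_congr rfl fun j _ => ?_
    rw [map_mul, map_pow]
    ring
  unfold circleCoeff
  change ∫ θ in (-Real.pi)..Real.pi, ((truncPoly a N (E θ)).re : ℂ) * starRingEnd ℂ (E θ) ^ n = _
  simp_rw [h1]
  have hi1 : ∀ (b : ℂ) (s t : ℕ), IntervalIntegrable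
      (fun θ => b * (E θ ^ s * starRingEnd ℂ (E θ) ^ t)) volume (-Real.pi) Real.pi :=
    fun b s t => (continuous_const.mul ((hEc.pow s).mul (hcc.pow t))).intervalIntegrable _ _
  rw [intervalIntegral.integral_finsetSum fun j _ => (hi1 _ _ _).add (hi1 _ _ _),
    Finset.sum_eq_single n]
  · rw [intervalIntegral.integral_add (hi1 _ _ _) (hi1 _ _ _), intervalIntegral.integral_const_mul,
      intervalIntegral.integral_const_mul, hI, hI, if_pos rfl, if_neg (by omega)]
    ring
  · intro j _ hj
    rw [intervalIntegral.integral_add (hi1 _ _ _) (hi1 _ _ _), intervalIntegral.integral_const_mul,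
      intervalIntegral.integral_const_mul, hI, hI, if_neg hj, if_neg (by omega)]
    ring
  · exact fun h => absurd (Finset.mem_range.2 hnN) h

lemma sum_mul_norm_circleCoeff_sq_le (hf : ContDiff ℝ 1 f) :
    Real.pi⁻¹ * ∑ n ∈ Finset.range N, n * ‖circleCoeff f n‖ ^ 2
      ≤ ∫ z in ball (0 : ℂ) 1, ‖fderiv ℝ f z‖ ^ 2 := by
  set a : ℕ → ℂ := fun n => Real.pi⁻¹ * circleCoeff f n with ha
  set Q := deriv (truncPoly a N) with hQ
  have hQc : Continuous Q := (contDiff_truncPoly a N).continuous_deriv (by exact_mod_cast le_top)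
  have h_int : ∀ {g : ℂ → ℝ}, Continuous g → IntegrableOn g (ball (0 : ℂ) 1) := fun hg =>
    (hg.continuousOn.integrableOn_compact (isCompact_closedBall (0 : ℂ) 1)).mono_set
      ball_subset_closedBall
  have hdf : Continuous fun z => fderiv ℝ f z := hf.continuous_fderiv one_ne_zero
  have h1 : ∫ z in ball (0 : ℂ) 1, fderiv ℝ f z (starRingEnd ℂ (Q z))
      = Real.pi⁻¹ * ∑ n ∈ Finset.range N, n * ‖circleCoeff f n‖ ^ 2 := by
    rw [integral_ball_fderiv_conj_deriv_truncPoly a N hf, Finset.mul_sum]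
    refine Finset.sum_congr rfl fun n _ => ?_
    rw [ha]
    simp only
    rw [mul_assoc, Complex.mul_conj, Complex.normSq_eq_norm_sq, ← Complex.ofReal_mul,
      Complex.ofReal_re]
    ring
  have h2 : ∫ z in ball (0 : ℂ) 1, ‖Q z‖ ^ 2
      = Real.pi⁻¹ * ∑ n ∈ Finset.range N, n * ‖circleCoeff f n‖ ^ 2 := by
    have hre : ContDiff ℝ 1 fun z => (truncPoly a N z).re :=
      Complex.reCLM.contDiff.comp (((contDiff_truncPoly a N).restrict_scalars ℝ).of_le
        (by exact_mod_cast le_top))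
    have h3 := integral_ball_fderiv_conj_deriv_truncPoly a N hre
    have h4 : ∀ z, fderiv ℝ (fun z => (truncPoly a N z).re) z (starRingEnd ℂ (Q z))
        = ‖Q z‖ ^ 2 := fun z => by
      have := fderiv_re_comp (G := fun z => z) (hasDerivAt_truncPoly a N z) differentiableAt_id
        (starRingEnd ℂ (Q z))
      rw [this]
      simp only [fderiv_fun_id, ContinuousLinearMap.coe_id', id_eq]
      rw [Complex.mul_conj, Complex.normSq_eq_norm_sq, Complex.ofReal_re]
    rw [← hQ] at h3
    simp_rw [h4] at h3
    rw [h3, Finset.mul_sum]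
    refine Finset.sum_congr rfl fun n hn => ?_
    rcases eq_or_ne n 0 with rfl | h0
    · simp
    · rw [circleCoeff_re_truncPoly a N h0 (Finset.mem_range.1 hn), ha]
      simp only
      rw [← mul_assoc (Real.pi : ℂ), ← Complex.ofReal_mul, mul_inv_cancel₀ Real.pi_ne_zero,
        Complex.ofReal_one, one_mul, mul_assoc, Complex.mul_conj, Complex.normSq_eq_norm_sq,
        ← Complex.ofReal_mul, Complex.ofReal_re]
      ring
  have h5 : ∫ z in ball (0 : ℂ) 1, (2 * fderiv ℝ f z (starRingEnd ℂ (Q z)) - ‖Q z‖ ^ 2)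
      ≤ ∫ z in ball (0 : ℂ) 1, ‖fderiv ℝ f z‖ ^ 2 := by
    refine integral_mono (h_int ?_) (h_int (hdf.norm.pow 2)) fun z => ?_
    · exact ((hdf.clm_apply (Complex.continuous_conj.comp hQc)).const_mul 2).sub (hQc.norm.pow 2)
    · have h6 := (le_abs_self _).trans ((fderiv ℝ f z).le_opNorm (starRingEnd ℂ (Q z)))
      rw [RCLike.norm_conj] at h6
      have := sq_nonneg (‖fderiv ℝ f z‖ - ‖Q z‖)
      simp only
      linarith
  rw [integral_sub, integral_const_mul, h1, h2] at h5
  · linarith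
  · exact h_int ((hdf.clm_apply (Complex.continuous_conj.comp hQc)).const_mul 2)
  · exact h_int (hQc.norm.pow 2)

lemma fourierCoeffOn_circle (n : ℕ) :
    fourierCoeffOn (neg_lt_self Real.pi_pos) (fun θ : ℝ => (f (Complex.exp (θ * Complex.I)) : ℂ)) n
      = (2 * Real.pi : ℝ)⁻¹ • circleCoeff f n := by
  rw [fourierCoeffOn_eq_integral, circleCoeff]
  congr 1
  · ring
  · refine intervalIntegral.integral_congr fun θ _ => ?_
    rw [fourier_coe_apply, ← Complex.exp_conj, map_mul, Complex.conj_I, Complex.conj_ofReal,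
      ← Complex.exp_nat_mul, smul_eq_mul, mul_comm]
    congr 2
    push_cast
    have : (Real.pi : ℂ) ≠ 0 := by exact_mod_cast Real.pi_ne_zero
    field_simp
    ring

lemma fourierCoeffOn_circle_neg (n : ℕ) :
    fourierCoeffOn (neg_lt_self Real.pi_pos)
      (fun θ : ℝ => (f (Complex.exp (θ * Complex.I)) : ℂ)) (-n)
      = (2 * Real.pi : ℝ)⁻¹ • starRingEnd ℂ (circleCoeff f n) := by
  rw [fourierCoeffOn_eq_integral, circleCoeff,
    intervalIntegral.integral_of_le (by linarith [Real.pi_pos]),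
    intervalIntegral.integral_of_le (by linarith [Real.pi_pos]), ← integral_conj]
  congr 1
  · ring
  · refine integral_congr_ae (ae_of_all _ fun θ => ?_)
    simp only
    rw [fourier_coe_apply, map_mul, map_pow, Complex.conj_conj, Complex.conj_ofReal,
      ← Complex.exp_nat_mul, smul_eq_mul, mul_comm]
    congr 2
    push_cast
    have : (Real.pi : ℂ) ≠ 0 := by exact_mod_cast Real.pi_ne_zero
    field_simp
    ring

theorem mul_integral_sq_le_integral_fderiv_sq (hf : ContDiff ℝ 1 f) {m : ℕ} (hm : 1 ≤ m)
    (h0 : ∀ n < m, circleCoeff f n = 0) :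
    m * ∫ θ in (-Real.pi)..Real.pi, f (Complex.exp (θ * Complex.I)) ^ 2
      ≤ ∫ z in ball (0 : ℂ) 1, ‖fderiv ℝ f z‖ ^ 2 := by
  have hcF : Continuous fun θ : ℝ => (f (Complex.exp (θ * Complex.I)) : ℂ) :=
    Complex.continuous_ofReal.comp (hf.continuous.comp continuous_expMulI)
  have hL2 : MemLp (fun θ : ℝ => (f (Complex.exp (θ * Complex.I)) : ℂ)) 2
      (volume.restrict (Ioc (-Real.pi) Real.pi)) := by
    obtain ⟨C, hC⟩ := (isCompact_Icc (a := -Real.pi) (b := Real.pi)).exists_bound_of_continuousOn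
      hcF.continuousOn
    refine MemLp.of_bound hcF.aestronglyMeasurable C ?_
    filter_upwards [ae_restrict_mem measurableSet_Ioc] with θ hθ
    exact hC θ (Ioc_subset_Icc_self hθ)
  have hsum := (hasSum_sq_fourierCoeffOn (neg_lt_self Real.pi_pos) hL2).nat_add_neg
  simp only [fourierCoeffOn_circle_neg, fourierCoeffOn_circle, norm_smul, RCLike.norm_conj] at hsum
  have hz : fourierCoeffOn (neg_lt_self Real.pi_pos)
      (fun θ : ℝ => (f (Complex.exp (θ * Complex.I)) : ℂ)) 0 = 0 := by
    have := fourierCoeffOn_circle (f := f) 0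
    rw [h0 0 (by omega), smul_zero] at this
    exact_mod_cast this
  rw [hz] at hsum
  simp only [norm_zero, Complex.norm_real, Real.norm_eq_abs, sq_abs, smul_eq_mul] at hsum
  have hlim := hsum.tendsto_sum_nat
  have hle := le_of_tendsto' hlim (b := (2 * Real.pi)⁻¹ * (m : ℝ)⁻¹ *
    ∫ z in ball (0 : ℂ) 1, ‖fderiv ℝ f z‖ ^ 2) fun N => ?_
  · have hm0 : (0 : ℝ) < m := by exact_mod_cast hm
    have hpi := Real.pi_pos
    have h2 : (Real.pi - -Real.pi)⁻¹ = (2 * Real.pi)⁻¹ := by ring_nf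
    rw [h2] at hle
    have h3 := mul_le_mul_of_nonneg_left hle (by positivity : 0 ≤ 2 * Real.pi * m)
    generalize (∫ θ in (-Real.pi)..Real.pi, f (Complex.exp (θ * Complex.I)) ^ 2) = I at h3 ⊢
    generalize (∫ z in ball (0 : ℂ) 1, ‖fderiv ℝ f z‖ ^ 2) = J at h3 ⊢
    field_simp at h3
    linarith
  · have hm0 : (0 : ℝ) < m := by exact_mod_cast hm
    have hpi := Real.pi_pos
    have h1 := sum_mul_norm_circleCoeff_sq_le N hf
    have h2 : m * ∑ n ∈ Finset.range N, ‖circleCoeff f n‖ ^ 2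
        ≤ ∑ n ∈ Finset.range N, n * ‖circleCoeff f n‖ ^ 2 := by
      rw [Finset.mul_sum]
      refine Finset.sum_le_sum fun n _ => ?_
      rcases lt_or_ge n m with h | h
      · simp [h0 n h]
      · gcongr
    calc ∑ n ∈ Finset.range N, ((‖(2 * Real.pi)⁻¹‖ * ‖circleCoeff f n‖) ^ 2 +
          (‖(2 * Real.pi)⁻¹‖ * ‖circleCoeff f n‖) ^ 2)
        = (2 * Real.pi)⁻¹ * (m : ℝ)⁻¹ * (Real.pi⁻¹ *
          (m * ∑ n ∈ Finset.range N, ‖circleCoeff f n‖ ^ 2)) := by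
          rw [Real.norm_of_nonneg (by positivity), Finset.mul_sum, Finset.mul_sum, Finset.mul_sum]
          refine Finset.sum_congr rfl fun n _ => ?_
          field_simp
          ring
      _ ≤ (2 * Real.pi)⁻¹ * (m : ℝ)⁻¹ * (Real.pi⁻¹ *
          ∑ n ∈ Finset.range N, n * ‖circleCoeff f n‖ ^ 2) := by gcongr
      _ ≤ _ := by gcongr

end DiskEnergy

section DiskLowerBound

variable {g : ℂ → ℝ}

lemma setLIntegral_sphere_ofReal_sq (hg : Continuous g) :
    ∫⁻ z in sphere (0 : ℂ) 1, ENNReal.ofReal (g z ^ 2) ∂μH[1]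
      = ENNReal.ofReal (∫ θ in (-Real.pi)..Real.pi, g (Complex.exp (θ * Complex.I)) ^ 2) := by
  have hc : Continuous fun θ : ℝ => g (Complex.exp (θ * Complex.I)) ^ 2 :=
    (hg.comp continuous_expMulI).pow 2
  have hm : Measurable fun z => ENNReal.ofReal (g z ^ 2) := (hg.pow 2).measurable.ennreal_ofReal
  rw [setLIntegral_sphere hm,
    intervalIntegral.integral_of_le (by linarith [Real.pi_pos]),
    ofReal_integral_eq_lintegral_ofReal _ (ae_of_all _ fun θ => sq_nonneg _)]
  exact (hc.intervalIntegrable (-Real.pi) Real.pi).1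

lemma setLIntegral_ball_fderiv_sq (hg : ContDiff ℝ 1 g) :
    ∫⁻ z in ball (0 : ℂ) 1, (‖fderiv ℝ g z‖₊ : ℝ≥0∞) ^ 2
      = ENNReal.ofReal (∫ z in ball (0 : ℂ) 1, ‖fderiv ℝ g z‖ ^ 2) := by
  have hc : Continuous fun z => ‖fderiv ℝ g z‖ ^ 2 := (hg.continuous_fderiv one_ne_zero).norm.pow 2
  rw [ofReal_integral_eq_lintegral_ofReal
    ((hc.continuousOn.integrableOn_compact (isCompact_closedBall (0 : ℂ) 1)).mono_set
      ball_subset_closedBall) (ae_of_all _ fun θ => sq_nonneg _)]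
  refine lintegral_congr fun z => ?_
  rw [ENNReal.ofReal_pow (norm_nonneg _), ofReal_norm, enorm_eq_nnnorm]

lemma mul_setLIntegral_sphere_le (hg : ContDiff ℝ 1 g) {m : ℕ} (hm : 1 ≤ m)
    (h0 : ∀ n < m, circleCoeff g n = 0) :
    m * ∫⁻ z in sphere (0 : ℂ) 1, ENNReal.ofReal (g z ^ 2) ∂μH[1]
      ≤ ∫⁻ z in ball (0 : ℂ) 1, (‖fderiv ℝ g z‖₊ : ℝ≥0∞) ^ 2 := by
  rw [setLIntegral_sphere_ofReal_sq hg.continuous, setLIntegral_ball_fderiv_sq hg,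
    ← ENNReal.ofReal_natCast, ← ENNReal.ofReal_mul (by positivity)]
  exact ENNReal.ofReal_le_ofReal (mul_integral_sq_le_integral_fderiv_sq hg hm h0)

lemma eqOn_zero_of_setLIntegral_fderiv_eq_zero (hg : ContDiff ℝ 1 g) (h0 : circleCoeff g 0 = 0)
    (h : ∫⁻ z in ball (0 : ℂ) 1, (‖fderiv ℝ g z‖₊ : ℝ≥0∞) ^ 2 = 0) :
    EqOn g 0 (closedBall 0 1) := by
  have hc : Continuous fun z => fderiv ℝ g z := hg.continuous_fderiv one_ne_zero
  have hz : EqOn (fderiv ℝ g) 0 (ball (0 : ℂ) 1) := by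
    refine Measure.eqOn_open_of_ae_eq (μ := volume) ?_ isOpen_ball hc.continuousOn
      continuousOn_const
    rw [lintegral_eq_zero_iff (by fun_prop)] at h
    filter_upwards [h] with z hz
    simpa using hz
  have hconst : EqOn g (fun _ => g 0) (closedBall 0 1) := by
    rw [← closure_ball (0 : ℂ) one_ne_zero]
    refine EqOn.closure (fun z hz' => ?_) hg.continuous continuous_const
    exact isOpen_ball.is_const_of_fderiv_eq_zero (convex_ball (0 : ℂ) 1).isPreconnected
      (hg.differentiable one_ne_zero).differentiableOn hz hz' (mem_ball_self one_pos)
  have hg0 : g 0 = 0 := by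
    have : circleCoeff g 0 = ∫ θ in (-Real.pi)..Real.pi, (g 0 : ℂ) := by
      refine intervalIntegral.integral_congr fun θ _ => ?_
      have := hconst (sphere_subset_closedBall (expMulI_mem_sphere θ))
      simp only [pow_zero, mul_one, this]
    rw [h0, intervalIntegral.integral_const, eq_comm, smul_eq_zero] at this
    rcases this with h | h
    · linarith [Real.pi_pos]
    · exact_mod_cast h
  intro z hz'
  rw [hconst hz', hg0, Pi.zero_apply]

lemma circleCoeff_add {f : ℂ → ℝ} (hf : Continuous f) (hg : Continuous g) (n : ℕ) :
    circleCoeff (f + g) n = circleCoeff f n + circleCoeff g n := by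
  have hI : ∀ {h : ℂ → ℝ}, Continuous h → IntervalIntegrable
      (fun θ : ℝ => (h (Complex.exp (θ * Complex.I)) : ℂ) *
        starRingEnd ℂ (Complex.exp (θ * Complex.I)) ^ n) volume (-Real.pi) Real.pi := fun hh =>
    ((Complex.continuous_ofReal.comp (hh.comp continuous_expMulI)).mul
      ((Complex.continuous_conj.comp continuous_expMulI).pow n)).intervalIntegrable _ _
  rw [circleCoeff, circleCoeff, circleCoeff, ← intervalIntegral.integral_add (hI hf) (hI hg)]
  refine intervalIntegral.integral_congr fun θ _ => ?_
  simp only [Pi.add_apply, Complex.ofReal_add, add_mul]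

lemma circleCoeff_smul (c : ℝ) (n : ℕ) : circleCoeff (c • g) n = c • circleCoeff g n := by
  rw [circleCoeff, circleCoeff, ← intervalIntegral.integral_smul]
  refine intervalIntegral.integral_congr fun θ _ => ?_
  simp only [Pi.smul_apply, smul_eq_mul, Complex.ofReal_mul, Complex.real_smul, mul_assoc]

lemma circleCoeff_zero_im : (circleCoeff g 0).im = 0 := by
  simp only [circleCoeff, pow_zero, mul_one]
  rw [intervalIntegral.integral_ofReal, Complex.ofReal_im]

/-- A space of dimension at least `2 * m` contains a nonzero function whose trace on the circle
is orthogonal to the trigonometric polynomials of degree less than `m`. -/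
lemma exists_ne_zero_circleCoeff_eq_zero (V : Submodule ℝ (E2 → ℝ)) [FiniteDimensional ℝ V]
    (hV : ∀ f ∈ V, Continuous f) {m : ℕ} (hm : 1 ≤ m) (hdim : 2 * m ≤ Module.finrank ℝ V) :
    ∃ f ∈ V, f ≠ 0 ∧ ∀ n < m, circleCoeff (f ∘ toComplex.symm) n = 0 := by
  have hcont : ∀ f : V, Continuous (f.1 ∘ toComplex.symm) := fun f =>
    (hV f.1 f.2).comp toComplex.symm.continuous
  let T : V →ₗ[ℝ] ℝ × (Fin (m - 1) → ℂ) :=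
    { toFun := fun f => ((circleCoeff (f.1 ∘ toComplex.symm) 0).re,
        fun i => circleCoeff (f.1 ∘ toComplex.symm) (i + 1))
      map_add' := fun f g => by
        have h := fun n => circleCoeff_add (hcont f) (hcont g) n
        ext i
        · exact congrArg Complex.re (h 0)
        · exact h (i + 1)
      map_smul' := fun c f => by
        have h := fun n => circleCoeff_smul (g := f.1 ∘ toComplex.symm) c n
        ext i
        · exact (congrArg Complex.re (h 0)).trans (Complex.smul_re c _)
        · exact h (i + 1) }
  have hker : LinearMap.ker T ≠ ⊥ := by
    refine LinearMap.ker_ne_bot_of_finrank_lt ?_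
    rw [Module.finrank_prod, Module.finrank_pi_fintype, Module.finrank_self]
    simp only [Complex.finrank_real_complex, Finset.sum_const, Finset.card_univ, Fintype.card_fin,
      smul_eq_mul]
    omega
  obtain ⟨f, hf, hf0⟩ := (Submodule.ne_bot_iff _).1 hker
  have hT : T f = 0 := hf
  refine ⟨f.1, f.2, fun h => hf0 (Subtype.ext h), fun n hn => ?_⟩
  rcases n with _ | n
  · exact Complex.ext (congrArg Prod.fst hT) circleCoeff_zero_im
  · exact congrFun (congrArg Prod.snd hT) ⟨n, by omega⟩

lemma image_toComplex_ball : toComplex '' ball (0 : E2) 1 = ball (0 : ℂ) 1 := by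
  rw [LinearIsometryEquiv.image_ball, map_zero]

lemma image_toComplex_frontier_ball :
    toComplex '' frontier (ball (0 : E2) 1) = sphere (0 : ℂ) 1 := by
  rw [image_toComplex_frontier, image_toComplex_ball, frontier_ball (0 : ℂ) one_ne_zero]

theorem le_steklov_ball {m k : ℕ} (hm : 1 ≤ m) (hmk : 2 * m ≤ k + 1) :
    (m : ℝ≥0∞) ≤ steklov (ball (0 : E2) 1) k := by
  refine le_iInf fun V => le_iInf fun hV => le_iInf fun hsm => le_iInf fun _ => le_iInf fun hV0 => ?_
  have : FiniteDimensional ℝ V := Module.finite_of_finrank_pos (by omega)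
  obtain ⟨f, hfV, hf0, hc⟩ := exists_ne_zero_circleCoeff_eq_zero V
    (fun f hf => (hsm f hf).continuous) hm (by omega)
  set g := f ∘ toComplex.symm with hg
  have hfg : f = g ∘ toComplex := by
    ext x
    simp [hg]
  have hgc : ContDiff ℝ 1 g :=
    ((hsm f hfV).of_le (by exact_mod_cast le_top)).comp toComplex.symm.contDiff
  have hne : ¬ EqOn f 0 (closure (ball (0 : E2) 1)) := fun h => hf0 (hV0 f hfV h)
  refine le_iSup₂_of_le f hfV (le_iSup_of_le hne ?_)
  have hD : dirEnergy (ball (0 : E2) 1) f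
      = ∫⁻ z in ball (0 : ℂ) 1, (‖fderiv ℝ g z‖₊ : ℝ≥0∞) ^ 2 := by
    rw [hfg, dirEnergy_comp_toComplex, image_toComplex_ball]
  have hB : bdryInt (frontier (ball (0 : E2) 1)) (fun _ => 1) f
      = ∫⁻ z in sphere (0 : ℂ) 1, ENNReal.ofReal (g z ^ 2) ∂μH[1] := by
    rw [← image_toComplex_frontier_ball, ← setLIntegral_comp_toComplex, bdryInt, hfg]
    simp only [one_mul, Function.comp_apply]
  rw [rayleigh, ENNReal.le_div_iff_mul_le (Or.inr ?_) (Or.inl ?_), hD, hB]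
  · exact mul_setLIntegral_sphere_le hgc hm hc
  · rw [hD]
    intro h
    refine hne fun x hx => ?_
    rw [closure_ball (0 : E2) one_ne_zero] at hx
    rw [hfg]
    refine eqOn_zero_of_setLIntegral_fderiv_eq_zero hgc (hc 0 hm) h ?_
    simpa using hx
  · rw [hB, setLIntegral_sphere_ofReal_sq hgc.continuous]
    exact ENNReal.ofReal_ne_top

end DiskLowerBound

section UnitDisk

lemma hausdorffMeasure_frontier_ball :
    μH[1] (frontier (ball (0 : E2) 1)) = ENNReal.ofReal (2 * Real.pi) := by
  have h := setLIntegral_comp_toComplex (frontier (ball (0 : E2) 1)) fun _ => 1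
  rw [image_toComplex_frontier_ball, setLIntegral_sphere measurable_const] at h
  simp only [lintegral_const, one_mul, Measure.restrict_apply_univ, Real.volume_Ioc] at h
  rw [h]
  ring_nf

lemma toComplex_re (x : E2) : (toComplex x).re = x 0 := by
  simp [toComplex_apply]

lemma toComplex_im (x : E2) : (toComplex x).im = x 1 := by
  simp [toComplex_apply]

lemma mem_ball_zero_iff_sq (x : E2) : x ∈ ball (0 : E2) 1 ↔ x 0 ^ 2 + x 1 ^ 2 < 1 := by
  rw [mem_ball_zero_iff, ← sq_lt_one_iff₀ (norm_nonneg x), EuclideanSpace.norm_sq_eq,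
    Fin.sum_univ_two]
  simp

lemma exists_linearIsometryEquiv_apply {p : E2} (hp : ‖p‖ = 1) :
    ∃ e : E2 ≃ₗᵢ[ℝ] E2, e p 0 = 0 ∧ e p 1 = -1 := by
  have hz : ‖toComplex p‖ = 1 := by rw [toComplex.norm_map, hp]
  let a : Circle := ⟨-Complex.I * starRingEnd ℂ (toComplex p), mem_sphere_zero_iff_norm.2 (by
    rw [norm_mul, norm_neg, Complex.norm_I, RCLike.norm_conj, hz, one_mul])⟩
  have ha : toComplex ((toComplex.trans ((rotation a).trans toComplex.symm)) p) = -Complex.I := by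
    simp only [LinearIsometryEquiv.trans_apply, LinearIsometryEquiv.apply_symm_apply,
      rotation_apply]
    change -Complex.I * starRingEnd ℂ (toComplex p) * toComplex p = _
    rw [mul_assoc, Complex.conj_mul', hz]
    simp
  refine ⟨toComplex.trans ((rotation a).trans toComplex.symm), ?_, ?_⟩
  · rw [← toComplex_re, ha]
    simp
  · rw [← toComplex_im, ha]
    simp

/-- The lower unit half circle, extended to a Lipschitz graph over the whole line. -/
def lowerArc (t : ℝ) : ℝ :=
  -√(1 - (projIcc (-(1 / 2) : ℝ) (1 / 2) (by norm_num) t : ℝ) ^ 2)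

lemma lipschitzWith_lowerArc : LipschitzWith 1 lowerArc := by
  have hproj := LipschitzWith.projIcc (a := (-(1 / 2) : ℝ)) (b := 1 / 2) (by norm_num)
  refine LipschitzWith.of_dist_le_mul fun s t => ?_
  have h1 : dist (projIcc (-(1 / 2) : ℝ) (1 / 2) (by norm_num) s : ℝ)
      (projIcc (-(1 / 2) : ℝ) (1 / 2) (by norm_num) t) ≤ (1 : ℝ≥0) * dist s t :=
    hproj.dist_le_mul s t
  refine le_trans ?_ h1
  have hs := (projIcc (-(1 / 2) : ℝ) (1 / 2) (by norm_num) s).2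
  have ht := (projIcc (-(1 / 2) : ℝ) (1 / 2) (by norm_num) t).2
  rw [lowerArc, lowerArc]
  generalize (projIcc (-(1 / 2) : ℝ) (1 / 2) (by norm_num) s : ℝ) = a at hs ⊢
  generalize (projIcc (-(1 / 2) : ℝ) (1 / 2) (by norm_num) t : ℝ) = b at ht ⊢
  have half_le : ∀ c : ℝ, c ∈ Icc (-(1 / 2) : ℝ) (1 / 2) → 1 / 2 ≤ √(1 - c ^ 2) := fun c hc =>
    Real.le_sqrt_of_sq_le (by nlinarith [hc.1, hc.2])
  have ha := half_le a hs
  have hb := half_le b ht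
  have ha2 : √(1 - a ^ 2) ^ 2 = 1 - a ^ 2 := Real.sq_sqrt (by nlinarith [hs.1, hs.2])
  have hb2 : √(1 - b ^ 2) ^ 2 = 1 - b ^ 2 := Real.sq_sqrt (by nlinarith [ht.1, ht.2])
  rw [Real.dist_eq, Real.dist_eq]
  have hprod : |-√(1 - a ^ 2) - -√(1 - b ^ 2)| * |√(1 - a ^ 2) + √(1 - b ^ 2)|
      = |a - b| * |a + b| := by
    rw [← abs_mul, ← abs_mul]
    congr 1
    linear_combination hb2 - ha2
  have h2 : 1 ≤ |√(1 - a ^ 2) + √(1 - b ^ 2)| := (by linarith : (1 : ℝ) ≤ _).trans (le_abs_self _)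
  have h3 : |a + b| ≤ 1 := abs_le.2 ⟨by linarith [hs.1, ht.1], by linarith [hs.2, ht.2]⟩
  calc _ ≤ _ := le_mul_of_one_le_right (abs_nonneg _) h2
    _ = _ := hprod
    _ ≤ _ := mul_le_of_le_one_right (abs_nonneg _) h3

lemma lowerArc_lt_iff {t y : ℝ} (ht : |t| < 1 / 2) (hy : y < 0) :
    lowerArc t < y ↔ t ^ 2 + y ^ 2 < 1 := by
  have h := abs_lt.1 ht
  rw [lowerArc, projIcc_of_mem _ ⟨h.1.le, h.2.le⟩, neg_lt, Real.lt_sqrt (by linarith)]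
  constructor <;> intro h <;> linarith

lemma isLipschitzDomain_ball : IsLipschitzDomain (ball (0 : E2) 1) := by
  refine ⟨isOpen_ball, (convex_ball _ _).isConnected ⟨0, mem_ball_self one_pos⟩,
    isBounded_ball, fun p hp => ?_⟩
  rw [frontier_ball (0 : E2) one_ne_zero, mem_sphere_zero_iff_norm] at hp
  obtain ⟨e, he0, he1⟩ := exists_linearIsometryEquiv_apply hp
  have hcoord : ∀ i, Continuous fun x : E2 => e x i := fun i =>
    (EuclideanSpace.proj (𝕜 := ℝ) i).continuous.comp e.continuous
  refine ⟨e, 1, lowerArc, {x | |e x 0| < 1 / 2} ∩ {x | e x 1 < 0}, lipschitzWith_lowerArc,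
    (isOpen_lt (hcoord 0).abs continuous_const).inter (isOpen_lt (hcoord 1) continuous_const),
    ⟨?_, ?_⟩, fun x hx => ?_⟩
  · simp [he0]
  · simp [he1]
  · rw [lowerArc_lt_iff hx.1 hx.2, ← mem_ball_zero_iff_sq, mem_ball_zero_iff, mem_ball_zero_iff,
      e.norm_map]

lemma image_rotBy_ball (θ : ℝ) : rotBy θ '' ball (0 : E2) 1 = ball (0 : E2) 1 := by
  have hnorm : ∀ (θ : ℝ) x, ‖rotBy θ x‖ = ‖x‖ := fun θ x => by
    rw [← toComplex.norm_map, toComplex_rotBy, norm_mul, Complex.norm_exp_ofReal_mul_I, one_mul,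
      toComplex.norm_map]
  ext x
  constructor
  · rintro ⟨y, hy, rfl⟩
    rw [mem_ball_zero_iff] at hy ⊢
    rwa [hnorm]
  · intro hx
    refine ⟨rotBy (-θ) x, ?_, toComplex.injective ?_⟩
    · rw [mem_ball_zero_iff] at hx ⊢
      rwa [hnorm]
    · rw [toComplex_rotBy, toComplex_rotBy, ← mul_assoc, ← Complex.exp_add]
      simp

lemma memDp_ball (p : ℕ) : MemDp p (ball (0 : E2) 1) fun _ => 1 := by
  refine ⟨isLipschitzDomain_ball, ?_, image_rotBy_ball _, fun _ => zero_le_one,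
    ⟨1, ae_of_all _ fun _ => le_rfl⟩, ?_, fun _ _ => rfl⟩
  · have : ContractibleSpace (ball (0 : E2) 1) :=
      (convex_ball _ _).contractibleSpace ⟨0, mem_ball_self one_pos⟩
    infer_instance
  · simp only [zero_lt_one, and_true, ofPred_mem_eq]
    rw [hausdorffMeasure_frontier_ball, ENNReal.ofReal_pos]
    positivity

lemma Lweight_ball : Lweight (ball (0 : E2) 1) (fun _ => 1) = ENNReal.ofReal (2 * Real.pi) := by
  simp [Lweight, hausdorffMeasure_frontier_ball]

theorem steklovW_ball_mul_Lweight {p k : ℕ} (hp : 2 ≤ p) (hk1 : 1 ≤ k) (hk : k < p) :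
    steklovW (ball (0 : E2) 1) (fun _ => 1) k * Lweight (ball (0 : E2) 1) (fun _ => 1)
      = ENNReal.ofReal (2 * Real.pi * ((k + 1) / 2 : ℕ)) := by
  refine le_antisymm (steklovW_mul_Lweight_le hp hk (memDp_ball p)) ?_
  rw [mul_comm, Lweight_ball, ENNReal.ofReal_mul (by positivity), ENNReal.ofReal_natCast]
  have h : (((k + 1) / 2 : ℕ) : ℝ≥0∞) ≤ steklovW (ball (0 : E2) 1) (fun _ => 1) k :=
    le_steklov_ball (by omega) (by omega)
  gcongr

end UnitDisk

theorem statement6 (p k : ℕ) (hp : 2 ≤ p) (hk1 : 1 ≤ k) (hk2 : k ≤ p - 1) :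
    SigmaP p k = ENNReal.ofReal (2 * Real.pi * (((k + 1) / 2 : ℕ) : ℝ))
    ∧ (Odd k → SigmaP p k = ENNReal.ofReal (((k : ℝ) + 1) * Real.pi))
    ∧ (Even k → SigmaP p k = ENNReal.ofReal ((k : ℝ) * Real.pi))
    ∧ steklov (Metric.ball (0 : E2) 1) k * μH[1] (frontier (Metric.ball (0 : E2) 1))
        = ENNReal.ofReal (2 * Real.pi * (((k + 1) / 2 : ℕ) : ℝ)) := by
  have hk : k < p := by omega
  have hball := steklovW_ball_mul_Lweight hp hk1 hk
  have hSigma : SigmaP p k = ENNReal.ofReal (2 * Real.pi * (((k + 1) / 2 : ℕ) : ℝ)) := by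
    refine le_antisymm (iSup_le fun Ω => iSup_le fun ρ => iSup_le fun h =>
      steklovW_mul_Lweight_le hp hk h) ?_
    rw [← hball]
    exact le_iSup₂_of_le _ _ (le_iSup_of_le (memDp_ball p) le_rfl)
  refine ⟨hSigma, fun hodd => ?_, fun heven => ?_, ?_⟩
  · obtain ⟨j, rfl⟩ := hodd
    rw [hSigma, show (2 * j + 1 + 1) / 2 = j + 1 by omega]
    push_cast
    ring_nf
  · obtain ⟨j, rfl⟩ := heven
    rw [hSigma, show (j + j + 1) / 2 = j by omega]
    push_cast
    ring_nf
  · rw [hausdorffMeasure_frontier_ball, ← Lweight_ball]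
    exact hball

end
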